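/- arXiv:1301.5895 — 2 statements merged into one kernel-verified Lean document; each statement's English description precedes it below -/
import Mathlib

section
/- The ball B⁵ is extensible: there exists an origin-symmetric convex body K in ℝ⁵ properly containing B⁵ such that d_K = d_{B⁵}, where d_K is the critical covering determinant of K. -/
open Set Pointwise MeasureTheory

noncomputable section

abbrev Euc (n : ℕ) := EuclideanSpace ℝ (Fin n)

/-- An origin-symmetric convex body in `ℝⁿ`: compact, convex, nonempty interior, `K = -K`. -/
def IsSymmConvexBody {n : ℕ} (K : Set (Euc n)) : Prop :=
  IsCompact K ∧ Convex ℝ K ∧ (interior K).Nonempty ∧ K = -K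

/-- The closed Euclidean unit ball `Bⁿ`. -/
def unitBall (n : ℕ) : Set (Euc n) := Metric.closedBall 0 1

/-- The set of integer points `ℤⁿ ⊆ ℝⁿ`. -/
def intPoints (n : ℕ) : Set (Euc n) := {x | ∀ i, ∃ m : ℤ, x i = (m : ℝ)}

/-- The lattice `Λ = T(ℤⁿ)` is a covering lattice for `K`:
the translates of `K` by lattice vectors cover all of `ℝⁿ`. -/
def IsCoveringLattice {n : ℕ} (T : Euc n →ₗ[ℝ] Euc n) (K : Set (Euc n)) : Prop :=
  (⋃ l ∈ T '' intPoints n, (l +ᵥ K)) = Set.univ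

/-- The critical covering determinant `d_K`: the supremum of the determinants
`d(Λ) = |det T|` over all covering lattices `Λ = T(ℤⁿ)` of `K`. -/
def critCoveringDet {n : ℕ} (K : Set (Euc n)) : ℝ :=
  sSup {d | ∃ T : Euc n →ₗ[ℝ] Euc n,
    LinearMap.det T ≠ 0 ∧ IsCoveringLattice T K ∧ d = |LinearMap.det T|}

open scoped RealInnerProductSpace

/-- The determinant of five vectors of `ℝ⁵`. -/
def vdet (f : Fin 5 → Euc 5) : ℝ := Matrix.det (Matrix.of fun i j => f i j)

lemma vdet_comb (R : Matrix (Fin 5) (Fin 5) ℝ) (f : Fin 5 → Euc 5) :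
    vdet (fun i => ∑ j, R i j • f j) = R.det * vdet f := by
  unfold vdet
  rw [← Matrix.det_mul]
  congr 1

lemma Matrix.PosSemidef.det_le_trace_pow {G : Matrix (Fin 5) (Fin 5) ℝ} (hG : G.PosSemidef) :
    G.det ≤ (G.trace / 5) ^ 5 := by
  have h := Real.geom_mean_le_arith_mean Finset.univ (fun _ => 1) hG.isHermitian.eigenvalues
    (by simp) (by simp) (fun i _ => hG.eigenvalues_nonneg i)
  have hd : G.det = ∏ i, hG.isHermitian.eigenvalues i := by
    simpa using hG.isHermitian.det_eq_prod_eigenvalues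
  have ht : G.trace = ∑ i, hG.isHermitian.eigenvalues i := by
    simpa using hG.isHermitian.trace_eq_sum_eigenvalues
  have h0 : 0 ≤ G.det := hG.det_nonneg
  simp only [Real.rpow_one, one_mul, ← hd, ← ht] at h
  norm_num at h
  calc G.det = (G.det ^ (1 / 5 : ℝ)) ^ 5 := by
        rw [← Real.rpow_natCast, ← Real.rpow_mul h0]; norm_num
    _ ≤ _ := by gcongr

lemma vdet_sq_le (f : Fin 5 → Euc 5) : vdet f ^ 2 ≤ ((∑ i, ‖f i‖ ^ 2) / 5) ^ 5 := by
  set A : Matrix (Fin 5) (Fin 5) ℝ := Matrix.of fun i j => f i j with hA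
  have h := (Matrix.posSemidef_self_mul_conjTranspose A).det_le_trace_pow
  have h1 : (A * A.conjTranspose).det = vdet f ^ 2 := by
    rw [Matrix.det_mul, Matrix.det_conjTranspose]; simp [vdet, hA, sq]
  have h2 : (A * A.conjTranspose).trace = ∑ i, ‖f i‖ ^ 2 := by
    simp [Matrix.trace, Matrix.mul_apply, EuclideanSpace.norm_sq_eq, hA, ← sq]
  rwa [h1, h2] at h

lemma vdet_quad {P : Matrix (Fin 5) (Fin 5) ℝ} (hP : P.PosSemidef) (f : Fin 5 → Euc 5) :
    P.det * vdet f ^ 2 ≤ ((∑ i, ∑ j, P i j * ⟪f i, f j⟫) / 5) ^ 5 := by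
  obtain ⟨B, rfl⟩ : ∃ B : Matrix (Fin 5) (Fin 5) ℝ, P = B.conjTranspose * B := by
    open scoped MatrixOrder in
    exact CStarAlgebra.nonneg_iff_eq_star_mul_self.mp hP.nonneg
  have h := vdet_sq_le (fun i => ∑ j, B i j • f j)
  rw [vdet_comb] at h
  convert h using 1
  · simp; ring
  · congr 2
    have hk : ∀ k, ‖∑ j, B k j • f j‖ ^ 2 = ∑ i, ∑ j, B k i * B k j * ⟪f i, f j⟫ := fun k => by
      simp only [← real_inner_self_eq_norm_sq, sum_inner, inner_sum, inner_smul_left,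
        inner_smul_right, RCLike.conj_to_real, Finset.mul_sum]
      exact Finset.sum_congr rfl fun i _ => Finset.sum_congr rfl fun j _ => by
        rw [real_inner_comm]; ring
    simp only [hk, Matrix.mul_apply, Matrix.conjTranspose_apply, star_trivial, Finset.sum_mul]
    rw [Finset.sum_comm (γ := Fin 5) (s := Finset.univ) (t := Finset.univ)
      (f := fun k i => ∑ j, B k i * B k j * ⟪f i, f j⟫)]
    exact Finset.sum_congr rfl fun i _ => Finset.sum_comm

lemma exists_inner_eq {f : Fin 5 → Euc 5} (hf : vdet f ≠ 0) (c : Fin 5 → ℝ) :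
    ∃ a : Euc 5, ∀ i, ⟪a, f i⟫ = c i := by
  set A : Matrix (Fin 5) (Fin 5) ℝ := Matrix.of fun i j => f i j with hA
  have hu : IsUnit A.det := isUnit_iff_ne_zero.mpr hf
  refine ⟨WithLp.toLp 2 (A⁻¹.mulVec c), fun i => ?_⟩
  have h : A.mulVec (A⁻¹.mulVec c) = c := by
    rw [Matrix.mulVec_mulVec, Matrix.mul_nonsing_inv _ hu, Matrix.one_mulVec]
  have := congrFun h i
  rw [← this]
  simp [PiLp.inner_apply, Matrix.mulVec, dotProduct, hA]

/-- Five vectors generating the lattice `T(ℤ⁵)` have the determinant of that lattice. -/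
lemma abs_vdet_eq {T : Euc 5 →ₗ[ℝ] Euc 5} (hT : LinearMap.det T ≠ 0) {B : Fin 5 → Euc 5}
    (hB : ∀ i, B i ∈ T '' intPoints 5)
    (hg : ∀ x ∈ T '' intPoints 5, ∃ n : Fin 5 → ℤ, x = ∑ i, (n i : ℝ) • B i) :
    |vdet B| = |LinearMap.det T| := by
  classical
  set b := (EuclideanSpace.basisFun (Fin 5) ℝ).toBasis
  have hTe : vdet (fun i => T (b i)) = LinearMap.det T := by
    rw [← LinearMap.det_toMatrix b, ← Matrix.det_transpose]
    unfold vdet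
    congr 1
    ext i j
    simp [LinearMap.toMatrix_apply, b]
  have hx : ∀ x : Euc 5, x = ∑ i, x i • b i := fun x => by
    conv_lhs => rw [← b.sum_repr x]
    simp [b]
  have h1 : ∀ i, ∃ n : Fin 5 → ℤ, B i = ∑ j, (n j : ℝ) • T (b j) := fun i => by
    obtain ⟨x, hx', hxi⟩ := hB i
    choose n hn using hx'
    refine ⟨n, ?_⟩
    rw [← hxi, hx x, map_sum]
    simp [hn]
  have h2 : ∀ i, ∃ n : Fin 5 → ℤ, T (b i) = ∑ j, (n j : ℝ) • B j := fun i =>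
    hg _ ⟨b i, fun j => ⟨if i = j then 1 else 0, by simp [b, eq_comm]⟩, rfl⟩
  choose M hM using h1
  choose N hN using h2
  have e1 := vdet_comb (Matrix.of fun i j => (M i j : ℝ)) (fun i => T (b i))
  have e2 := vdet_comb (Matrix.of fun i j => (N i j : ℝ)) B
  simp only [Matrix.of_apply, ← hM, ← hN] at e1 e2
  have c1 : (Matrix.of fun i j => (M i j : ℝ)).det = ((Matrix.of M).det : ℤ) := by
    rw [Int.cast_det]; rfl
  have c2 : (Matrix.of fun i j => (N i j : ℝ)).det = ((Matrix.of N).det : ℤ) := by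
    rw [Int.cast_det]; rfl
  rw [c1] at e1
  rw [c2] at e2
  rw [hTe] at e1 e2
  have hu : (Matrix.of N).det * (Matrix.of M).det = 1 := by
    have : ((Matrix.of N).det * (Matrix.of M).det : ℝ) = 1 := by
      apply mul_right_cancel₀ hT
      rw [one_mul, mul_assoc, ← e1, ← e2]
    exact_mod_cast this
  have hM1 : |((Matrix.of M).det : ℝ)| = 1 := by
    rcases Int.isUnit_iff.mp (IsUnit.of_mul_eq_one_right _ hu) with h | h <;> simp [h]
  rw [e1, abs_mul, hM1, one_mul]

/-- `b` is a superbase of `Λ`: a zero-sum system of integral generators. -/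
def IsA (Λ : Set (Euc 5)) (b : Fin 6 → Euc 5) : Prop :=
  ∑ i, b i = 0 ∧ ∀ x, x ∈ Λ ↔ ∃ n : Fin 6 → ℤ, x = ∑ i, (n i : ℝ) • b i

/-- `Λ` is the image of `ℤ⁵ ∪ (½ + ℤ)⁵` under the map sending the standard basis to `u`. -/
def IsD (Λ : Set (Euc 5)) (u : Fin 5 → Euc 5) : Prop :=
  ∀ x, x ∈ Λ ↔ ∃ (e : ℤ) (k : Fin 5 → ℤ), x = ∑ i, ((k i : ℝ) + e / 2) • u i

/-- `Λ` consists of the zero-sum combinations of the zero-sum system `w` whose coefficients are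
either all integers or all half-integers. -/
def IsP (Λ : Set (Euc 5)) (w : Fin 6 → Euc 5) : Prop :=
  ∑ i, w i = 0 ∧ ∀ x, x ∈ Λ ↔
    ∃ (e : ℤ) (k : Fin 6 → ℤ), ∑ i, k i + 3 * e = 0 ∧ x = ∑ i, ((k i : ℝ) + e / 2) • w i

section Moves
variable {Λ : Set (Euc 5)}

lemma IsA.perm {b : Fin 6 → Euc 5} (h : IsA Λ b) (σ : Equiv.Perm (Fin 6)) : IsA Λ (b ∘ σ) := by
  refine ⟨by rw [← h.1]; exact Equiv.sum_comp σ b, fun x => (h.2 x).trans ⟨?_, ?_⟩⟩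
  · rintro ⟨n, rfl⟩
    exact ⟨n ∘ σ, (Equiv.sum_comp σ fun i => (n i : ℝ) • b i).symm⟩
  · rintro ⟨n, rfl⟩
    refine ⟨n ∘ σ.symm, ?_⟩
    rw [← Equiv.sum_comp σ fun i => (((n ∘ σ.symm) i : ℤ) : ℝ) • b i]
    simp

lemma IsP.perm {w : Fin 6 → Euc 5} (h : IsP Λ w) (σ : Equiv.Perm (Fin 6)) : IsP Λ (w ∘ σ) := by
  refine ⟨by rw [← h.1]; exact Equiv.sum_comp σ w, fun x => (h.2 x).trans ⟨?_, ?_⟩⟩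
  · rintro ⟨e, n, h0, rfl⟩
    exact ⟨e, n ∘ σ, by rw [← h0, ← Equiv.sum_comp σ n]; rfl,
      (Equiv.sum_comp σ fun i => ((n i : ℝ) + e / 2) • w i).symm⟩
  · rintro ⟨e, n, h0, rfl⟩
    refine ⟨e, n ∘ σ.symm, by rw [← h0, ← Equiv.sum_comp σ.symm n]; rfl, ?_⟩
    rw [← Equiv.sum_comp σ fun i => ((((n ∘ σ.symm) i : ℤ) : ℝ) + e / 2) • w i]
    simp

lemma IsD.perm {u : Fin 5 → Euc 5} (h : IsD Λ u) (σ : Equiv.Perm (Fin 5)) : IsD Λ (u ∘ σ) := by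
  refine fun x => (h x).trans ⟨?_, ?_⟩
  · rintro ⟨e, n, rfl⟩
    exact ⟨e, n ∘ σ, (Equiv.sum_comp σ fun i => ((n i : ℝ) + e / 2) • u i).symm⟩
  · rintro ⟨e, n, rfl⟩
    refine ⟨e, n ∘ σ.symm, ?_⟩
    rw [← Equiv.sum_comp σ fun i => ((((n ∘ σ.symm) i : ℤ) : ℝ) + e / 2) • u i]
    simp

lemma IsD.flip {u : Fin 5 → Euc 5} (h : IsD Λ u) {ε : Fin 5 → ℝ}
    (hε : ∀ i, ε i = 1 ∨ ε i = -1) : IsD Λ (fun i => ε i • u i) := by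
  classical
  have key : ∀ v : Fin 5 → Euc 5, ∀ (e : ℤ) (k : Fin 5 → ℤ), ∃ k' : Fin 5 → ℤ,
      ∑ i, ((k i : ℝ) + e / 2) • v i = ∑ i, ((k' i : ℝ) + e / 2) • ε i • v i := by
    intro v e k
    refine ⟨fun i => if ε i = 1 then k i else -k i - e, Finset.sum_congr rfl fun i _ => ?_⟩
    rcases hε i with hi | hi
    · simp [hi]
    · have : ¬ ((-1 : ℝ) = 1) := by norm_num
      simp only [hi, this, if_false]
      push_cast
      module
  refine fun x => (h x).trans ⟨?_, ?_⟩
  · rintro ⟨e, k, rfl⟩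
    obtain ⟨k', hk⟩ := key u e k
    exact ⟨e, k', hk⟩
  · rintro ⟨e, k, rfl⟩
    obtain ⟨k', hk⟩ := key (fun i => ε i • u i) e k
    refine ⟨e, k', hk.trans (Finset.sum_congr rfl fun i _ => ?_)⟩
    rcases hε i with hi | hi <;> simp [hi]

lemma IsA.toD {b : Fin 6 → Euc 5} (h : IsA Λ b) : IsD Λ ![b 1 - b 0, b 2, b 3, b 4, b 5] := by
  obtain ⟨h0, h⟩ := h
  rw [Fin.sum_univ_six] at h0
  refine fun x => (h x).trans ⟨?_, ?_⟩
  · rintro ⟨n, rfl⟩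
    refine ⟨-(n 0 + n 1), ![n 1, n 2, n 3, n 4, n 5], ?_⟩
    simp only [Fin.sum_univ_six, Fin.sum_univ_five, Matrix.cons_val]
    push_cast
    linear_combination (norm := module) (((n 0 : ℝ) + n 1) / 2) • h0
  · rintro ⟨e, k, rfl⟩
    refine ⟨![-e - k 0, k 0, k 1, k 2, k 3, k 4], ?_⟩
    simp only [Fin.sum_univ_six, Fin.sum_univ_five, Matrix.cons_val]
    push_cast
    linear_combination (norm := module) ((e : ℝ) / 2) • h0

lemma IsD.neighbour {u : Fin 5 → Euc 5} (h : IsD Λ u) :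
    IsD Λ ![u 0, (1 / 2 : ℝ) • (∑ i, u i) - u 1, (1 / 2 : ℝ) • (∑ i, u i) - u 2,
      (1 / 2 : ℝ) • (∑ i, u i) - u 3, (1 / 2 : ℝ) • (∑ i, u i) - u 4] := by
  refine fun x => (h x).trans ⟨?_, ?_⟩
  · rintro ⟨e, k, rfl⟩
    refine ⟨e + k 1 + k 2 + k 3 + k 4,
      ![k 0 - e - k 1 - k 2 - k 3 - k 4, -k 1, -k 2, -k 3, -k 4], ?_⟩
    simp only [Fin.sum_univ_five, Matrix.cons_val]
    push_cast
    module
  · rintro ⟨e, k, rfl⟩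
    refine ⟨e + k 1 + k 2 + k 3 + k 4, ![e + k 0, -k 1, -k 2, -k 3, -k 4], ?_⟩
    simp only [Fin.sum_univ_five, Matrix.cons_val]
    push_cast
    module

lemma IsD.toA {u : Fin 5 → Euc 5} (h : IsD Λ u) :
    IsA Λ ![-(1 / 2 : ℝ) • (∑ i, u i), u 0 - (1 / 2 : ℝ) • (∑ i, u i), u 1, u 2, u 3, u 4] := by
  refine ⟨?_, fun x => (h x).trans ⟨?_, ?_⟩⟩
  · simp only [Fin.sum_univ_five, Fin.sum_univ_six, Matrix.cons_val]
    module
  · rintro ⟨e, k, rfl⟩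
    refine ⟨![-e - k 0, k 0, k 1, k 2, k 3, k 4], ?_⟩
    simp only [Fin.sum_univ_six, Fin.sum_univ_five, Matrix.cons_val]
    push_cast
    module
  · rintro ⟨n, rfl⟩
    refine ⟨-(n 0 + n 1), ![n 1, n 2, n 3, n 4, n 5], ?_⟩
    simp only [Fin.sum_univ_six, Fin.sum_univ_five, Matrix.cons_val]
    push_cast
    module

lemma IsD.swing {u : Fin 5 → Euc 5} (h : IsD Λ u) :
    IsD Λ ![(1 / 2 : ℝ) • (∑ i, u i), (1 / 2 : ℝ) • (∑ i, u i) - u 0, u 1 - u 2, u 3, u 4] := by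
  refine fun x => (h x).trans ⟨?_, ?_⟩
  · rintro ⟨e, k, rfl⟩
    refine ⟨k 1 + k 2, ![e + k 0, -k 0, -k 2, k 3 - k 1 - k 2, k 4 - k 1 - k 2], ?_⟩
    simp only [Fin.sum_univ_five, Matrix.cons_val]
    push_cast
    module
  · rintro ⟨e, k, rfl⟩
    refine ⟨k 0 + k 1, ![-k 1, e + k 2, -k 2, e + k 3, e + k 4], ?_⟩
    simp only [Fin.sum_univ_five, Matrix.cons_val]
    push_cast
    module

lemma IsD.toP {u : Fin 5 → Euc 5} (h : IsD Λ u) :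
    IsP Λ ![u 1 - (1 / 3 : ℝ) • (u 1 + u 2 + u 3 + u 4), u 2 - (1 / 3 : ℝ) • (u 1 + u 2 + u 3 + u 4),
      u 3 - (1 / 3 : ℝ) • (u 1 + u 2 + u 3 + u 4), u 4 - (1 / 3 : ℝ) • (u 1 + u 2 + u 3 + u 4),
      (1 / 6 : ℝ) • (u 1 + u 2 + u 3 + u 4) + (1 / 2 : ℝ) • u 0,
      (1 / 6 : ℝ) • (u 1 + u 2 + u 3 + u 4) - (1 / 2 : ℝ) • u 0] := by
  refine ⟨?_, fun x => (h x).trans ⟨?_, ?_⟩⟩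
  · simp only [Fin.sum_univ_six, Matrix.cons_val]
    module
  · rintro ⟨e, k, rfl⟩
    refine ⟨e + (k 1 + k 2 + k 3 + k 4), ![k 1 - (e + (k 1 + k 2 + k 3 + k 4)),
      k 2 - (e + (k 1 + k 2 + k 3 + k 4)), k 3 - (e + (k 1 + k 2 + k 3 + k 4)),
      k 4 - (e + (k 1 + k 2 + k 3 + k 4)), e + k 0, -k 0], ?_, ?_⟩
    · simp only [Fin.sum_univ_six, Matrix.cons_val]
      ring
    · simp only [Fin.sum_univ_six, Fin.sum_univ_five, Matrix.cons_val]
      push_cast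
      module
  · rintro ⟨e, k, h0, rfl⟩
    have h1 : (k 5 : ℝ) = -3 * e - k 0 - k 1 - k 2 - k 3 - k 4 := by
      rw [Fin.sum_univ_six] at h0
      have : k 5 = -3 * e - k 0 - k 1 - k 2 - k 3 - k 4 := by linarith
      exact_mod_cast this
    refine ⟨k 4 + k 5, ![-k 5, k 0 + e, k 1 + e, k 2 + e, k 3 + e], ?_⟩
    simp only [Fin.sum_univ_six, Fin.sum_univ_five, Matrix.cons_val]
    push_cast
    rw [h1]
    module

lemma IsP.toD {w : Fin 6 → Euc 5} (h : IsP Λ w) :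
    IsD Λ ![w 4 - w 5, w 0 + (w 4 + w 5), w 1 + (w 4 + w 5), w 2 + (w 4 + w 5),
      w 3 + (w 4 + w 5)] := by
  obtain ⟨hw, h⟩ := h
  rw [Fin.sum_univ_six] at hw
  refine fun x => (h x).trans ⟨?_, ?_⟩
  · rintro ⟨e, k, h0, rfl⟩
    have h1 : (k 5 : ℝ) = -3 * e - k 0 - k 1 - k 2 - k 3 - k 4 := by
      rw [Fin.sum_univ_six] at h0
      have : k 5 = -3 * e - k 0 - k 1 - k 2 - k 3 - k 4 := by linarith
      exact_mod_cast this
    refine ⟨k 4 + k 5, ![-k 5, k 0 + e, k 1 + e, k 2 + e, k 3 + e], ?_⟩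
    simp only [Fin.sum_univ_six, Fin.sum_univ_five, Matrix.cons_val]
    push_cast
    rw [h1]
    linear_combination (norm := module) (e + ((k 0 : ℝ) + k 1 + k 2 + k 3) / 2) • hw
  · rintro ⟨e, k, rfl⟩
    refine ⟨e + (k 1 + k 2 + k 3 + k 4), ![k 1 - (e + (k 1 + k 2 + k 3 + k 4)),
      k 2 - (e + (k 1 + k 2 + k 3 + k 4)), k 3 - (e + (k 1 + k 2 + k 3 + k 4)),
      k 4 - (e + (k 1 + k 2 + k 3 + k 4)), e + k 0, -k 0], ?_, ?_⟩
    · simp only [Fin.sum_univ_six, Matrix.cons_val]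
      ring
    · simp only [Fin.sum_univ_six, Fin.sum_univ_five, Matrix.cons_val]
      push_cast
      linear_combination (norm := module) ((e : ℝ) + ((k 1 : ℝ) + k 2 + k 3 + k 4) / 2) • hw

end Moves

/-- `m` is a lower bound for the values of all frames of `Λ`. -/
def FrameBound (Λ : Set (Euc 5)) (m : ℝ) : Prop :=
  (∀ b, IsA Λ b → m ≤ 1 / 2 * ∑ i, ‖b i‖ ^ 2) ∧ (∀ u, IsD Λ u → m ≤ 1 / 2 * ∑ i, ‖u i‖ ^ 2) ∧
    ∀ w, IsP Λ w → m ≤ 3 / 4 * ∑ i, ‖w i‖ ^ 2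

lemma exists_perm_zero_one {i j : Fin 6} (h : i ≠ j) :
    ∃ σ : Equiv.Perm (Fin 6), σ 0 = i ∧ σ 1 = j := by
  refine ⟨Equiv.swap 0 i * Equiv.swap 1 (Equiv.swap 0 i j), ?_⟩
  revert i j
  decide

lemma exists_perm_four_five {i j : Fin 6} (h : i ≠ j) :
    ∃ σ : Equiv.Perm (Fin 6), σ 4 = i ∧ σ 5 = j := by
  refine ⟨Equiv.swap 4 i * Equiv.swap 5 (Equiv.swap 4 i j), ?_⟩
  revert i j
  decide

section Cones
variable {Λ : Set (Euc 5)} {m : ℝ}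

lemma IsA.inner_nonpos (hm : FrameBound Λ m) {b : Fin 6 → Euc 5} (hb : IsA Λ b)
    (hv : 1 / 2 * ∑ i, ‖b i‖ ^ 2 = m) {i j : Fin 6} (hij : i ≠ j) : ⟪b i, b j⟫ ≤ 0 := by
  obtain ⟨σ, h0, h1⟩ := exists_perm_zero_one hij
  have h := hm.2.1 _ (hb.perm σ).toD
  rw [← hv, ← Equiv.sum_comp σ] at h
  simp only [Fin.sum_univ_six, Fin.sum_univ_five, Matrix.cons_val, Function.comp_apply, h0, h1,
    norm_sub_sq_real] at h
  rw [real_inner_comm]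
  linarith

lemma IsP.cone (hm : FrameBound Λ m) {w : Fin 6 → Euc 5} (hw : IsP Λ w)
    (hv : 3 / 4 * ∑ i, ‖w i‖ ^ 2 = m) {i j : Fin 6} (hij : i ≠ j) :
    0 ≤ ⟪w i, w j⟫ + ‖w i‖ ^ 2 + ‖w j‖ ^ 2 - (∑ k, ‖w k‖ ^ 2) / 4 := by
  obtain ⟨σ, h4, h5⟩ := exists_perm_four_five hij
  have h := hm.2.1 _ (hw.perm σ).toD
  have h0 := (hw.perm σ).1
  rw [← hv, ← Equiv.sum_comp σ] at h
  rw [← Equiv.sum_comp σ]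
  simp only [Fin.sum_univ_six, Fin.sum_univ_five, Matrix.cons_val, Function.comp_apply, h4, h5,
    norm_sub_sq_real, norm_add_sq_real] at h h0 ⊢
  have e : ⟪w (σ 0), w i + w j⟫ + ⟪w (σ 1), w i + w j⟫ + ⟪w (σ 2), w i + w j⟫ +
      ⟪w (σ 3), w i + w j⟫ = -(‖w i‖ ^ 2 + 2 * ⟪w i, w j⟫ + ‖w j‖ ^ 2) := by
    rw [← norm_add_sq_real, ← real_inner_self_eq_norm_sq, ← inner_add_left, ← inner_add_left,
      ← inner_add_left, ← inner_neg_left]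
    congr 1
    linear_combination (norm := module) h0
  linarith

/-- `u` is a `D`-frame whose value is minimal among all frames. -/
def IsMinD (Λ : Set (Euc 5)) (u : Fin 5 → Euc 5) : Prop :=
  IsD Λ u ∧ FrameBound Λ (1 / 2 * ∑ i, ‖u i‖ ^ 2)

variable {u : Fin 5 → Euc 5}

lemma IsMinD.perm (h : IsMinD Λ u) (σ : Equiv.Perm (Fin 5)) : IsMinD Λ (u ∘ σ) :=
  ⟨h.1.perm σ, by
    have := Equiv.sum_comp σ fun i => ‖u i‖ ^ 2
    simpa [this] using h.2⟩

lemma IsMinD.flip (h : IsMinD Λ u) {ε : Fin 5 → ℝ} (hε : ∀ i, ε i = 1 ∨ ε i = -1) :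
    IsMinD Λ (fun i => ε i • u i) := by
  refine ⟨h.1.flip hε, ?_⟩
  have : ∀ i, ‖ε i • u i‖ = ‖u i‖ := fun i => by rcases hε i with hi | hi <;> simp [hi]
  simpa [this] using h.2

lemma IsMinD.neighbour (h : IsMinD Λ u) :
    0 ≤ ‖u 0‖ ^ 2 + ⟪u 0, u 1⟫ + ⟪u 0, u 2⟫ + ⟪u 0, u 3⟫ + ⟪u 0, u 4⟫ := by
  have := h.2.2.1 _ h.1.neighbour
  simp only [Fin.sum_univ_five, Matrix.cons_val, ← real_inner_self_eq_norm_sq, inner_add_left,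
    inner_add_right, inner_sub_left, inner_sub_right, inner_smul_left, inner_smul_right,
    RCLike.conj_to_real, real_inner_comm (u 0), real_inner_comm (u 1) (u 2),
    real_inner_comm (u 1) (u 3), real_inner_comm (u 1) (u 4), real_inner_comm (u 2) (u 3),
    real_inner_comm (u 2) (u 4), real_inner_comm (u 3) (u 4)] at this ⊢
  linarith

lemma IsMinD.toA (h : IsMinD Λ u) : ‖u 0‖ ^ 2 ≤ ‖u 1‖ ^ 2 + ‖u 2‖ ^ 2 + ‖u 3‖ ^ 2 + ‖u 4‖ ^ 2 +
    2 * (⟪u 1, u 2⟫ + ⟪u 1, u 3⟫ + ⟪u 1, u 4⟫ + ⟪u 2, u 3⟫ + ⟪u 2, u 4⟫ + ⟪u 3, u 4⟫) := by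
  have := h.2.1 _ h.1.toA
  simp only [Fin.sum_univ_five, Fin.sum_univ_six, Matrix.cons_val, ← real_inner_self_eq_norm_sq,
    inner_add_left, inner_add_right, inner_sub_left, inner_sub_right, inner_smul_left, inner_smul_right,
    RCLike.conj_to_real, real_inner_comm (u 0), real_inner_comm (u 1) (u 2),
    real_inner_comm (u 1) (u 3), real_inner_comm (u 1) (u 4), real_inner_comm (u 2) (u 3),
    real_inner_comm (u 2) (u 4), real_inner_comm (u 3) (u 4)] at this ⊢
  linarith

lemma IsMinD.toP (h : IsMinD Λ u) : ‖u 0‖ ^ 2 ≤ ‖u 1‖ ^ 2 + ‖u 2‖ ^ 2 + ‖u 3‖ ^ 2 + ‖u 4‖ ^ 2 -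
    2 * (⟪u 1, u 2⟫ + ⟪u 1, u 3⟫ + ⟪u 1, u 4⟫ + ⟪u 2, u 3⟫ + ⟪u 2, u 4⟫ + ⟪u 3, u 4⟫) := by
  have := h.2.2.2 _ h.1.toP
  simp only [Fin.sum_univ_five, Fin.sum_univ_six, Matrix.cons_val, ← real_inner_self_eq_norm_sq,
    inner_add_left, inner_add_right, inner_sub_left, inner_sub_right, inner_smul_left, inner_smul_right,
    RCLike.conj_to_real, real_inner_comm (u 0), real_inner_comm (u 1) (u 2),
    real_inner_comm (u 1) (u 3), real_inner_comm (u 1) (u 4), real_inner_comm (u 2) (u 3),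
    real_inner_comm (u 2) (u 4), real_inner_comm (u 3) (u 4)] at this ⊢
  linarith

lemma IsMinD.swing (h : IsMinD Λ u) : ‖u 0‖ ^ 2 ≤ ‖u 1‖ ^ 2 + ‖u 2‖ ^ 2 + ‖u 3‖ ^ 2 + ‖u 4‖ ^ 2 +
    2 * (-⟪u 1, u 2⟫ + ⟪u 1, u 3⟫ + ⟪u 1, u 4⟫ + ⟪u 2, u 3⟫ + ⟪u 2, u 4⟫ + ⟪u 3, u 4⟫) := by
  have := h.2.2.1 _ h.1.swing
  simp only [Fin.sum_univ_five, Matrix.cons_val, ← real_inner_self_eq_norm_sq,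
    inner_add_left, inner_add_right, inner_sub_left, inner_sub_right, inner_smul_left, inner_smul_right,
    RCLike.conj_to_real, real_inner_comm (u 0), real_inner_comm (u 1) (u 2),
    real_inner_comm (u 1) (u 3), real_inner_comm (u 1) (u 4), real_inner_comm (u 2) (u 3),
    real_inner_comm (u 2) (u 4), real_inner_comm (u 3) (u 4)] at this ⊢
  linarith

lemma IsMinD.sum_abs_inner_le (h : IsMinD Λ u) :
    |⟪u 0, u 1⟫| + |⟪u 0, u 2⟫| + |⟪u 0, u 3⟫| + |⟪u 0, u 4⟫| ≤ ‖u 0‖ ^ 2 := by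
  obtain ⟨ε, hε, h0, hn⟩ : ∃ ε : Fin 5 → ℝ, (∀ i, ε i = 1 ∨ ε i = -1) ∧ ε 0 = 1 ∧
      ∀ i, i ≠ 0 → ε i * ⟪u 0, u i⟫ = -|⟪u 0, u i⟫| := by
    classical
    refine ⟨fun i => if i = 0 ∨ ⟪u 0, u i⟫ ≤ 0 then 1 else -1, fun i => ?_, by simp,
      fun i hi => ?_⟩
    · dsimp only
      split_ifs <;> simp
    · rcases le_or_gt ⟪u 0, u i⟫ 0 with h | h
      · simp [h, abs_of_nonpos h]
      · simp [hi, not_le.mpr h, abs_of_pos h]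
  have := (h.flip hε).neighbour
  simp only [h0, one_smul, inner_smul_right, hn 1 (by decide), hn 2 (by decide),
    hn 3 (by decide), hn 4 (by decide)] at this
  linarith

lemma IsMinD.swing_perm (h : IsMinD Λ u) {ε : Fin 5 → ℝ} (hε : ∀ i, ε i = 1 ∨ ε i = -1)
    (σ : Equiv.Perm (Fin 5)) {a b c d : Fin 5}
    (hσ : σ 0 = 0 ∧ σ 1 = a ∧ σ 2 = b ∧ σ 3 = c ∧ σ 4 = d) :
    ‖u 0‖ ^ 2 ≤ ‖u a‖ ^ 2 + ‖u b‖ ^ 2 + ‖u c‖ ^ 2 + ‖u d‖ ^ 2 +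
      2 * (-(ε a * ε b * ⟪u a, u b⟫) + ε a * ε c * ⟪u a, u c⟫ + ε a * ε d * ⟪u a, u d⟫ +
        ε b * ε c * ⟪u b, u c⟫ + ε b * ε d * ⟪u b, u d⟫ + ε c * ε d * ⟪u c, u d⟫) := by
  obtain ⟨h0, rfl, rfl, rfl, rfl⟩ := hσ
  have := ((h.flip hε).perm σ).swing
  have hE : ∀ i, |ε i| = 1 := fun i => by rcases hε i with hi | hi <;> simp [hi]
  simp only [Function.comp_apply, h0, norm_smul, Real.norm_eq_abs, hE, one_mul, inner_smul_left,
    inner_smul_right, RCLike.conj_to_real] at this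
  linarith

lemma IsMinD.norm_sq_le_of_nonpos (h : IsMinD Λ u) (h2 : ⟪u 1, u 2⟫ ≤ 0) (h3 : ⟪u 1, u 3⟫ ≤ 0)
    (h4 : ⟪u 1, u 4⟫ ≤ 0) : ‖u 0‖ ^ 2 + 2 * (|⟪u 1, u 2⟫| + |⟪u 1, u 3⟫| + |⟪u 1, u 4⟫| +
      |⟪u 2, u 3⟫| + |⟪u 2, u 4⟫| + |⟪u 3, u 4⟫|) ≤
      ‖u 1‖ ^ 2 + ‖u 2‖ ^ 2 + ‖u 3‖ ^ 2 + ‖u 4‖ ^ 2 := by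
  have c12 := real_inner_comm (u 1) (u 2)
  have c13 := real_inner_comm (u 1) (u 3)
  have c14 := real_inner_comm (u 1) (u 4)
  have c23 := real_inner_comm (u 2) (u 3)
  have c24 := real_inner_comm (u 2) (u 4)
  have c34 := real_inner_comm (u 3) (u 4)
  rw [abs_of_nonpos h2, abs_of_nonpos h3, abs_of_nonpos h4]
  rcases le_or_gt ⟪u 2, u 3⟫ 0 with h23 | h23 <;> rcases le_or_gt ⟪u 2, u 4⟫ 0 with h24 | h24 <;>
    rcases le_or_gt ⟪u 3, u 4⟫ 0 with h34 | h34 <;>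
    simp only [abs_of_nonpos, abs_of_pos, h23, h24, h34]
  · linarith [h.toA]
  · have := h.swing_perm (ε := ![1, 1, 1, 1, 1]) (by simp [Fin.forall_fin_succ])
      (Equiv.swap 1 3 * Equiv.swap 2 4) (a := 3) (b := 4) (c := 1) (d := 2) (by decide)
    simp at this
    linarith
  · have := h.swing_perm (ε := ![1, 1, 1, 1, 1]) (by simp [Fin.forall_fin_succ])
      (Equiv.swap 1 4) (a := 4) (b := 2) (c := 3) (d := 1) (by decide)
    simp at this
    linarith
  · have := h.swing_perm (ε := ![1, 1, 1, 1, -1]) (by simp [Fin.forall_fin_succ])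
      (Equiv.swap 2 4) (a := 1) (b := 4) (c := 3) (d := 2) (by decide)
    simp at this
    linarith
  · have := h.swing_perm (ε := ![1, 1, 1, 1, 1]) (by simp [Fin.forall_fin_succ])
      (Equiv.swap 1 3) (a := 3) (b := 2) (c := 1) (d := 4) (by decide)
    simp at this
    linarith
  · have := h.swing_perm (ε := ![1, 1, 1, -1, 1]) (by simp [Fin.forall_fin_succ])
      (Equiv.swap 2 3) (a := 1) (b := 3) (c := 2) (d := 4) (by decide)
    simp at this
    linarith
  · have := h.swing_perm (ε := ![1, 1, -1, 1, 1]) (by simp [Fin.forall_fin_succ])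
      1 (a := 1) (b := 2) (c := 3) (d := 4) (by decide)
    simp at this
    linarith
  · have := (h.flip (ε := ![1, -1, 1, 1, 1]) (by simp [Fin.forall_fin_succ])).toP
    simp at this
    linarith

lemma IsMinD.norm_sq_le (h : IsMinD Λ u) : ‖u 0‖ ^ 2 + 2 * (|⟪u 1, u 2⟫| + |⟪u 1, u 3⟫| +
      |⟪u 1, u 4⟫| + |⟪u 2, u 3⟫| + |⟪u 2, u 4⟫| + |⟪u 3, u 4⟫|) ≤
      ‖u 1‖ ^ 2 + ‖u 2‖ ^ 2 + ‖u 3‖ ^ 2 + ‖u 4‖ ^ 2 := by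
  obtain ⟨ε, hε, h1, hn⟩ : ∃ ε : Fin 5 → ℝ, (∀ i, ε i = 1 ∨ ε i = -1) ∧ ε 1 = 1 ∧
      ∀ i, i ≠ 1 → ε i * ⟪u 1, u i⟫ ≤ 0 := by
    classical
    refine ⟨fun i => if i = 1 ∨ ⟪u 1, u i⟫ ≤ 0 then 1 else -1, fun i => ?_, by simp,
      fun i hi => ?_⟩
    · dsimp only
      split_ifs <;> simp
    · rcases le_or_gt ⟪u 1, u i⟫ 0 with h | h
      · simp [h]
      · simp [hi, not_le.mpr h, h.le]
  have hE : ∀ i, |ε i| = 1 := fun i => by rcases hε i with hi | hi <;> simp [hi]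
  have := (h.flip hε).norm_sq_le_of_nonpos
  simp only [h1, one_smul, inner_smul_right, inner_smul_left, RCLike.conj_to_real, abs_mul, hE,
    one_mul, norm_smul, Real.norm_eq_abs] at this
  exact this (hn 2 (by decide)) (hn 3 (by decide)) (hn 4 (by decide))

end Cones

lemma finite_lattice_inter_ball {T : Euc 5 →ₗ[ℝ] Euc 5} (hT : LinearMap.det T ≠ 0) (C : ℝ) :
    {x | x ∈ T '' intPoints 5 ∧ ‖x‖ ≤ C}.Finite := by
  set S : Euc 5 →L[ℝ] Euc 5 :=
    ((LinearMap.equivOfDetNeZero T hT).symm : Euc 5 →ₗ[ℝ] Euc 5).toContinuousLinearMap with hS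
  have hST : ∀ z, S (T z) = z := fun z =>
    (LinearMap.equivOfDetNeZero T hT).symm_apply_apply z
  obtain ⟨M, hM⟩ := exists_nat_ge (‖S‖ * C)
  refine ((Fintype.piFinset fun _ : Fin 5 => Finset.Icc (-M : ℤ) M).finite_toSet.image
    (fun n : Fin 5 → ℤ => T (WithLp.toLp 2 fun i => (n i : ℝ)))).subset ?_
  rintro _ ⟨⟨z, hz, rfl⟩, hx⟩
  choose n hn using hz
  refine ⟨n, ?_, ?_⟩
  · simp only [Finset.mem_coe, Fintype.mem_piFinset, Finset.mem_Icc, ← abs_le]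
    intro i
    have h1 : |z i| ≤ ‖z‖ := PiLp.norm_apply_le z i
    have h2 : ‖z‖ ≤ ‖S‖ * ‖T z‖ := by
      conv_lhs => rw [← hST z]
      exact S.le_opNorm _
    have h3 : ‖S‖ * ‖T z‖ ≤ ‖S‖ * C := by gcongr
    rw [hn i] at h1
    have : (|n i| : ℝ) ≤ M := h1.trans (h2.trans (h3.trans hM))
    exact_mod_cast this
  · have : WithLp.toLp 2 (fun i => (n i : ℝ)) = z := by
      ext i
      exact (hn i).symm
    simp only [this]

section
variable {Λ : Set (Euc 5)}

lemma IsA.mem {b : Fin 6 → Euc 5} (h : IsA Λ b) (i : Fin 6) : b i ∈ Λ :=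
  (h.2 _).2 ⟨Pi.single i 1, by simp [Pi.single_apply]⟩

lemma IsD.mem {u : Fin 5 → Euc 5} (h : IsD Λ u) (i : Fin 5) : u i ∈ Λ :=
  (h _).2 ⟨0, Pi.single i 1, by simp [Pi.single_apply]⟩

lemma IsP.mem {w : Fin 6 → Euc 5} (h : IsP Λ w) (i : Fin 6) : (6 : ℝ) • w i ∈ Λ := by
  refine (h.2 _).2 ⟨-2, Pi.single i 6, by simp, ?_⟩
  have : ∀ j, (((Pi.single i 6 : Fin 6 → ℤ) j : ℝ) + ((-2 : ℤ) : ℝ) / 2) • w j =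
      ((Pi.single i 6 : Fin 6 → ℝ) j) • w j - w j := fun j => by
    by_cases hj : j = i <;> simp [hj]; module
  simp only [this, Finset.sum_sub_distrib, h.1]
  simp [Pi.single_apply]

lemma exists_isA (T : Euc 5 →ₗ[ℝ] Euc 5) : ∃ b, IsA (T '' intPoints 5) b := by
  set e := fun i : Fin 5 => T (EuclideanSpace.single i 1) with he
  have hx : ∀ x : Euc 5, T x = ∑ i, x i • e i := fun x => by
    simp only [he, ← map_smul, ← map_sum]
    congr 1
    ext i
    simp [Pi.single_apply]
  refine ⟨![e 0, e 1, e 2, e 3, e 4, -∑ i, e i], ?_, fun x => ⟨?_, ?_⟩⟩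
  · simp only [Fin.sum_univ_six, Fin.sum_univ_five, Matrix.cons_val]
    module
  · rintro ⟨z, hz, rfl⟩
    choose n hn using hz
    refine ⟨![n 0, n 1, n 2, n 3, n 4, 0], ?_⟩
    simp only [hx, hn, Fin.sum_univ_six, Fin.sum_univ_five, Matrix.cons_val]
    module
  · rintro ⟨n, rfl⟩
    refine ⟨WithLp.toLp 2 fun i => ((![n 0 - n 5, n 1 - n 5, n 2 - n 5, n 3 - n 5, n 4 - n 5] i : ℤ) : ℝ),
      fun i => ⟨_, rfl⟩, ?_⟩
    simp only [hx, Fin.sum_univ_six, Fin.sum_univ_five, Matrix.cons_val]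
    push_cast
    module

end

lemma exists_min_frame {T : Euc 5 →ₗ[ℝ] Euc 5} (hT : LinearMap.det T ≠ 0) :
    ∃ m, FrameBound (T '' intPoints 5) m ∧
      ((∃ b, IsA (T '' intPoints 5) b ∧ 1 / 2 * ∑ i, ‖b i‖ ^ 2 = m) ∨
        (∃ u, IsD (T '' intPoints 5) u ∧ 1 / 2 * ∑ i, ‖u i‖ ^ 2 = m) ∨
        ∃ w, IsP (T '' intPoints 5) w ∧ 3 / 4 * ∑ i, ‖w i‖ ^ 2 = m) := by
  set Λ := T '' intPoints 5 with hΛ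
  set V : Set ℝ := {m | (∃ b, IsA Λ b ∧ 1 / 2 * ∑ i, ‖b i‖ ^ 2 = m) ∨
        (∃ u, IsD Λ u ∧ 1 / 2 * ∑ i, ‖u i‖ ^ 2 = m) ∨
        ∃ w, IsP Λ w ∧ 3 / 4 * ∑ i, ‖w i‖ ^ 2 = m} with hV
  obtain ⟨b₀, hb₀⟩ := exists_isA T
  set v₀ := 1 / 2 * ∑ i, ‖b₀ i‖ ^ 2 with hv₀
  have hv₀V : v₀ ∈ V := Or.inl ⟨b₀, hb₀, rfl⟩
  have hF := finite_lattice_inter_ball hT (48 * v₀ + 1)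
  set F := {x | x ∈ T '' intPoints 5 ∧ ‖x‖ ≤ 48 * v₀ + 1} with hFdef
  have hfin : (V ∩ Iic v₀).Finite := by
    have h6 : {g : Fin 6 → Euc 5 | ∀ i, g i ∈ F}.Finite := by
      simpa [Set.pi] using Set.Finite.pi (ι := Fin 6) (t := fun _ => F) fun _ => hF
    have h5 : {g : Fin 5 → Euc 5 | ∀ i, g i ∈ F}.Finite := by
      simpa [Set.pi] using Set.Finite.pi (ι := Fin 5) (t := fun _ => F) fun _ => hF
    refine ((h6.image fun g => 1 / 2 * ∑ i, ‖g i‖ ^ 2).union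
      ((h5.image fun g => 1 / 2 * ∑ i, ‖g i‖ ^ 2).union
      (h6.image fun g => 3 / 4 * ∑ i, ‖(1 / 6 : ℝ) • g i‖ ^ 2))).subset ?_
    have hn : ∀ x : Euc 5, ‖x‖ ≤ ‖x‖ ^ 2 + 1 := fun x => by nlinarith [sq_nonneg (‖x‖ - 1)]
    rintro m ⟨hm | hm | hm, hle⟩ <;> rw [mem_Iic] at hle
    · obtain ⟨b, hb, rfl⟩ := hm
      refine Or.inl ⟨b, fun i => ⟨hb.mem i, ?_⟩, rfl⟩
      have := Finset.single_le_sum (f := fun i => ‖b i‖ ^ 2) (fun i _ => by positivity)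
        (Finset.mem_univ i)
      have h0 := sq_nonneg ‖b i‖
      linarith [hn (b i)]
    · obtain ⟨b, hb, rfl⟩ := hm
      refine Or.inr (Or.inl ⟨b, fun i => ⟨hb.mem i, ?_⟩, rfl⟩)
      have := Finset.single_le_sum (f := fun i => ‖b i‖ ^ 2) (fun i _ => by positivity)
        (Finset.mem_univ i)
      have h0 := sq_nonneg ‖b i‖
      linarith [hn (b i)]
    · obtain ⟨b, hb, rfl⟩ := hm
      refine Or.inr (Or.inr ⟨fun i => (6 : ℝ) • b i, fun i => ⟨hb.mem i, ?_⟩, ?_⟩)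
      · have := Finset.single_le_sum (f := fun i => ‖b i‖ ^ 2) (fun i _ => by positivity)
          (Finset.mem_univ i)
        have h0 := sq_nonneg ‖b i‖
        have h6 := hn ((6 : ℝ) • b i)
        have h7 : ‖(6 : ℝ) • b i‖ ^ 2 = 36 * ‖b i‖ ^ 2 := by
          rw [norm_smul, mul_pow]; norm_num
        show ‖(6 : ℝ) • b i‖ ≤ _
        linarith
      · simp [smul_smul]
  obtain ⟨m, ⟨hmV, hm0⟩, hmin⟩ := Set.exists_min_image _ id hfin ⟨v₀, hv₀V, mem_Iic.2 le_rfl⟩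
  have hmin' : ∀ v ∈ V, m ≤ v := fun v hv => by
    rcases le_or_gt v v₀ with h | h
    · exact hmin v ⟨hv, h⟩
    · exact (show m ≤ v₀ from hm0).trans h.le
  exact ⟨m, ⟨fun b hb => hmin' _ (Or.inl ⟨b, hb, rfl⟩),
    fun u hu => hmin' _ (Or.inr (Or.inl ⟨u, hu, rfl⟩)),
    fun w hw => hmin' _ (Or.inr (Or.inr ⟨w, hw, rfl⟩))⟩, hmV⟩

section Determinants
variable {T : Euc 5 →ₗ[ℝ] Euc 5}

lemma IsA.abs_vdet (hT : LinearMap.det T ≠ 0) {b : Fin 6 → Euc 5} (hb : IsA (T '' intPoints 5) b) :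
    |vdet ![b 0, b 1, b 2, b 3, b 4]| = |LinearMap.det T| := by
  have h0 := hb.1
  rw [Fin.sum_univ_six] at h0
  refine abs_vdet_eq hT (fun i => ?_) fun x hx => ?_
  · fin_cases i <;> exact hb.mem _
  · obtain ⟨n, rfl⟩ := (hb.2 x).1 hx
    refine ⟨![n 0 - n 5, n 1 - n 5, n 2 - n 5, n 3 - n 5, n 4 - n 5], ?_⟩
    simp only [Fin.sum_univ_six, Fin.sum_univ_five, Matrix.cons_val]
    push_cast
    linear_combination (norm := module) (n 5 : ℝ) • h0

lemma IsD.abs_vdet (hT : LinearMap.det T ≠ 0) {u : Fin 5 → Euc 5} (hu : IsD (T '' intPoints 5) u) :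
    |vdet u| = 2 * |LinearMap.det T| := by
  set B : Fin 5 → Euc 5 := ![u 0, u 1, u 2, u 3, (1 / 2 : ℝ) • ∑ i, u i] with hB
  have h1 : |vdet B| = |LinearMap.det T| := by
    refine abs_vdet_eq hT (fun i => ?_) fun x hx => ?_
    · refine (hu _).2 ?_
      fin_cases i
      · exact ⟨0, ![1, 0, 0, 0, 0], by simp [hB, Fin.sum_univ_five]⟩
      · exact ⟨0, ![0, 1, 0, 0, 0], by simp [hB, Fin.sum_univ_five]⟩
      · exact ⟨0, ![0, 0, 1, 0, 0], by simp [hB, Fin.sum_univ_five]⟩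
      · exact ⟨0, ![0, 0, 0, 1, 0], by simp [hB, Fin.sum_univ_five]⟩
      · exact ⟨1, ![0, 0, 0, 0, 0], by simp [hB, Fin.sum_univ_five]⟩
    · obtain ⟨e, k, rfl⟩ := (hu x).1 hx
      refine ⟨![k 0 - k 4, k 1 - k 4, k 2 - k 4, k 3 - k 4, 2 * k 4 + e], ?_⟩
      simp only [hB, Fin.sum_univ_five, Matrix.cons_val]
      push_cast
      module
  have h2 := vdet_comb !![1, 0, 0, 0, 0; 0, 1, 0, 0, 0; 0, 0, 1, 0, 0; 0, 0, 0, 1, 0;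
    -1, -1, -1, -1, 2] B
  have h3 : (fun i => ∑ j, (!![1, 0, 0, 0, 0; 0, 1, 0, 0, 0; 0, 0, 1, 0, 0; 0, 0, 0, 1, 0;
    -1, -1, -1, -1, 2] : Matrix (Fin 5) (Fin 5) ℝ) i j • B j) = u := by
    funext i
    fin_cases i <;> simp [hB, Fin.sum_univ_five]
    module
  have h4 : (!![1, 0, 0, 0, 0; 0, 1, 0, 0, 0; 0, 0, 1, 0, 0; 0, 0, 0, 1, 0;
    -1, -1, -1, -1, 2] : Matrix (Fin 5) (Fin 5) ℝ).det = 2 := by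
    simp [Matrix.det_succ_row_zero, Fin.sum_univ_succ, Fin.succAbove]
  rw [h3, h4] at h2
  rw [h2, abs_mul, h1, abs_two]

lemma IsP.abs_vdet (hT : LinearMap.det T ≠ 0) {w : Fin 6 → Euc 5} (hw : IsP (T '' intPoints 5) w) :
    3 * |vdet ![w 0, w 1, w 2, w 3, w 4]| = |LinearMap.det T| := by
  set B : Fin 5 → Euc 5 := ![w 0 + w 1 + w 2, w 1 - w 2, w 2 - w 3, w 3 - w 4, w 4 - w 5] with hB
  have h0 := hw.1
  rw [Fin.sum_univ_six] at h0
  have h1 : |vdet B| = |LinearMap.det T| := by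
    refine abs_vdet_eq hT (fun i => ?_) fun x hx => ?_
    · refine (hw.2 _).2 ?_
      fin_cases i
      · refine ⟨1, ![0, 0, 0, -1, -1, -1], by decide, ?_⟩
        simp [hB, Fin.sum_univ_six]
        linear_combination (norm := module) (1 / 2 : ℝ) • h0
      · exact ⟨0, ![0, 1, -1, 0, 0, 0], by decide, by simp [hB, Fin.sum_univ_six]; module⟩
      · exact ⟨0, ![0, 0, 1, -1, 0, 0], by decide, by simp [hB, Fin.sum_univ_six]; module⟩
      · exact ⟨0, ![0, 0, 0, 1, -1, 0], by decide, by simp [hB, Fin.sum_univ_six]; module⟩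
      · exact ⟨0, ![0, 0, 0, 0, 1, -1], by decide, by simp [hB, Fin.sum_univ_six]; module⟩
    · obtain ⟨e, k, hk, rfl⟩ := (hw.2 x).1 hx
      rw [Fin.sum_univ_six] at hk
      have hk' : (k 0 + k 1 + k 2 + k 3 + k 4 + k 5 + 3 * e : ℝ) = 0 := by exact_mod_cast hk
      refine ⟨![2 * k 0 + e, k 1 - k 0, k 1 + k 2 - 2 * k 0, k 1 + k 2 + k 3 - k 0 + e,
        k 1 + k 2 + k 3 + k 4 + 2 * e], ?_⟩
      simp only [hB, Fin.sum_univ_six, Fin.sum_univ_five, Matrix.cons_val]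
      push_cast
      linear_combination (norm := module) (-(k 0 + e / 2) : ℝ) • h0 + hk' • w 5
  have h2 := vdet_comb !![1, 1, 1, 0, 0; 0, 1, -1, 0, 0; 0, 0, 1, -1, 0; 0, 0, 0, 1, -1;
    1, 1, 1, 1, 2] ![w 0, w 1, w 2, w 3, w 4]
  have h3 : (fun i => ∑ j, (!![1, 1, 1, 0, 0; 0, 1, -1, 0, 0; 0, 0, 1, -1, 0; 0, 0, 0, 1, -1;
    1, 1, 1, 1, 2] : Matrix (Fin 5) (Fin 5) ℝ) i j • (![w 0, w 1, w 2, w 3, w 4] : Fin 5 → Euc 5) j)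
      = B := by
    funext i
    fin_cases i <;> simp [hB, Fin.sum_univ_five]
    · module
    · module
    · module
    · linear_combination (norm := module) h0
  have h4 : (!![1, 1, 1, 0, 0; 0, 1, -1, 0, 0; 0, 0, 1, -1, 0; 0, 0, 0, 1, -1;
    1, 1, 1, 1, 2] : Matrix (Fin 5) (Fin 5) ℝ).det = 3 := by
    simp [Matrix.det_succ_row_zero, Fin.sum_univ_succ, Fin.succAbove]
    norm_num
  rw [h3, h4] at h2
  rw [← h1, h2, abs_mul, abs_of_pos (by norm_num : (0 : ℝ) < 3)]

end Determinants

section Holes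
variable {Λ : Set (Euc 5)} {R : ℝ}

lemma norm_sq_le_of_hole (hC : ∀ x, ∃ v ∈ Λ, ‖x - v‖ ≤ R) {a : Euc 5}
    (ha : ∀ v ∈ Λ, 2 * ⟪a, v⟫ ≤ ‖v‖ ^ 2) : ‖a‖ ^ 2 ≤ R ^ 2 := by
  obtain ⟨v, hv, h⟩ := hC a
  have h1 := ha v hv
  have h2 : ‖a - v‖ ^ 2 ≤ R ^ 2 := by gcongr
  rw [norm_sub_sq_real] at h2
  linarith

lemma two_inner_sub_le (a y : Euc 5) : 2 * ⟪a, y⟫ - ‖y‖ ^ 2 ≤ ‖a‖ ^ 2 := by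
  have := norm_sub_sq_real a y
  have h := sq_nonneg ‖a - y‖
  linarith

lemma exists_inner_eq_six {w : Fin 6 → Euc 5} (hw : ∑ i, w i = 0)
    (hd : vdet ![w 0, w 1, w 2, w 3, w 4] ≠ 0) {c : Fin 6 → ℝ} (hc : ∑ i, c i = 0) :
    ∃ a : Euc 5, ∀ i, ⟪a, w i⟫ = c i := by
  obtain ⟨a, ha⟩ := exists_inner_eq hd ![c 0, c 1, c 2, c 3, c 4]
  have h0 := ha 0
  have h1 := ha 1
  have h2 := ha 2
  have h3 := ha 3
  have h4 := ha 4
  have h5 := congrArg (fun v => ⟪a, v⟫) hw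
  simp only [Fin.sum_univ_six, inner_add_right, inner_zero_right, Matrix.cons_val] at *
  refine ⟨a, fun i => ?_⟩
  fin_cases i <;> simp only [Fin.zero_eta, Fin.mk_one, Fin.reduceFinMk] <;> linarith

lemma vdet_sq_le_six {w : Fin 6 → Euc 5} (hw : ∑ i, w i = 0) :
    6 * vdet ![w 0, w 1, w 2, w 3, w 4] ^ 2 ≤ ((∑ i, ‖w i‖ ^ 2) / 5) ^ 5 := by
  set P : Matrix (Fin 5) (Fin 5) ℝ := 1 + Matrix.vecMulVec (fun _ => 1) (fun _ => 1) with hPd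
  have hP : P.PosSemidef := by
    refine Matrix.PosSemidef.one.add ?_
    simpa using Matrix.posSemidef_vecMulVec_self_star (fun _ : Fin 5 => (1 : ℝ))
  have hdet : P.det = 6 := by
    rw [hPd, Matrix.vecMulVec_eq Unit, Matrix.det_one_add_replicateCol_mul_replicateRow]
    simp [dotProduct]
    norm_num
  have h := vdet_quad hP ![w 0, w 1, w 2, w 3, w 4]
  rw [hdet] at h
  refine h.trans_eq ?_
  congr 2
  have h5 : ‖w 5‖ ^ 2 = ‖w 0 + w 1 + w 2 + w 3 + w 4‖ ^ 2 := by
    rw [← norm_neg (w 5)]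
    congr 2
    rw [Fin.sum_univ_six] at hw
    linear_combination (norm := module) -hw
  simp only [Fin.sum_univ_six, Fin.sum_univ_five, h5]
  simp only [← real_inner_self_eq_norm_sq, inner_add_left, inner_add_right, hPd, Matrix.add_apply,
    Matrix.vecMulVec_apply, Matrix.one_apply]
  simp
  ring

lemma le_sq_of_int {s : ℝ} (hs : s = 1 ∨ s = -1 ∨ s = 0) (m : ℤ) : s * m ≤ (m : ℝ) ^ 2 := by
  have h : |m| ≤ m ^ 2 := by
    rw [← sq_abs]
    nlinarith [Int.le_self_sq |m|]
  have h1 : |(m : ℝ)| ≤ (m : ℝ) ^ 2 := by exact_mod_cast h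
  have h2 := abs_le.1 h1
  have h3 := sq_nonneg (m : ℝ)
  rcases hs with rfl | rfl | rfl <;> linarith

end Holes

/-- The coefficient of `(n i + n j) ^ 2` in `‖∑ n i • w i‖ ^ 2` for zero-sum `n` and `w`. -/
def pCoeff (w : Fin 6 → Euc 5) (i j : Fin 6) : ℝ :=
  if i = j then 0 else ⟪w i, w j⟫ + ‖w i‖ ^ 2 + ‖w j‖ ^ 2 - (∑ k, ‖w k‖ ^ 2) / 4

lemma pCoeff_comm (w : Fin 6 → Euc 5) (i j : Fin 6) : pCoeff w i j = pCoeff w j i := by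
  simp only [pCoeff, eq_comm (a := i), real_inner_comm (w i)]
  split_ifs <;> ring

lemma norm_sq_sum_smul {ι : Type*} [Fintype ι] (w : ι → Euc 5) (n : ι → ℝ) :
    ‖∑ i, n i • w i‖ ^ 2 = ∑ i, ∑ j, n i * n j * ⟪w i, w j⟫ := by
  rw [← real_inner_self_eq_norm_sq, sum_inner]
  refine Finset.sum_congr rfl fun i _ => ?_
  rw [inner_sum]
  refine Finset.sum_congr rfl fun j _ => ?_
  rw [real_inner_smul_left, real_inner_smul_right, mul_assoc]

lemma sum_inner_eq_zero {w : Fin 6 → Euc 5} (hw : ∑ i, w i = 0) (i : Fin 6) :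
    ∑ j, ⟪w i, w j⟫ = 0 := by
  rw [← inner_sum, hw, inner_zero_right]

set_option maxRecDepth 4000 in
lemma two_mul_norm_sq_eq_pCoeff {w : Fin 6 → Euc 5} (hw : ∑ i, w i = 0) {n : Fin 6 → ℝ}
    (hn : ∑ i, n i = 0) :
    2 * ‖∑ i, n i • w i‖ ^ 2 = ∑ i, ∑ j, pCoeff w i j * (n i + n j) ^ 2 := by
  have hr := sum_inner_eq_zero hw
  have hc : ∀ j, ∑ i, ⟪w i, w j⟫ = 0 := fun j => by
    simpa only [real_inner_comm] using hr j
  rw [norm_sq_sum_smul]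
  simp only [pCoeff, ← real_inner_self_eq_norm_sq]
  obtain ⟨g, hg⟩ : ∃ g : Fin 6 → Fin 6 → ℝ, ∀ i j, ⟪w i, w j⟫ = g i j := ⟨_, fun _ _ => rfl⟩
  simp only [hg] at *
  have e : ∀ i j, (if i = j then (0 : ℝ) else g i j + g i i + g j j - (∑ k, g k k) / 4) =
      g i j + g i i + g j j - (∑ k, g k k) / 4 -
        if i = j then 3 * g i i - (∑ k, g k k) / 4 else 0 := fun i j => by
    split_ifs with h
    · subst h; ring
    · ring
  simp only [e, sub_mul, Finset.sum_sub_distrib, ite_mul, zero_mul, Finset.sum_ite_eq,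
    Finset.mem_univ, if_true]
  simp only [Fin.sum_univ_six] at *
  linear_combination -n 0 ^ 2 * (hr 0 + hc 0) - n 1 ^ 2 * (hr 1 + hc 1) - n 2 ^ 2 * (hr 2 + hc 2) -
    n 3 ^ 2 * (hr 3 + hc 3) - n 4 ^ 2 * (hr 4 + hc 4) - n 5 ^ 2 * (hr 5 + hc 5) +
    ((g 0 0 + g 1 1 + g 2 2 + g 3 3 + g 4 4 + g 5 5) / 2 * (n 0 + n 1 + n 2 + n 3 + n 4 + n 5) -
      4 * (g 0 0 * n 0 + g 1 1 * n 1 + g 2 2 * n 2 + g 3 3 * n 3 + g 4 4 * n 4 + g 5 5 * n 5)) * hn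

lemma sum_pCoeff {w : Fin 6 → Euc 5} (hw : ∑ i, w i = 0) :
    ∑ i, ∑ j, pCoeff w i j = 3 / 2 * ∑ i, ‖w i‖ ^ 2 := by
  have hr := sum_inner_eq_zero hw
  simp only [pCoeff, ← real_inner_self_eq_norm_sq]
  obtain ⟨g, hg⟩ : ∃ g : Fin 6 → Fin 6 → ℝ, ∀ i j, ⟪w i, w j⟫ = g i j := ⟨_, fun _ _ => rfl⟩
  simp only [hg] at *
  have e : ∀ i j, (if i = j then (0 : ℝ) else g i j + g i i + g j j - (∑ k, g k k) / 4) =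
      g i j + g i i + g j j - (∑ k, g k k) / 4 -
        if i = j then 3 * g i i - (∑ k, g k k) / 4 else 0 := fun i j => by
    split_ifs with h
    · subst h; ring
    · ring
  simp only [e, Finset.sum_add_distrib, Finset.sum_sub_distrib, Finset.sum_ite_eq,
    Finset.mem_univ, if_true, hr, Finset.sum_const, Finset.card_univ, Fintype.card_fin, ← Finset.smul_sum,
    ← Finset.mul_sum]
  simp only [nsmul_eq_mul]
  push_cast
  ring

lemma IsP.det_sq_le {T : Euc 5 →ₗ[ℝ] Euc 5} (hT : LinearMap.det T ≠ 0) {R : ℝ}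
    (hC : ∀ x, ∃ v ∈ T '' intPoints 5, ‖x - v‖ ≤ R) {w : Fin 6 → Euc 5}
    (hw : IsP (T '' intPoints 5) w) (hm : FrameBound (T '' intPoints 5) (3 / 4 * ∑ i, ‖w i‖ ^ 2)) :
    LinearMap.det T ^ 2 ≤ 3 / 2 * (6 / 5 * R ^ 2) ^ 5 := by
  have hcone : ∀ i j, i ≠ j →
    0 ≤ ⟪w i, w j⟫ + ‖w i‖ ^ 2 + ‖w j‖ ^ 2 - (∑ k, ‖w k‖ ^ 2) / 4 := fun i j => hw.cone hm rfl
  have hdet := hw.abs_vdet hT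
  have hd : vdet ![w 0, w 1, w 2, w 3, w 4] ≠ 0 := by
    intro h
    rw [h] at hdet
    simp [eq_comm (a := (0 : ℝ)), hT] at hdet
  set G := ∑ k, ‖w k‖ ^ 2 with hG
  have hl0 : ∀ i j, 0 ≤ pCoeff w i j := fun i j => by
    unfold pCoeff
    split_ifs with h
    exacts [le_rfl, hcone i j h]
  set s : Fin 6 → Fin 6 → ℝ := fun i j => if i = 5 ∨ j = 5 then -1 else 1 with hs
  have hssymm : ∀ i j, s i j = s j i := fun i j => by simp only [hs, or_comm]
  set c : Fin 6 → ℝ := fun i => 1 / 2 * ∑ j, pCoeff w i j * s i j with hc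
  obtain ⟨a, ha⟩ := exists_inner_eq_six hw.1 hd
    (c := fun i => c i - (∑ j, c j) / 6) (by simp [Finset.sum_sub_distrib]; ring)
  have hinner : ∀ n : Fin 6 → ℝ, ∑ i, n i = 0 →
      4 * ⟪a, ∑ i, n i • w i⟫ = ∑ i, ∑ j, pCoeff w i j * (s i j * (n i + n j)) := fun n hn => by
    have e1 : 2 * ⟪a, ∑ i, n i • w i⟫ = ∑ i, ∑ j, pCoeff w i j * (s i j * n i) := by
      have : 2 * ⟪a, ∑ i, n i • w i⟫ = 2 * ∑ i, n i * c i := by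
        simp only [inner_sum, inner_smul_right, ha, mul_sub, Finset.sum_sub_distrib,
          ← Finset.sum_mul, hn]
        ring
      rw [this, Finset.mul_sum]
      refine Finset.sum_congr rfl fun i _ => ?_
      simp only [hc, Finset.mul_sum]
      exact Finset.sum_congr rfl fun j _ => by ring
    have e2 : ∑ i, ∑ j, pCoeff w i j * (s i j * n i) = ∑ i, ∑ j, pCoeff w i j * (s i j * n j) := by
      rw [Finset.sum_comm]
      exact Finset.sum_congr rfl fun i _ => Finset.sum_congr rfl fun j _ => by
        rw [pCoeff_comm, hssymm]
    simp only [mul_add, Finset.sum_add_distrib, ← e2, ← e1]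
    ring
  have hsq := norm_sq_le_of_hole hC (a := a) fun v hv => by
    obtain ⟨e, k, hk, rfl⟩ := (hw.2 v).1 hv
    have hn : ∑ i, ((k i : ℝ) + e / 2) = 0 := by
      have : ((∑ i, k i + 3 * e : ℤ) : ℝ) = 0 := by rw [hk]; simp
      push_cast at this
      rw [← this, Finset.sum_add_distrib]
      simp
      ring
    have h : ∑ i, ∑ j, pCoeff w i j * (s i j * ((k i + e / 2 : ℝ) + (k j + e / 2))) ≤
        ∑ i, ∑ j, pCoeff w i j * ((k i + e / 2 : ℝ) + (k j + e / 2)) ^ 2 :=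
      Finset.sum_le_sum fun i _ => Finset.sum_le_sum fun j _ =>
        mul_le_mul_of_nonneg_left (by
          have := le_sq_of_int (s := s i j) (by simp only [hs]; split_ifs <;> simp) (k i + k j + e)
          have e : ((k i + k j + e : ℤ) : ℝ) = (k i + e / 2) + (k j + e / 2) := by push_cast; ring
          rwa [e] at this) (hl0 i j)
    rw [← hinner _ hn, ← two_mul_norm_sq_eq_pCoeff hw.1 hn] at h
    linarith
  set y : Fin 6 → ℝ := fun i => if i = 5 then -5 / 6 else 1 / 6 with hyd
  have hy : ∑ i, y i = 0 := by
    simp [hyd, Fin.sum_univ_six]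
    norm_num
  have h1 := two_inner_sub_le a (∑ i, y i • w i)
  have hG6 : G / 6 ≤ R ^ 2 := by
    refine le_trans ?_ (h1.trans hsq)
    have h2 := hinner _ hy
    have h3 := two_mul_norm_sq_eq_pCoeff hw.1 hy
    have h4 : ∑ i, ∑ j, pCoeff w i j * (s i j * (y i + y j)) -
        ∑ i, ∑ j, pCoeff w i j * (y i + y j) ^ 2 = 2 / 9 * ∑ i, ∑ j, pCoeff w i j := by
      simp only [Finset.mul_sum, ← Finset.sum_sub_distrib]
      refine Finset.sum_congr rfl fun i _ => Finset.sum_congr rfl fun j _ => ?_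
      rcases eq_or_ne i j with rfl | hij
      · simp [pCoeff]
      · rw [← mul_sub, mul_comm]
        congr 1
        simp only [hs, hyd]
        split_ifs with h h' h'' <;> first | (exfalso; omega) | norm_num
    rw [sum_pCoeff hw.1] at h4
    linarith
  have h6 := vdet_sq_le_six hw.1
  rw [← sq_abs, ← hdet, mul_pow]
  rw [← sq_abs] at h6
  have h7 : (G / 5) ^ 5 ≤ (6 / 5 * R ^ 2) ^ 5 := by
    have h0 : 0 ≤ G := Finset.sum_nonneg fun i _ => sq_nonneg _
    exact pow_le_pow_left₀ (by linarith) (by linarith) 5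
  linarith

lemma two_mul_norm_sq_eq {b : Fin 6 → Euc 5} (hb : ∑ i, b i = 0) (n : Fin 6 → ℝ) :
    2 * ‖∑ i, n i • b i‖ ^ 2 = ∑ i, ∑ j, -⟪b i, b j⟫ * (n i - n j) ^ 2 := by
  have e1 : ∑ i, ∑ j, ⟪b i, b j⟫ * n i ^ 2 = 0 := by
    simp only [← Finset.sum_mul, sum_inner_eq_zero hb, zero_mul, Finset.sum_const_zero]
  have e2 : ∑ i, ∑ j, ⟪b i, b j⟫ * n j ^ 2 = 0 := by
    rw [Finset.sum_comm]
    simpa only [real_inner_comm] using e1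
  have e3 : ∑ i, ∑ j, -⟪b i, b j⟫ * (n i - n j) ^ 2 = 2 * ∑ i, ∑ j, n i * n j * ⟪b i, b j⟫ -
      ∑ i, ∑ j, ⟪b i, b j⟫ * n i ^ 2 - ∑ i, ∑ j, ⟪b i, b j⟫ * n j ^ 2 := by
    simp only [Finset.mul_sum, ← Finset.sum_sub_distrib]
    exact Finset.sum_congr rfl fun i _ => Finset.sum_congr rfl fun j _ => by ring
  rw [e3, e1, e2, norm_sq_sum_smul]
  ring

/-- The value of the deep-hole candidate attached to the labelling `π`. -/
def holeValue (b : Fin 6 → Euc 5) (π : Fin 6 → ℤ) : ℝ :=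
  (∑ i, ∑ j, -⟪b i, b j⟫ * ((|π i - π j| * (6 - |π i - π j|) : ℤ) : ℝ)) / 72

lemma IsA.exists_hole {Λ : Set (Euc 5)} {b : Fin 6 → Euc 5} (hb : IsA Λ b)
    (hd : vdet ![b 0, b 1, b 2, b 3, b 4] ≠ 0) (hl : ∀ i j, i ≠ j → ⟪b i, b j⟫ ≤ 0)
    (π : Fin 6 → ℤ) :
    ∃ a, (∀ v ∈ Λ, 2 * ⟪a, v⟫ ≤ ‖v‖ ^ 2) ∧
      2 * ⟪a, ∑ i, (π i / 6 : ℝ) • b i⟫ - ‖∑ i, (π i / 6 : ℝ) • b i‖ ^ 2 = holeValue b π := by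
  set s : Fin 6 → Fin 6 → ℝ := fun i j => ((π i - π j).sign : ℤ) with hs
  have hsanti : ∀ i j, s i j = -s j i := fun i j => by
    simp only [hs]
    rw [← neg_sub, Int.sign_neg]
    push_cast
    ring
  have e0 : ∑ i, ∑ j, ⟪b i, b j⟫ * s i j = 0 := by
    have : ∑ i, ∑ j, ⟪b i, b j⟫ * s i j = -∑ i, ∑ j, ⟪b i, b j⟫ * s i j := by
      conv_lhs => rw [Finset.sum_comm]
      simp only [← Finset.sum_neg_distrib]
      exact Finset.sum_congr rfl fun i _ => Finset.sum_congr rfl fun j _ => by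
        rw [hsanti, real_inner_comm, mul_neg]
    linarith
  obtain ⟨a, ha⟩ := exists_inner_eq_six hb.1 hd (c := fun i => -(1 / 2) * ∑ j, ⟪b i, b j⟫ * s i j)
    (by rw [← Finset.mul_sum, e0, mul_zero])
  have hinner : ∀ n : Fin 6 → ℝ,
      4 * ⟪a, ∑ i, n i • b i⟫ = ∑ i, ∑ j, -⟪b i, b j⟫ * (s i j * (n i - n j)) := fun n => by
    have e1 : 2 * ⟪a, ∑ i, n i • b i⟫ = ∑ i, ∑ j, -⟪b i, b j⟫ * (s i j * n i) := by
      rw [inner_sum, Finset.mul_sum]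
      refine Finset.sum_congr rfl fun i _ => ?_
      rw [real_inner_smul_right, ha, Finset.mul_sum, Finset.mul_sum, Finset.mul_sum]
      exact Finset.sum_congr rfl fun j _ => by ring
    have e2 : ∑ i, ∑ j, -⟪b i, b j⟫ * (s i j * n i) = -∑ i, ∑ j, -⟪b i, b j⟫ * (s i j * n j) := by
      rw [Finset.sum_comm]
      simp only [← Finset.sum_neg_distrib]
      exact Finset.sum_congr rfl fun i _ => Finset.sum_congr rfl fun j _ => by
        rw [hsanti, real_inner_comm]
        ring
    simp only [mul_sub, Finset.sum_sub_distrib]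
    linarith
  refine ⟨a, fun v hv => ?_, ?_⟩
  · obtain ⟨n, rfl⟩ := (hb.2 v).1 hv
    have h : ∑ i, ∑ j, -⟪b i, b j⟫ * (s i j * ((n i : ℝ) - n j)) ≤
        ∑ i, ∑ j, -⟪b i, b j⟫ * ((n i : ℝ) - n j) ^ 2 := by
      refine Finset.sum_le_sum fun i _ => Finset.sum_le_sum fun j _ => ?_
      rcases eq_or_ne i j with rfl | hij
      · simp
      · refine mul_le_mul_of_nonneg_left ?_ (neg_nonneg.2 (hl i j hij))
        have := le_sq_of_int (s := s i j) (by
          simp only [hs]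
          rcases Int.sign_trichotomy (π i - π j) with h | h | h <;> simp [h]) (n i - n j)
        exact_mod_cast this
    rw [← hinner, ← two_mul_norm_sq_eq hb.1] at h
    linarith
  · have h1 := hinner fun i => (π i / 6 : ℝ)
    have h2 := two_mul_norm_sq_eq hb.1 fun i => (π i / 6 : ℝ)
    have h3 : ∑ i, ∑ j, -⟪b i, b j⟫ * (s i j * ((π i / 6 : ℝ) - π j / 6)) -
        ∑ i, ∑ j, -⟪b i, b j⟫ * ((π i / 6 : ℝ) - π j / 6) ^ 2 = 2 * holeValue b π := by
      have e : ∀ S : ℝ, 2 * (S / 72) = 1 / 36 * S := fun S => by ring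
      rw [holeValue, e]
      simp only [Finset.mul_sum, ← Finset.sum_sub_distrib]
      refine Finset.sum_congr rfl fun i _ => Finset.sum_congr rfl fun j _ => ?_
      have hs' : s i j * ((π i : ℝ) - π j) = |(π i : ℝ) - π j| := by
        have := Int.sign_mul_self_eq_abs (π i - π j)
        simp only [hs]
        exact_mod_cast this
      have hsq := sq_abs ((π i : ℝ) - π j)
      push_cast
      linear_combination (-⟪b i, b j⟫ / 6) * hs' - (⟪b i, b j⟫ / 36) * hsq
    linarith

lemma vdet_sq_le_sub_inner {b : Fin 6 → Euc 5} (hb : ∑ i, b i = 0) :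
    25 / 128 * vdet ![b 0, b 1, b 2, b 3, b 4] ^ 2 ≤
      ((1 / 2 * ∑ i, ‖b i‖ ^ 2 - 1 / 4 * ⟪b 4, b 5⟫) / 5) ^ 5 := by
  set P : Matrix (Fin 5) (Fin 5) ℝ := Matrix.diagonal ![1 / 2, 1 / 2, 1 / 2, 1 / 2, 5 / 16] +
    (3 / 16 : ℝ) • Matrix.vecMulVec ![1, 1, 1, 1, 0] ![1, 1, 1, 1, 0] with hPd
  have hP : P.PosSemidef := by
    refine (Matrix.PosSemidef.diagonal fun i => ?_).add (Matrix.PosSemidef.smul ?_ (by norm_num))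
    · fin_cases i <;> norm_num
    · simpa using Matrix.posSemidef_vecMulVec_self_star (![1, 1, 1, 1, 0] : Fin 5 → ℝ)
  have hPe : P = !![11 / 16, 3 / 16, 3 / 16, 3 / 16, 0; 3 / 16, 11 / 16, 3 / 16, 3 / 16, 0;
      3 / 16, 3 / 16, 11 / 16, 3 / 16, 0; 3 / 16, 3 / 16, 3 / 16, 11 / 16, 0;
      0, 0, 0, 0, 5 / 16] := by
    ext i j
    fin_cases i <;> fin_cases j <;> simp [hPd] <;> norm_num
  have hdet : P.det = 25 / 512 := by
    rw [hPe]
    simp [Matrix.det_succ_row_zero, Fin.sum_univ_succ, Fin.succAbove]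
    norm_num
  have h0 := hb
  rw [Fin.sum_univ_six] at h0
  have h2 := vdet_comb !![1, 0, 0, 0, 0; 0, 1, 0, 0, 0; 0, 0, 1, 0, 0; 0, 0, 0, 1, 0;
    1, 1, 1, 1, 2] ![b 0, b 1, b 2, b 3, b 4]
  have h3 : (fun i => ∑ j, (!![1, 0, 0, 0, 0; 0, 1, 0, 0, 0; 0, 0, 1, 0, 0; 0, 0, 0, 1, 0;
    1, 1, 1, 1, 2] : Matrix (Fin 5) (Fin 5) ℝ) i j •
      (![b 0, b 1, b 2, b 3, b 4] : Fin 5 → Euc 5) j) = ![b 0, b 1, b 2, b 3, b 4 - b 5] := by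
    funext i
    fin_cases i <;> simp [Fin.sum_univ_five]
    linear_combination (norm := module) h0
  have h4 : (!![1, 0, 0, 0, 0; 0, 1, 0, 0, 0; 0, 0, 1, 0, 0; 0, 0, 0, 1, 0;
    1, 1, 1, 1, 2] : Matrix (Fin 5) (Fin 5) ℝ).det = 2 := by
    simp [Matrix.det_succ_row_zero, Fin.sum_univ_succ, Fin.succAbove]
  rw [h3, h4] at h2
  have h := vdet_quad hP ![b 0, b 1, b 2, b 3, b 4 - b 5]
  rw [hdet, h2, hPe] at h
  refine le_trans (le_of_eq (by ring)) (h.trans_eq ?_)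
  congr 2
  have h5 : ‖b 0 + b 1 + b 2 + b 3‖ ^ 2 = ‖b 4 + b 5‖ ^ 2 := by
    rw [← norm_neg (b 4 + b 5)]
    congr 2
    linear_combination (norm := module) h0
  simp only [← real_inner_self_eq_norm_sq, inner_add_left, inner_add_right] at h5
  simp only [Fin.sum_univ_six, Fin.sum_univ_five, ← real_inner_self_eq_norm_sq]
  simp [norm_sub_sq_real]
  simp only [real_inner_self_eq_norm_sq] at h5
  linear_combination (3 / 16) * h5 + 3 / 16 * real_inner_comm (b 4) (b 5)

/-- Labellings whose value at a pair, summed over the family, does not depend on the pair. -/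
def orbitOne : Fin 10 → Fin 6 → ℤ :=
  ![![0, 1, 2, 5, 3, 4], ![0, 1, 4, 2, 5, 3], ![0, 1, 3, 4, 2, 5], ![0, 1, 5, 3, 4, 2],
    ![0, 2, 1, 5, 4, 3], ![0, 4, 1, 2, 3, 5], ![0, 3, 1, 4, 5, 2], ![0, 2, 3, 1, 5, 4],
    ![0, 3, 2, 1, 4, 5], ![0, 2, 4, 3, 1, 5]]

/-- A second family of labellings with the property of `orbitOne`. -/
def orbitTwo : Fin 10 → Fin 6 → ℤ :=
  ![![0, 1, 2, 5, 4, 3], ![0, 1, 4, 2, 3, 5], ![0, 1, 5, 3, 2, 4], ![0, 1, 3, 4, 5, 2],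
    ![0, 2, 1, 5, 3, 4], ![0, 4, 1, 2, 5, 3], ![0, 3, 1, 4, 2, 5], ![0, 2, 3, 1, 4, 5],
    ![0, 3, 2, 1, 5, 4], ![0, 4, 2, 3, 1, 5]]

lemma sum_orbitOne : ∀ i j : Fin 6, i ≠ j →
    ∑ k, |orbitOne k i - orbitOne k j| * (6 - |orbitOne k i - orbitOne k j|) = 70 := by
  decide +kernel

lemma sum_orbitTwo : ∀ i j : Fin 6, i ≠ j →
    ∑ k, |orbitTwo k i - orbitTwo k j| * (6 - |orbitTwo k i - orbitTwo k j|) = 70 := by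
  decide +kernel

lemma orbits_disjoint : ∀ k l, ∃ i j, ¬ (6 : ℤ) ∣
    (orbitOne k i - orbitTwo l i) - (orbitOne k j - orbitTwo l j) := by
  decide +kernel

lemma orbits_disjoint_neg : ∀ k l, ∃ i j, ¬ (6 : ℤ) ∣
    (orbitOne k i + orbitTwo l i) - (orbitOne k j + orbitTwo l j) := by
  decide +kernel

lemma sum_holeValue {b : Fin 6 → Euc 5} (hb : ∑ i, b i = 0) {O : Fin 10 → Fin 6 → ℤ}
    (hO : ∀ i j, i ≠ j → ∑ k, |O k i - O k j| * (6 - |O k i - O k j|) = 70) :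
    ∑ k, holeValue b (O k) = 35 / 18 * (1 / 2 * ∑ i, ‖b i‖ ^ 2) := by
  simp only [holeValue, ← Finset.sum_div]
  rw [Finset.sum_comm]
  have h : ∀ i, ∑ k, ∑ j, -⟪b i, b j⟫ * ((|O k i - O k j| * (6 - |O k i - O k j|) : ℤ) : ℝ) =
      70 * ‖b i‖ ^ 2 := fun i => by
    rw [Finset.sum_comm]
    have : ∀ j, ∑ k, -⟪b i, b j⟫ * ((|O k i - O k j| * (6 - |O k i - O k j|) : ℤ) : ℝ) =
        -⟪b i, b j⟫ * 70 + if i = j then 70 * ‖b i‖ ^ 2 else 0 := fun j => by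
      rw [← Finset.mul_sum, ← Int.cast_sum]
      split_ifs with hij
      · subst hij
        simp
        ring
      · rw [hO i j hij]
        simp
    simp only [this, Finset.sum_add_distrib, Finset.sum_ite_eq, Finset.mem_univ, if_true,
      ← Finset.sum_mul, Finset.sum_neg_distrib, sum_inner_eq_zero hb]
    ring
  simp only [h, ← Finset.mul_sum]
  ring

lemma exists_one_lt_holeValue {b : Fin 6 → Euc 5} (hb : ∑ i, b i = 0) {O : Fin 10 → Fin 6 → ℤ}
    (hO : ∀ i j, i ≠ j → ∑ k, |O k i - O k j| * (6 - |O k i - O k j|) = 70)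
    (hL : 36 / 7 < 1 / 2 * ∑ i, ‖b i‖ ^ 2) : ∃ k, 1 < holeValue b (O k) := by
  by_contra! h
  have h1 : ∑ k, holeValue b (O k) ≤ ∑ _k : Fin 10, (1 : ℝ) := Finset.sum_le_sum fun k _ => h k
  rw [sum_holeValue hb hO] at h1
  simp at h1
  linarith

/-- A labelling of value above `1` yields a lattice translate of `±p` close to the associated
point. -/
lemma exists_near_pole {Λ K : Set (Euc 5)} {p : Euc 5} {R δ : ℝ} (hδ : 0 ≤ δ)
    (hC : ∀ x, ∃ v ∈ Λ, x - v ∈ K) (hK : ∀ x ∈ K, ‖x‖ ≤ R) (hR : R ^ 2 - 1 ≤ δ ^ 2)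
    (hp : ∀ x ∈ K, 1 < ‖x‖ → ‖x - p‖ ≤ δ ∨ ‖x + p‖ ≤ δ)
    {a y : Euc 5} (ha : ∀ v ∈ Λ, 2 * ⟪a, v⟫ ≤ ‖v‖ ^ 2) (hy : 1 < 2 * ⟪a, y⟫ - ‖y‖ ^ 2) :
    ∃ v ∈ Λ, ‖y - v - p‖ ≤ 2 * δ ∨ ‖y - v + p‖ ≤ 2 * δ := by
  obtain ⟨v, hv, hav⟩ := hC a
  have h1 := ha v hv
  have h2 := norm_sub_sq_real a v
  have h3 := norm_sub_sq_real a y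
  have h4 : ‖a - v‖ ^ 2 ≤ R ^ 2 := pow_le_pow_left₀ (norm_nonneg _) (hK _ hav) 2
  have h5 := two_inner_sub_le a y
  have h6 : 1 < ‖a - v‖ := by
    by_contra! h
    have := pow_le_one₀ (norm_nonneg _) h (n := 2)
    linarith
  have h7 : ‖a - y‖ ≤ δ := by
    refine (pow_le_pow_iff_left₀ (norm_nonneg _) hδ two_ne_zero).1 ?_
    linarith
  refine ⟨v, hv, (hp _ hav h6).imp (fun h => ?_) fun h => ?_⟩
  · calc ‖y - v - p‖ = ‖(a - v - p) - (a - y)‖ := by congr 1; abel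
      _ ≤ _ := norm_sub_le _ _
      _ ≤ 2 * δ := by linarith
  · calc ‖y - v + p‖ = ‖(a - v + p) - (a - y)‖ := by congr 1; abel
      _ ≤ _ := norm_sub_le _ _
      _ ≤ 2 * δ := by linarith

lemma neg_inner_le {b : Fin 6 → Euc 5} (hb : ∑ i, b i = 0)
    (hl : ∀ i j, i ≠ j → ⟪b i, b j⟫ ≤ 0) (c : Fin 6 → ℤ) {i j : Fin 6}
    (hij : ¬ (6 : ℤ) ∣ c i - c j) : -⟪b i, b j⟫ ≤ 72 * ‖∑ i, (c i / 6 : ℝ) • b i‖ ^ 2 := by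
  have hne : i ≠ j := by
    rintro rfl
    simp at hij
  have h := two_mul_norm_sq_eq hb fun i => (c i / 6 : ℝ)
  have hpos : ∀ i j, 0 ≤ -⟪b i, b j⟫ * ((c i / 6 : ℝ) - c j / 6) ^ 2 := fun i j => by
    rcases eq_or_ne i j with rfl | hij
    · simp
    · exact mul_nonneg (neg_nonneg.2 (hl i j hij)) (sq_nonneg _)
  have h1 : 1 ≤ ((c i : ℝ) - c j) ^ 2 := by
    have : c i - c j ≠ 0 := fun h => hij (h ▸ dvd_zero _)
    have : 0 < (c i - c j) ^ 2 := by positivity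
    have : 1 ≤ (c i - c j) ^ 2 := this
    exact_mod_cast this
  have h2 : -⟪b i, b j⟫ * ((c i / 6 : ℝ) - c j / 6) ^ 2 ≤
      2 * ‖∑ i, (c i / 6 : ℝ) • b i‖ ^ 2 := by
    rw [h]
    exact (Finset.single_le_sum (f := fun j => -⟪b i, b j⟫ * ((c i / 6 : ℝ) - c j / 6) ^ 2)
      (fun j _ => hpos i j) (Finset.mem_univ j)).trans (Finset.single_le_sum
        (f := fun i => ∑ j, -⟪b i, b j⟫ * ((c i / 6 : ℝ) - c j / 6) ^ 2)
        (fun i _ => Finset.sum_nonneg fun j _ => hpos i j) (Finset.mem_univ i))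
  have h3 := mul_le_mul_of_nonneg_left h1 (neg_nonneg.2 (hl i j hne))
  linarith

lemma IsA.det_sq_le {T : Euc 5 →ₗ[ℝ] Euc 5} (hT : LinearMap.det T ≠ 0) {K : Set (Euc 5)}
    {p : Euc 5} {R : ℝ} (hC : ∀ x, ∃ v ∈ T '' intPoints 5, x - v ∈ K) (hK : ∀ x ∈ K, ‖x‖ ≤ R)
    (hR : R ^ 2 ≤ 1 + (1 / 99) ^ 2)
    (hp : ∀ x ∈ K, 1 < ‖x‖ → ‖x - p‖ ≤ 1 / 99 ∨ ‖x + p‖ ≤ 1 / 99)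
    {b : Fin 6 → Euc 5} (hb : IsA (T '' intPoints 5) b)
    (hm : FrameBound (T '' intPoints 5) (1 / 2 * ∑ i, ‖b i‖ ^ 2)) :
    LinearMap.det T ^ 2 ≤ 1296 * (12 / 35) ^ 5 := by
  set Λ := T '' intPoints 5 with hΛ
  have hl : ∀ i j, i ≠ j → ⟪b i, b j⟫ ≤ 0 := fun i j => hb.inner_nonpos hm rfl
  have hdet := hb.abs_vdet hT
  have hd : vdet ![b 0, b 1, b 2, b 3, b 4] ≠ 0 := by
    rw [← abs_pos, hdet]
    exact abs_pos.2 hT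
  set L := 1 / 2 * ∑ i, ‖b i‖ ^ 2 with hL
  have h6 := vdet_sq_le_six hb.1
  rw [← sq_abs, hdet, sq_abs, show ∑ i, ‖b i‖ ^ 2 = 2 * L by rw [hL]; ring] at h6
  by_contra! hlt
  have hL1 : 36 / 7 < L := by
    by_contra! h
    have h0 : 0 ≤ L := by positivity
    have : (2 * L / 5) ^ 5 ≤ (2 * (36 / 7) / 5) ^ 5 := by gcongr
    norm_num at this hlt
    linarith
  have hC' : ∀ x, ∃ v ∈ Λ, ‖x - v‖ ≤ R := fun x => by
    obtain ⟨v, hv, h⟩ := hC x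
    exact ⟨v, hv, hK _ h⟩
  have hL2 : L ≤ 36 / 7 * R ^ 2 := by
    have h1 : ∀ k, holeValue b (orbitOne k) ≤ R ^ 2 := fun k => by
      obtain ⟨a, ha, hay⟩ := hb.exists_hole hd hl (orbitOne k)
      rw [← hay]
      exact (two_inner_sub_le _ _).trans (norm_sq_le_of_hole hC' ha)
    have h2 : ∑ k, holeValue b (orbitOne k) ≤ ∑ _k : Fin 10, R ^ 2 :=
      Finset.sum_le_sum fun k _ => h1 k
    rw [sum_holeValue hb.1 sum_orbitOne] at h2
    simp at h2
    linarith
  have hlow : ∀ i j, i ≠ j → 4 / 25 ≤ -⟪b i, b j⟫ := fun i j hij => by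
    obtain ⟨σ, h4, h5⟩ := exists_perm_four_five hij
    have h1 := vdet_sq_le_sub_inner (hb.perm σ).1
    rw [← sq_abs, (hb.perm σ).abs_vdet hT, sq_abs] at h1
    simp only [Function.comp_apply, h4, h5] at h1
    rw [Equiv.sum_comp σ fun i => ‖b i‖ ^ 2, ← hL] at h1
    by_contra! h
    have h2 : ((L - 1 / 4 * ⟪b i, b j⟫) / 5) ^ 5 ≤
        ((36 / 7 * (1 + (1 / 99) ^ 2) + 1 / 4 * (4 / 25)) / 5) ^ 5 := by
      have := hl i j hij
      have h0 : 0 ≤ L := by linarith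
      refine pow_le_pow_left₀ (by linarith) ?_ 5
      linarith
    norm_num at h2 hlt
    linarith
  obtain ⟨k, hk⟩ := exists_one_lt_holeValue hb.1 sum_orbitOne hL1
  obtain ⟨l, hl'⟩ := exists_one_lt_holeValue hb.1 sum_orbitTwo hL1
  obtain ⟨a, ha, hay⟩ := hb.exists_hole hd hl (orbitOne k)
  obtain ⟨a', ha', hay'⟩ := hb.exists_hole hd hl (orbitTwo l)
  rw [← hay] at hk
  rw [← hay'] at hl'
  obtain ⟨v, hv, h⟩ := exists_near_pole (by norm_num) hC hK (by linarith) hp ha hk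
  obtain ⟨v', hv', h'⟩ := exists_near_pole (by norm_num) hC hK (by linarith) hp ha' hl'
  obtain ⟨n, rfl⟩ := (hb.2 v).1 hv
  obtain ⟨n', rfl⟩ := (hb.2 v').1 hv'
  set y := ∑ i, (orbitOne k i / 6 : ℝ) • b i
  set y' := ∑ i, (orbitTwo l i / 6 : ℝ) • b i
  set v := ∑ i, (n i : ℝ) • b i
  set v' := ∑ i, (n' i : ℝ) • b i
  have hfin : ∀ c : Fin 6 → ℤ, (∃ i j, ¬ (6 : ℤ) ∣ c i - c j) →
      ‖∑ i, (c i / 6 : ℝ) • b i‖ ≤ 4 / 99 → False := by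
    rintro c ⟨i, j, hij⟩ hle
    have hne : i ≠ j := by
      rintro rfl
      simp at hij
    have h1 := neg_inner_le hb.1 hl c hij
    have h2 := hlow i j hne
    have h3 := pow_le_pow_left₀ (norm_nonneg _) hle 2
    norm_num at h3
    linarith
  have hminus : ‖(y - v) - (y' - v')‖ ≤ 4 / 99 → False := by
    refine fun hle => hfin (fun i => orbitOne k i - orbitTwo l i - 6 * (n i - n' i)) ?_ ?_
    · obtain ⟨i, j, hij⟩ := orbits_disjoint k l
      refine ⟨i, j, fun h => hij ?_⟩
      omega
    · convert hle using 2
      simp only [y, y', v, v', ← Finset.sum_sub_distrib, ← sub_smul]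
      refine Finset.sum_congr rfl fun i _ => ?_
      push_cast
      congr 1
      ring
  have hplus : ‖(y - v) + (y' - v')‖ ≤ 4 / 99 → False := by
    refine fun hle => hfin (fun i => orbitOne k i + orbitTwo l i - 6 * (n i + n' i)) ?_ ?_
    · obtain ⟨i, j, hij⟩ := orbits_disjoint_neg k l
      refine ⟨i, j, fun h => hij ?_⟩
      omega
    · convert hle using 2
      simp only [y, y', v, v', ← Finset.sum_sub_distrib, ← sub_smul, ← Finset.sum_add_distrib,
        ← add_smul]
      refine Finset.sum_congr rfl fun i _ => ?_
      push_cast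
      congr 1
      ring
  rcases h with h | h <;> rcases h' with h' | h'
  · refine hminus ?_
    calc ‖(y - v) - (y' - v')‖ = ‖(y - v - p) - (y' - v' - p)‖ := by congr 1; abel
      _ ≤ _ := norm_sub_le _ _
      _ ≤ 4 / 99 := by linarith
  · refine hplus ?_
    calc ‖(y - v) + (y' - v')‖ = ‖(y - v - p) + (y' - v' + p)‖ := by congr 1; abel
      _ ≤ _ := norm_add_le _ _
      _ ≤ 4 / 99 := by linarith
  · refine hplus ?_
    calc ‖(y - v) + (y' - v')‖ = ‖(y - v + p) + (y' - v' - p)‖ := by congr 1; abel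
      _ ≤ _ := norm_add_le _ _
      _ ≤ 4 / 99 := by linarith
  · refine hminus ?_
    calc ‖(y - v) - (y' - v')‖ = ‖(y - v + p) - (y' - v' + p)‖ := by congr 1; abel
      _ ≤ _ := norm_sub_le _ _
      _ ≤ 4 / 99 := by linarith

/-- The absolute values of the off-diagonal inner products. -/
def absGram (u : Fin 5 → Euc 5) (i j : Fin 5) : ℝ := if i = j then 0 else |⟪u i, u j⟫|

/-- The diagonal excess of the Gram matrix. -/
def excess (u : Fin 5 → Euc 5) (i : Fin 5) : ℝ := ‖u i‖ ^ 2 - ∑ j, absGram u i j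

/-- `s` records the signs of the off-diagonal inner products of `u`. -/
def IsSignPattern (u : Fin 5 → Euc 5) (s : Fin 5 → Fin 5 → ℤ) : Prop :=
  ∀ i j, i ≠ j → (s i j = 1 ∨ s i j = -1) ∧ ⟪u i, u j⟫ = s i j * |⟪u i, u j⟫|

lemma absGram_nonneg (u : Fin 5 → Euc 5) (i j : Fin 5) : 0 ≤ absGram u i j := by
  unfold absGram
  split_ifs
  exacts [le_rfl, abs_nonneg _]

lemma absGram_comm (u : Fin 5 → Euc 5) (i j : Fin 5) : absGram u i j = absGram u j i := by
  simp only [absGram, eq_comm (a := i), real_inner_comm (u i)]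

lemma norm_sq_eq_absGram {u : Fin 5 → Euc 5} {s : Fin 5 → Fin 5 → ℤ} (hs : IsSignPattern u s)
    (x : Fin 5 → ℝ) :
    ‖∑ i, x i • u i‖ ^ 2 = ∑ i, excess u i * x i ^ 2 +
      1 / 2 * ∑ i, ∑ j, absGram u i j * (x i + s i j * x j) ^ 2 := by
  have e1 : ∀ i j, absGram u i j * (x i + s i j * x j) ^ 2 =
      absGram u i j * x i ^ 2 + absGram u j i * x j ^ 2 +
        (2 * (x i * x j * ⟪u i, u j⟫) - if i = j then 2 * (x i ^ 2 * ‖u i‖ ^ 2) else 0) :=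
      fun i j => by
    rw [absGram_comm u j i]
    rcases eq_or_ne i j with rfl | hij
    · simp [absGram]
      ring
    · obtain ⟨h1, h2⟩ := hs i j hij
      have h3 : (s i j : ℝ) ^ 2 = 1 := by rcases h1 with h | h <;> simp [h]
      simp only [absGram, hij, if_false]
      linear_combination |⟪u i, u j⟫| * x j ^ 2 * h3 - 2 * x i * x j * h2
  have e2 : ∑ i, ∑ j, absGram u j i * x j ^ 2 = ∑ i, ∑ j, absGram u i j * x i ^ 2 :=
    Finset.sum_comm
  simp only [e1, Finset.sum_add_distrib, Finset.sum_sub_distrib, e2, Finset.sum_ite_eq,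
    Finset.mem_univ, if_true, ← Finset.mul_sum, ← norm_sq_sum_smul, excess, sub_mul]
  simp only [← Finset.sum_mul, mul_comm (x _ ^ 2)]
  ring

lemma exists_weighted_median {r : Fin 5 → ℝ} (hr : ∀ i, 0 ≤ r i) (t : Fin 5 → ℝ) :
    ∃ (k : Fin 5) (s : Fin 5 → ℝ), (∀ i, 0 ≤ s i ∧ s i ≤ 1) ∧
      ∑ i, r i * s i = 1 / 2 * ∑ i, r i ∧
      ∀ i, (s i - 1 / 2) * (t i - t k) = 1 / 2 * |t i - t k| := by
  classical
  set A : Fin 5 → ℝ := fun k => ∑ i with t k ≤ t i, r i with hA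
  set S := ∑ i, r i with hS
  have hS0 : 0 ≤ S := Finset.sum_nonneg fun i _ => hr i
  have hne : (Finset.univ.filter fun k => S / 2 ≤ A k).Nonempty := by
    obtain ⟨k, -, hk⟩ := Finset.exists_min_image Finset.univ t ⟨0, Finset.mem_univ _⟩
    refine ⟨k, ?_⟩
    have : A k = S := by
      simp only [hA]
      rw [Finset.filter_true_of_mem fun i hi => hk i hi]
    simp only [Finset.mem_filter, Finset.mem_univ, true_and, this]
    linarith
  obtain ⟨k, hk, hmax⟩ := Finset.exists_max_image _ t hne
  simp only [Finset.mem_filter, Finset.mem_univ, true_and] at hk hmax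
  set U := ∑ i with t k < t i, r i with hU
  set E := ∑ i with t i = t k, r i with hE
  have hUE : A k = U + E := by
    simp only [hA, hU, hE]
    rw [← Finset.sum_union]
    · refine Finset.sum_congr ?_ fun _ _ => rfl
      ext i
      simp [le_iff_lt_or_eq, eq_comm]
    · rw [Finset.disjoint_filter]
      exact fun i _ h h' => h.ne' h'
  have hUle : U ≤ S / 2 := by
    by_cases hn : (Finset.univ.filter fun i => t k < t i).Nonempty
    · obtain ⟨m, hm, hmin⟩ := Finset.exists_min_image _ t hn
      simp only [Finset.mem_filter, Finset.mem_univ, true_and] at hm hmin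
      have : U = A m := by
        refine Finset.sum_congr ?_ fun _ _ => rfl
        ext i
        simp only [Finset.mem_filter, Finset.mem_univ, true_and]
        exact ⟨hmin i, hm.trans_le⟩
      rw [this]
      by_contra! h
      exact absurd (hmax m h.le) (not_le.2 hm)
    · rw [Finset.not_nonempty_iff_eq_empty] at hn
      rw [hU, hn]
      rw [Finset.sum_empty]
      linarith
  have hE0 : 0 ≤ E := Finset.sum_nonneg fun i _ => hr i
  obtain ⟨θ, h0, h1, hθ⟩ : ∃ θ : ℝ, 0 ≤ θ ∧ θ ≤ 1 ∧ U + θ * E = S / 2 := by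
    rcases hE0.eq_or_lt with h | h
    · exact ⟨0, le_rfl, zero_le_one, by linarith⟩
    · refine ⟨(S / 2 - U) / E, div_nonneg (by linarith) h.le, (div_le_one h).2 (by linarith), ?_⟩
      field_simp
      ring
  refine ⟨k, fun i => if t k < t i then 1 else if t i = t k then θ else 0, fun i => ?_, ?_,
    fun i => ?_⟩
  · dsimp only
    split_ifs <;> constructor <;> linarith
  · have e : ∀ i, r i * (if t k < t i then 1 else if t i = t k then θ else 0) =
        (if t k < t i then r i else 0) + θ * if t i = t k then r i else 0 := fun i => by
      split_ifs with h h'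
      · exact absurd h' h.ne'
      all_goals ring
    simp only [e, Finset.sum_add_distrib, ← Finset.mul_sum, ← Finset.sum_filter]
    linarith
  · dsimp only
    split_ifs with h h'
    · rw [abs_of_pos (sub_pos.2 h)]
      ring
    · simp [h']
    · rw [abs_of_nonpos (by linarith)]
      ring

lemma half_sub_le_sq {s v : ℝ} (hs : s ≤ 1) (hv : 1 / 2 ≤ |v|) : 1 / 4 - s / 2 ≤ v ^ 2 - s * |v| := by
  rw [← sq_abs]
  nlinarith [mul_nonneg (sub_nonneg.2 hv) (by linarith : 0 ≤ |v| + 1 / 2 - s)]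

lemma Int.abs_cast_le_sq (m : ℤ) : |(m : ℝ)| ≤ (m : ℝ) ^ 2 := by
  have h : |m| ≤ m ^ 2 := by
    rw [← sq_abs]
    nlinarith [Int.le_self_sq |m|]
  exact_mod_cast h

/-- The contribution of the diagonal excess `r` to the value of the test point `a / 12`. -/
def diagValue (r a : Fin 5 → ℝ) (k : Fin 5) : ℝ :=
  ∑ i, r i * (|a i| * (6 - |a i|) + 6 * |(|a i| - |a k|)|)

lemma sign_mul_le_abs (x y : ℝ) : SignType.sign x * y ≤ |y| := by
  have h1 := le_abs_self y
  have h2 := neg_le_abs y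
  have h3 := abs_nonneg y
  rcases lt_trichotomy x 0 with h | h | h
  · rw [sign_neg h]; simpa using h2
  · rw [h]; simp
  · rw [sign_pos h]; simpa using h1

lemma IsD.exists_diagValue_le {Λ : Set (Euc 5)} {R : ℝ} (hC : ∀ x, ∃ v ∈ Λ, ‖x - v‖ ≤ R)
    {u : Fin 5 → Euc 5} (hu : IsD Λ u) (hd : vdet u ≠ 0) (hr : ∀ i, 0 ≤ excess u i)
    {s : Fin 5 → Fin 5 → ℤ} (hs : IsSignPattern u s) (a : Fin 5 → ℝ) :
    ∃ k, diagValue (excess u) a k + 1 / 2 * ∑ i, ∑ j, absGram u i j *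
      (|a i + s i j * a j| * (12 - |a i + s i j * a j|)) ≤ 144 * R ^ 2 := by
  obtain ⟨k, θ, hθ, hθS, hθk⟩ := exists_weighted_median hr fun i => |a i|
  refine ⟨k, ?_⟩
  set σ : Fin 5 → Fin 5 → ℝ := fun i j => SignType.sign (a i + s i j * a j) with hσ
  set τ : Fin 5 → ℝ := fun i => SignType.sign (a i) with hτ
  obtain ⟨α, hα⟩ := exists_inner_eq hd fun i => 1 / 2 * (excess u i * (θ i * τ i) +
    1 / 2 * ∑ j, absGram u i j * σ i j + 1 / 2 * ∑ j, absGram u j i * (σ j i * s j i))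
  have hinner : ∀ x : Fin 5 → ℝ, 2 * ⟪α, ∑ i, x i • u i⟫ = ∑ i, excess u i * (θ i * (τ i * x i)) +
      1 / 2 * ∑ i, ∑ j, absGram u i j * (σ i j * (x i + s i j * x j)) := fun x => by
    have e1 : ∑ i, ∑ j, absGram u i j * (σ i j * (s i j * x j)) =
        ∑ i, ∑ j, absGram u j i * (σ j i * (s j i * x i)) := Finset.sum_comm
    simp only [mul_add, Finset.sum_add_distrib, e1]
    simp only [inner_sum, real_inner_smul_right, hα, Finset.mul_sum, ← Finset.sum_add_distrib]
    refine Finset.sum_congr rfl fun i _ => ?_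
    simp only [mul_add, Finset.mul_sum, Finset.sum_add_distrib, add_assoc]
    refine congrArg₂ _ (by ring) (congrArg₂ _ ?_ ?_) <;>
      exact Finset.sum_congr rfl fun j _ => by ring
  have hsq := norm_sq_le_of_hole hC (a := α) fun v hv => by
    obtain ⟨e, n, rfl⟩ := (hu v).1 hv
    rw [hinner, norm_sq_eq_absGram hs]
    refine add_le_add ?_ (mul_le_mul_of_nonneg_left (Finset.sum_le_sum fun i _ =>
      Finset.sum_le_sum fun j _ => ?_) (by norm_num))
    · have h1 : ∀ i, excess u i * (θ i * (τ i * ((n i : ℝ) + e / 2))) ≤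
          excess u i * (θ i * |(n i : ℝ) + e / 2|) := fun i =>
        mul_le_mul_of_nonneg_left (mul_le_mul_of_nonneg_left (sign_mul_le_abs _ _) (hθ i).1) (hr i)
      refine (Finset.sum_le_sum fun i _ => h1 i).trans ?_
      rcases Int.even_or_odd' e with ⟨m, rfl | rfl⟩
      · refine Finset.sum_le_sum fun i _ => mul_le_mul_of_nonneg_left ?_ (hr i)
        have := Int.abs_cast_le_sq (n i + m)
        push_cast at this ⊢
        rw [mul_div_cancel_left₀ _ two_ne_zero]
        nlinarith [(hθ i).2, abs_nonneg ((n i : ℝ) + m)]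
      · have h2 : ∀ i, excess u i * (1 / 4 - θ i / 2) ≤
            excess u i * (((n i : ℝ) + (2 * m + 1 : ℤ) / 2) ^ 2 -
              θ i * |(n i : ℝ) + (2 * m + 1 : ℤ) / 2|) := fun i => by
          refine mul_le_mul_of_nonneg_left (half_sub_le_sq (hθ i).2 ?_) (hr i)
          have h3 : 1 ≤ |2 * (n i + m) + 1| := Int.one_le_abs (by omega)
          have h4 : (1 : ℝ) ≤ |2 * ((n i : ℝ) + m) + 1| := by exact_mod_cast h3
          have h5 : (n i : ℝ) + (2 * m + 1 : ℤ) / 2 = (2 * ((n i : ℝ) + m) + 1) / 2 := by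
            push_cast
            ring
          rw [h5, abs_div, abs_two]
          linarith
        have h3 := Finset.sum_le_sum fun i (_ : i ∈ Finset.univ) => h2 i
        have h4 : ∑ i, excess u i * (1 / 4 - θ i / 2) = 0 := by
          have : ∀ i, excess u i * (1 / 4 - θ i / 2) =
            1 / 4 * excess u i - 1 / 2 * (excess u i * θ i) := fun i => by ring
          simp only [this, Finset.sum_sub_distrib, ← Finset.mul_sum, hθS]
          ring
        rw [h4] at h3
        simp only [mul_sub, Finset.sum_sub_distrib] at h3
        linarith
    · rcases eq_or_ne i j with rfl | hij
      · simp [absGram]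
      refine mul_le_mul_of_nonneg_left ((sign_mul_le_abs _ _).trans ?_) (absGram_nonneg u i j)
      rcases (hs i j hij).1 with h | h
      · have := Int.abs_cast_le_sq (n i + n j + e)
        push_cast at this
        rwa [h, Int.cast_one, show (n i : ℝ) + e / 2 + 1 * (n j + e / 2) = n i + n j + e by ring]
      · have := Int.abs_cast_le_sq (n i - n j)
        push_cast at this
        rwa [h, Int.cast_neg, Int.cast_one,
          show (n i : ℝ) + e / 2 + -1 * (n j + e / 2) = n i - n j by ring]
  have h1 := two_inner_sub_le α (∑ i, (a i / 12) • u i)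
  rw [hinner, norm_sq_eq_absGram hs] at h1
  refine le_trans ?_ (mul_le_mul_of_nonneg_left (h1.trans hsq) (by norm_num : (0 : ℝ) ≤ 144))
  have e1 : ∑ i, excess u i * (12 * ((θ i - 1 / 2) * |a k|)) = 0 := by
    have : ∀ i, excess u i * (12 * ((θ i - 1 / 2) * |a k|)) =
      12 * |a k| * (excess u i * θ i) - 6 * |a k| * excess u i := fun i => by ring
    simp only [this, Finset.sum_sub_distrib, ← Finset.mul_sum, hθS]
    ring
  have e2 : diagValue (excess u) a k = 144 * (∑ i, excess u i * (θ i * (τ i * (a i / 12)))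
      - ∑ i, excess u i * (a i / 12) ^ 2) := by
    rw [← add_zero (diagValue _ _ _), ← e1, diagValue, ← Finset.sum_add_distrib,
      ← Finset.sum_sub_distrib, Finset.mul_sum]
    refine Finset.sum_congr rfl fun i _ => ?_
    have h2 : τ i * a i = |a i| := sign_mul_self (a i)
    linear_combination -12 * excess u i * hθk i - 12 * excess u i * θ i * h2 -
      excess u i * sq_abs (a i)
  have e3 : ∑ i, ∑ j, absGram u i j * (|a i + s i j * a j| * (12 - |a i + s i j * a j|)) =
      144 * (∑ i, ∑ j, absGram u i j * (σ i j * (a i / 12 + s i j * (a j / 12))) -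
        ∑ i, ∑ j, absGram u i j * (a i / 12 + s i j * (a j / 12)) ^ 2) := by
    simp only [← Finset.sum_sub_distrib, Finset.mul_sum]
    refine Finset.sum_congr rfl fun i _ => Finset.sum_congr rfl fun j _ => ?_
    have h2 : σ i j * (a i + s i j * a j) = |a i + s i j * a j| := sign_mul_self _
    linear_combination -12 * absGram u i j * h2 - absGram u i j * sq_abs (a i + s i j * a j)
  rw [e2, e3]
  exact le_of_eq (by ring)

/-- Weighted test points together with a lower triangular matrix, certifying a lower bound for the
covering radius of a lattice of type D. -/
structure Certificate where
  weight : Fin 4 → ℤ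
  point : Fin 4 → Fin 5 → ℤ
  factor : Fin 5 → Fin 5 → ℤ

namespace Certificate

/-- A lower bound for `diagValue ρ a k` valid for every `k`. -/
def diagBound (ρ a : Fin 5 → ℤ) : ℤ :=
  let g (k i : Fin 5) : ℤ := ρ i * (|a i| * (6 - |a i|) + 6 * |(|a i| - |a k|)|)
  let f (k : Fin 5) : ℤ := g k 0 + g k 1 + g k 2 + g k 3 + g k 4
  min (f 0) (min (f 1) (min (f 2) (min (f 3) (f 4))))

/-- The contribution of an off-diagonal entry to the value of a test point. -/
def offDiagValue (e : ℤ) : ℤ := |e| * (12 - |e|)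

/-- The Gram matrix of the rows of the factor. -/
def gram (C : Certificate) (i j : Fin 5) : ℤ :=
  C.factor i 0 * C.factor j 0 + C.factor i 1 * C.factor j 1 + C.factor i 2 * C.factor j 2 +
    C.factor i 3 * C.factor j 3 + C.factor i 4 * C.factor j 4

/-- The weighted sum of the values of `f` at the test points. -/
def total (C : Certificate) (f : (Fin 5 → ℤ) → ℤ) : ℤ :=
  C.weight 0 * f (C.point 0) + C.weight 1 * f (C.point 1) + C.weight 2 * f (C.point 2) +
    C.weight 3 * f (C.point 3)

/-- The certificate `C` is valid for the cone of diagonal excesses spanned by the rows of `ρ` and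
for the sign pattern `s`. -/
def Valid {m : ℕ} (ρ : Fin m → Fin 5 → ℤ) (s : Fin 5 → Fin 5 → ℤ) (C : Certificate) : Prop :=
  (∀ t, 0 ≤ C.weight t) ∧
  (∀ κ, ρ κ 0 * C.gram 0 0 + ρ κ 1 * C.gram 1 1 + ρ κ 2 * C.gram 2 2 + ρ κ 3 * C.gram 3 3 +
    ρ κ 4 * C.gram 4 4 ≤ C.total (diagBound (ρ κ))) ∧
  (∀ i j, i ≠ j → C.gram i i + C.gram j j + 2 * (s i j * C.gram i j) ≤
    C.total fun a => offDiagValue (a i + s i j * a j)) ∧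
  (∀ i j, i < j → C.factor i j = 0) ∧ 0 < ∏ i, C.factor i i ∧
  1001 * ((144 * ∑ t, C.weight t) ^ 5 * 35 ^ 5) ≤
    1000 * (5 ^ 5 * 4 * 1296 * 12 ^ 5 * (∏ i, C.factor i i) ^ 2)

instance {m : ℕ} (ρ : Fin m → Fin 5 → ℤ) (s : Fin 5 → Fin 5 → ℤ) (C : Certificate) :
    Decidable (C.Valid ρ s) := by
  unfold Valid
  infer_instance

/-- The sign pattern with negative first row and the remaining signs given by the bits of `n`. -/
def signs (n : ℕ) : Fin 5 → Fin 5 → ℤ :=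
  let b (k : ℕ) : ℤ := if n.testBit k then 1 else -1
  ![![0, -1, -1, -1, -1], ![-1, 0, b 0, b 1, b 2], ![-1, b 0, 0, b 3, b 4],
    ![-1, b 1, b 3, 0, b 5], ![-1, b 2, b 4, b 5, 0]]

/-- The extreme rays of the first cone of diagonal excesses. -/
def raysOne : Fin 8 → Fin 5 → ℤ :=
  ![![1, 1, 0, 0, 0], ![1, 1, 1, 0, 0], ![1, 1, 1, 1, 0], ![2, 1, 1, 0, 0], ![2, 1, 1, 1, 1],
    ![2, 2, 2, 1, 1], ![3, 1, 1, 1, 0], ![4, 1, 1, 1, 1]]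

/-- The extreme rays of the second cone of diagonal excesses. -/
def raysTwo : Fin 5 → Fin 5 → ℤ :=
  ![![1, 1, 0, 0, 0], ![1, 1, 1, 1, 0], ![1, 1, 1, 1, 1], ![2, 1, 1, 1, 1], ![2, 2, 2, 1, 1]]

instance : Inhabited Certificate := ⟨⟨0, 0, 0⟩⟩

/-- The certificates for the first cone, indexed by sign pattern. -/
def listOne : List Certificate :=
  [⟨![1490, 1510, 0, 0],
    ![![-6, 0, -4, 2, -2], ![-6, 4, 1, -1, -3], ![0, 0, 0, 0, 0], ![0, 0, 0, 0, 0]],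
    ![![189, 0, 0, 0, 0], ![2, 217, 0, 0, 0], ![3, 17, 215, 0, 0], ![4, 57, 49, 233, 0], ![11, 49, 55, 60, 217]]⟩,
   ⟨![1024, 1019, 957, 0],
    ![![6, -1, -1, -4, 3], ![-6, -1, -3, 1, 4], ![0, 5, 2, -3, -6], ![0, 0, 0, 0, 0]],
    ![![189, 0, 0, 0, 0], ![10, 206, 0, 0, 0], ![5, -11, 219, 0, 0], ![31, 51, 30, 230, 0], ![33, 54, 21, 41, 230]]⟩,
   ⟨![161, 139, 0, 0],
    ![![-6, 4, 0, 2, -2], ![-6, 1, -4, 2, -1], ![0, 0, 0, 0, 0], ![0, 0, 0, 0, 0]],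
    ![![60, 0, 0, 0, 0], ![0, 66, 0, 0, 0], ![0, 4, 70, 0, 0], ![1, -7, 19, 74, 0], ![0, 16, 29, 16, 69]]⟩,
   ⟨![509, 491, 0, 0],
    ![![-6, 1, 4, 1, -2], ![6, 2, 0, 4, -3], ![0, 0, 0, 0, 0], ![0, 0, 0, 0, 0]],
    ![![109, 0, 0, 0, 0], ![-1, 122, 0, 0, 0], ![3, -16, 127, 0, 0], ![15, -25, 21, 133, 0], ![12, 17, 22, 29, 135]]⟩,
   ⟨![509, 491, 0, 0],
    ![![-6, 1, -4, -1, 2], ![-6, 2, 0, -4, 3], ![0, 0, 0, 0, 0], ![0, 0, 0, 0, 0]],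
    ![![109, 0, 0, 0, 0], ![1, 122, 0, 0, 0], ![3, 16, 127, 0, 0], ![15, 25, 21, 133, 0], ![12, -17, 22, 29, 135]]⟩,
   ⟨![160, 140, 0, 0],
    ![![0, 2, -6, -4, 4], ![0, -5, -2, 4, -5], ![0, 0, 0, 0, 0], ![0, 0, 0, 0, 0]],
    ![![60, 0, 0, 0, 0], ![1, 67, 0, 0, 0], ![0, -4, 70, 0, 0], ![1, 7, 19, 74, 0], ![0, -16, 29, 16, 69]]⟩,
   ⟨![358, 339, 303, 0],
    ![![-6, 1, -1, 3, -4], ![-6, -3, 1, -4, -1], ![0, -2, 5, -6, -3], ![0, 0, 0, 0, 0]],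
    ![![109, 0, 0, 0, 0], ![0, 125, 0, 0, 0], ![6, 6, 120, 0, 0], ![21, -10, 31, 135, 0], ![17, -15, 32, 23, 130]]⟩,
   ⟨![138, 110, 52, 0],
    ![![-6, 0, 4, 2, -2], ![-6, -4, 1, -3, -1], ![0, -5, -6, 2, -3], ![0, 0, 0, 0, 0]],
    ![![60, 0, 0, 0, 0], ![-1, 68, 0, 0, 0], ![1, -10, 67, 0, 0], ![7, -16, 15, 71, 0], ![2, -19, 14, 16, 73]]⟩,
   ⟨![421, 579, 0, 0],
    ![![0, 2, -5, -4, 5], ![0, -6, -2, -4, 4], ![0, 0, 0, 0, 0], ![0, 0, 0, 0, 0]],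
    ![![110, 0, 0, 0, 0], ![1, 126, 0, 0, 0], ![5, 6, 123, 0, 0], ![1, 36, -15, 135, 0], ![2, 54, 25, 28, 127]]⟩,
   ⟨![486, 514, 0, 0],
    ![![-6, -4, -1, -1, 2], ![0, -6, -4, -2, 3], ![0, 0, 0, 0, 0], ![0, 0, 0, 0, 0]],
    ![![109, 0, 0, 0, 0], ![3, 127, 0, 0, 0], ![-2, -17, 122, 0, 0], ![17, 22, -21, 133, 0], ![11, 19, 19, 28, 135]]⟩,
   ⟨![150, 150, 0, 0],
    ![![-6, 1, 4, 2, -2], ![0, -2, -5, -4, 4], ![0, 0, 0, 0, 0], ![0, 0, 0, 0, 0]],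
    ![![60, 0, 0, 0, 0], ![0, 68, 0, 0, 0], ![0, 9, 67, 0, 0], ![0, -9, -8, 76, 0], ![0, 9, 8, 17, 74]]⟩,
   ⟨![150, 150, 0, 0],
    ![![-6, 4, 1, 2, -2], ![-6, 1, 4, 2, -2], ![0, 0, 0, 0, 0], ![0, 0, 0, 0, 0]],
    ![![60, 0, 0, 0, 0], ![0, 68, 0, 0, 0], ![0, 2, 68, 0, 0], ![0, -9, -9, 76, 0], ![1, 9, 8, 18, 74]]⟩,
   ⟨![150, 150, 0, 0],
    ![![0, 2, -5, -4, 4], ![0, 5, -2, -4, 4], ![0, 0, 0, 0, 0], ![0, 0, 0, 0, 0]],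
    ![![60, 0, 0, 0, 0], ![0, 68, 0, 0, 0], ![0, -2, 68, 0, 0], ![0, 9, -9, 76, 0], ![1, -9, 8, 18, 74]]⟩,
   ⟨![150, 150, 0, 0],
    ![![0, 2, -5, -4, 4], ![0, 5, -2, -4, 4], ![0, 0, 0, 0, 0], ![0, 0, 0, 0, 0]],
    ![![60, 0, 0, 0, 0], ![0, 68, 0, 0, 0], ![0, -9, 67, 0, 0], ![0, 9, -8, 76, 0], ![0, -9, 8, 17, 74]]⟩,
   ⟨![487, 513, 0, 0],
    ![![6, -4, 1, 1, -2], ![-6, 0, -2, -4, 3], ![0, 0, 0, 0, 0], ![0, 0, 0, 0, 0]],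
    ![![109, 0, 0, 0, 0], ![0, 127, 0, 0, 0], ![-1, 17, 122, 0, 0], ![17, -22, -21, 133, 0], ![12, -19, 20, 28, 135]]⟩,
   ⟨![421, 579, 0, 0],
    ![![-6, 4, 1, 2, -1], ![-6, 0, 4, 2, -2], ![0, 0, 0, 0, 0], ![0, 0, 0, 0, 0]],
    ![![110, 0, 0, 0, 0], ![-1, 126, 0, 0, 0], ![5, -6, 123, 0, 0], ![1, -36, -15, 135, 0], ![2, -54, 25, 28, 127]]⟩,
   ⟨![486, 514, 0, 0],
    ![![-6, 4, -1, 1, -2], ![-6, 0, -2, 4, -3], ![0, 0, 0, 0, 0], ![0, 0, 0, 0, 0]],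
    ![![109, 0, 0, 0, 0], ![3, 127, 0, 0, 0], ![2, 17, 122, 0, 0], ![17, 22, 21, 133, 0], ![11, 19, -19, 28, 135]]⟩,
   ⟨![420, 580, 0, 0],
    ![![-6, -4, -1, 2, -1], ![-6, 0, -4, 2, -2], ![0, 0, 0, 0, 0], ![0, 0, 0, 0, 0]],
    ![![110, 0, 0, 0, 0], ![0, 126, 0, 0, 0], ![6, -6, 124, 0, 0], ![1, 36, 15, 135, 0], ![-1, 54, -25, 28, 127]]⟩,
   ⟨![150, 150, 0, 0],
    ![![-6, 4, -1, 2, -2], ![-6, 1, -4, 2, -2], ![0, 0, 0, 0, 0], ![0, 0, 0, 0, 0]],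
    ![![60, 0, 0, 0, 0], ![0, 68, 0, 0, 0], ![0, -2, 68, 0, 0], ![0, -9, 9, 76, 0], ![0, 9, -9, 18, 74]]⟩,
   ⟨![150, 150, 0, 0],
    ![![-6, -4, 1, -2, 2], ![-6, -1, 4, -2, 2], ![0, 0, 0, 0, 0], ![0, 0, 0, 0, 0]],
    ![![60, 0, 0, 0, 0], ![0, 68, 0, 0, 0], ![0, -9, 67, 0, 0], ![0, -9, 8, 76, 0], ![0, 9, -8, 17, 74]]⟩,
   ⟨![150, 150, 0, 0],
    ![![-6, -4, -1, 2, -2], ![0, 5, 2, -4, 4], ![0, 0, 0, 0, 0], ![0, 0, 0, 0, 0]],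
    ![![60, 0, 0, 0, 0], ![0, 68, 0, 0, 0], ![0, 9, 67, 0, 0], ![0, 9, 8, 76, 0], ![0, -9, -8, 17, 74]]⟩,
   ⟨![150, 150, 0, 0],
    ![![-6, 1, 4, -2, 2], ![-6, -4, -1, 2, -2], ![0, 0, 0, 0, 0], ![0, 0, 0, 0, 0]],
    ![![60, 0, 0, 0, 0], ![0, 68, 0, 0, 0], ![0, 2, 68, 0, 0], ![0, 9, 9, 76, 0], ![0, -9, -9, 18, 74]]⟩,
   ⟨![566, 434, 0, 0],
    ![![6, 0, 4, -2, 2], ![-6, -4, 1, -2, 1], ![0, 0, 0, 0, 0], ![0, 0, 0, 0, 0]],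
    ![![109, 0, 0, 0, 0], ![0, 125, 0, 0, 0], ![4, 6, 124, 0, 0], ![2, -36, 15, 135, 0], ![-1, -54, -25, 28, 127]]⟩,
   ⟨![487, 513, 0, 0],
    ![![-6, -4, -1, 1, -2], ![-6, 0, 2, -4, 3], ![0, 0, 0, 0, 0], ![0, 0, 0, 0, 0]],
    ![![109, 0, 0, 0, 0], ![0, 127, 0, 0, 0], ![1, -17, 122, 0, 0], ![17, -22, 21, 133, 0], ![12, -19, -20, 28, 135]]⟩,
   ⟨![1018, 907, 1075, 0],
    ![![0, -3, 5, 2, 5], ![-6, 4, -1, 0, -3], ![6, -1, 1, 3, -4], ![0, 0, 0, 0, 0]],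
    ![![189, 0, 0, 0, 0], ![4, 216, 0, 0, 0], ![-11, 11, 208, 0, 0], ![36, 16, -53, 233, 0], ![30, 25, -55, 39, 226]]⟩,
   ⟨![493, 507, 0, 0],
    ![![-6, 0, 4, 2, -2], ![6, -4, 1, 1, 3], ![0, 0, 0, 0, 0], ![0, 0, 0, 0, 0]],
    ![![109, 0, 0, 0, 0], ![1, 126, 0, 0, 0], ![0, -10, 124, 0, 0], ![2, 33, -29, 134, 0], ![7, 28, -31, 35, 125]]⟩,
   ⟨![494, 506, 0, 0],
    ![![6, -1, 4, -1, 2], ![-6, 2, 0, 4, -3], ![0, 0, 0, 0, 0], ![0, 0, 0, 0, 0]],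
    ![![109, 0, 0, 0, 0], ![-1, 123, 0, 0, 0], ![1, 17, 126, 0, 0], ![16, -24, -19, 133, 0], ![12, 17, -21, 28, 135]]⟩,
   ⟨![47, 53, 0, 0],
    ![![-6, -1, -4, -2, 1], ![0, -4, 6, -2, 3], ![0, 0, 0, 0, 0], ![0, 0, 0, 0, 0]],
    ![![34, 0, 0, 0, 0], ![-1, 38, 0, 0, 0], ![0, -5, 40, 0, 0], ![8, -4, -3, 43, 0], ![2, 9, -10, 9, 41]]⟩,
   ⟨![1376, 1624, 0, 0],
    ![![-6, -1, 4, 2, -1], ![-6, 4, 0, -2, 2], ![0, 0, 0, 0, 0], ![0, 0, 0, 0, 0]],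
    ![![189, 0, 0, 0, 0], ![1, 211, 0, 0, 0], ![0, 14, 223, 0, 0], ![1, 21, -64, 235, 0], ![0, -54, -96, 53, 221]]⟩,
   ⟨![494, 506, 0, 0],
    ![![0, -5, -2, 5, -4], ![0, -4, 6, 2, -3], ![0, 0, 0, 0, 0], ![0, 0, 0, 0, 0]],
    ![![109, 0, 0, 0, 0], ![1, 123, 0, 0, 0], ![1, -17, 126, 0, 0], ![16, 24, -19, 133, 0], ![12, -17, -21, 28, 135]]⟩,
   ⟨![1263, 1243, 494, 0],
    ![![-6, 4, 0, 2, -2], ![6, -1, -4, -1, -3], ![-6, 0, 1, -4, 3], ![0, 0, 0, 0, 0]],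
    ![![189, 0, 0, 0, 0], ![-4, 215, 0, 0, 0], ![-3, 32, 214, 0, 0], ![8, -49, -52, 235, 0], ![16, -58, -37, 54, 222]]⟩,
   ⟨![105, 94, 101, 0],
    ![![-6, -1, -1, -3, 4], ![-6, -1, -4, 0, -3], ![-6, -1, -3, -4, -1], ![0, 0, 0, 0, 0]],
    ![![60, 0, 0, 0, 0], ![-3, 65, 0, 0, 0], ![1, -3, 69, 0, 0], ![11, -17, -7, 74, 0], ![10, -17, -9, 13, 71]]⟩,
   ⟨![150, 150, 0, 0],
    ![![-6, -1, -4, 2, 2], ![0, 2, 5, -4, -4], ![0, 0, 0, 0, 0], ![0, 0, 0, 0, 0]],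
    ![![60, 0, 0, 0, 0], ![0, 68, 0, 0, 0], ![0, 9, 67, 0, 0], ![0, 9, 8, 76, 0], ![0, 9, 8, -17, 74]]⟩,
   ⟨![150, 150, 0, 0],
    ![![-6, -4, -1, 2, 2], ![6, -1, -4, 2, 2], ![0, 0, 0, 0, 0], ![0, 0, 0, 0, 0]],
    ![![60, 0, 0, 0, 0], ![0, 68, 0, 0, 0], ![0, 2, 68, 0, 0], ![0, 9, 9, 76, 0], ![1, 9, 8, -18, 74]]⟩,
   ⟨![416, 584, 0, 0],
    ![![-6, 4, -1, 2, 1], ![-6, 0, 4, -2, -2], ![0, 0, 0, 0, 0], ![0, 0, 0, 0, 0]],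
    ![![109, 0, 0, 0, 0], ![0, 126, 0, 0, 0], ![6, 7, 124, 0, 0], ![1, -37, 15, 135, 0], ![1, 56, 26, -29, 128]]⟩,
   ⟨![488, 512, 0, 0],
    ![![6, 4, 1, -1, -2], ![-6, 0, -2, 4, 3], ![0, 0, 0, 0, 0], ![0, 0, 0, 0, 0]],
    ![![109, 0, 0, 0, 0], ![0, 127, 0, 0, 0], ![5, -16, 122, 0, 0], ![17, -22, 21, 133, 0], ![11, 18, 19, -31, 134]]⟩,
   ⟨![488, 512, 0, 0],
    ![![-6, -4, 1, -1, -2], ![0, -6, -4, 2, 3], ![0, 0, 0, 0, 0], ![0, 0, 0, 0, 0]],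
    ![![109, 0, 0, 0, 0], ![1, 127, 0, 0, 0], ![5, 16, 122, 0, 0], ![17, 22, 21, 133, 0], ![11, -18, 19, -31, 134]]⟩,
   ⟨![414, 586, 0, 0],
    ![![-6, 4, 1, -2, -1], ![-6, 0, 4, -2, -2], ![0, 0, 0, 0, 0], ![0, 0, 0, 0, 0]],
    ![![109, 0, 0, 0, 0], ![0, 127, 0, 0, 0], ![6, -7, 124, 0, 0], ![1, 37, 15, 135, 0], ![1, -57, 26, -29, 128]]⟩,
   ⟨![150, 150, 0, 0],
    ![![-6, 1, -4, 2, 2], ![0, -2, 5, -4, -4], ![0, 0, 0, 0, 0], ![0, 0, 0, 0, 0]],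
    ![![60, 0, 0, 0, 0], ![0, 68, 0, 0, 0], ![0, -2, 68, 0, 0], ![0, -9, 9, 76, 0], ![0, -9, 9, -18, 74]]⟩,
   ⟨![150, 150, 0, 0],
    ![![0, -5, 2, -4, -4], ![-6, 4, -1, 2, 2], ![0, 0, 0, 0, 0], ![0, 0, 0, 0, 0]],
    ![![60, 0, 0, 0, 0], ![0, 68, 0, 0, 0], ![0, -9, 67, 0, 0], ![0, -9, 8, 76, 0], ![0, -9, 8, -17, 74]]⟩,
   ⟨![1377, 1623, 0, 0],
    ![![6, 1, -4, -2, -1], ![0, 2, -6, -4, -4], ![0, 0, 0, 0, 0], ![0, 0, 0, 0, 0]],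
    ![![189, 0, 0, 0, 0], ![1, 211, 0, 0, 0], ![0, 14, 223, 0, 0], ![1, 21, -64, 235, 0], ![0, 54, 96, -53, 221]]⟩,
   ⟨![1508, 1492, 0, 0],
    ![![0, -5, -2, 5, 4], ![6, 2, 0, -4, -3], ![0, 0, 0, 0, 0], ![0, 0, 0, 0, 0]],
    ![![190, 0, 0, 0, 0], ![7, 212, 0, 0, 0], ![4, -28, 220, 0, 0], ![27, 42, -35, 230, 0], ![20, 28, 37, -54, 233]]⟩,
   ⟨![1489, 1511, 0, 0],
    ![![0, 6, -2, -4, -4], ![-6, -4, -1, -1, 3], ![0, 0, 0, 0, 0], ![0, 0, 0, 0, 0]],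
    ![![189, 0, 0, 0, 0], ![2, 217, 0, 0, 0], ![3, 17, 215, 0, 0], ![-4, -57, -49, 233, 0], ![11, 49, 55, -60, 217]]⟩,
   ⟨![334, 333, 333, 0],
    ![![-1, 6, 0, 4, 4], ![-6, -3, -1, -4, 1], ![-6, -3, -1, -1, 4], ![0, 0, 0, 0, 0]],
    ![![104, 0, 0, 0, 0], ![0, 126, 0, 0, 0], ![0, 5, 126, 0, 0], ![0, -24, -23, 134, 0], ![0, 24, 23, -27, 131]]⟩,
   ⟨![986, 504, 980, 530],
    ![![-6, 3, -1, -4, 1], ![-6, 3, -1, -1, 4], ![0, 5, -2, -6, 3], ![5, -6, 0, -2, -2]],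
    ![![187, 0, 0, 0, 0], ![1, 213, 0, 0, 0], ![2, -8, 220, 0, 0], ![-2, 51, -36, 225, 0], ![11, -15, 55, -53, 228]]⟩,
   ⟨![520, 480, 0, 0],
    ![![-6, -4, 0, -2, -2], ![-6, -1, 4, 3, -1], ![0, 0, 0, 0, 0], ![0, 0, 0, 0, 0]],
    ![![109, 0, 0, 0, 0], ![0, 123, 0, 0, 0], ![0, -11, 127, 0, 0], ![0, 29, -24, 127, 0], ![0, -34, 39, -35, 132]]⟩,
   ⟨![1508, 1492, 0, 0],
    ![![0, -5, 2, -5, -4], ![0, -4, 6, -2, -3], ![0, 0, 0, 0, 0], ![0, 0, 0, 0, 0]],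
    ![![190, 0, 0, 0, 0], ![-7, 212, 0, 0, 0], ![4, 28, 220, 0, 0], ![27, -42, -35, 230, 0], ![20, -28, 37, -54, 233]]⟩,
   ⟨![1377, 1623, 0, 0],
    ![![-6, -1, -4, -2, -1], ![0, 2, 6, 4, 4], ![0, 0, 0, 0, 0], ![0, 0, 0, 0, 0]],
    ![![189, 0, 0, 0, 0], ![0, 211, 0, 0, 0], ![0, -14, 223, 0, 0], ![1, -21, -64, 235, 0], ![0, -54, 96, -53, 221]]⟩,
   ⟨![508, 492, 0, 0],
    ![![0, -5, 2, 5, 4], ![-6, -2, 0, 4, 3], ![0, 0, 0, 0, 0], ![0, 0, 0, 0, 0]],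
    ![![109, 0, 0, 0, 0], ![5, 122, 0, 0, 0], ![3, 16, 127, 0, 0], ![16, 25, 21, 133, 0], ![11, 16, -21, -31, 134]]⟩,
   ⟨![139, 161, 0, 0],
    ![![0, 5, 2, -4, -5], ![6, 4, 0, -2, -2], ![0, 0, 0, 0, 0], ![0, 0, 0, 0, 0]],
    ![![60, 0, 0, 0, 0], ![0, 66, 0, 0, 0], ![0, -4, 70, 0, 0], ![1, 7, 19, 74, 0], ![0, 16, -29, -16, 69]]⟩,
   ⟨![69, 106, 50, 75],
    ![![6, 4, -1, 0, -3], ![-6, 3, -1, 4, -1], ![-6, -1, 3, -1, 4], ![1, -6, 0, -4, -4]],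
    ![![58, 0, 0, 0, 0], ![0, 69, 0, 0, 0], ![0, -4, 68, 0, 0], ![0, -15, 13, 72, 0], ![0, 12, -15, -16, 72]]⟩,
   ⟨![118, 48, 134, 0],
    ![![-6, 1, -4, 1, -3], ![-6, -1, 0, 4, 3], ![-6, -4, 0, -2, -2], ![0, 0, 0, 0, 0]],
    ![![60, 0, 0, 0, 0], ![0, 68, 0, 0, 0], ![0, -10, 67, 0, 0], ![2, -17, 15, 74, 0], ![5, 18, -14, -17, 70]]⟩,
   ⟨![134, 118, 48, 0],
    ![![0, 6, -2, 4, 4], ![0, 2, 5, -5, 3], ![-6, 0, 1, 4, 3], ![0, 0, 0, 0, 0]],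
    ![![60, 0, 0, 0, 0], ![0, 68, 0, 0, 0], ![0, 10, 67, 0, 0], ![2, 17, 14, 74, 0], ![5, -17, -15, -17, 70]]⟩,
   ⟨![299, 446, 256, 0],
    ![![-1, 0, 6, 4, 4], ![-6, 1, 3, -1, 4], ![-6, 1, 4, -3, 0], ![0, 0, 0, 0, 0]],
    ![![104, 0, 0, 0, 0], ![-2, 125, 0, 0, 0], ![-2, 7, 127, 0, 0], ![-3, 32, 23, 132, 0], ![11, -31, -25, -29, 132]]⟩,
   ⟨![160, 140, 0, 0],
    ![![-6, -4, 0, -2, -2], ![-6, 1, -4, 2, 1], ![0, 0, 0, 0, 0], ![0, 0, 0, 0, 0]],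
    ![![60, 0, 0, 0, 0], ![1, 67, 0, 0, 0], ![0, 4, 70, 0, 0], ![1, -7, 19, 74, 0], ![0, -16, -29, -16, 69]]⟩,
   ⟨![492, 508, 0, 0],
    ![![-6, 2, 0, 4, 3], ![-6, 1, 4, 1, 2], ![0, 0, 0, 0, 0], ![0, 0, 0, 0, 0]],
    ![![109, 0, 0, 0, 0], ![-5, 122, 0, 0, 0], ![3, -16, 127, 0, 0], ![16, -25, 21, 133, 0], ![11, -16, -21, -31, 134]]⟩,
   ⟨![150, 150, 0, 0],
    ![![-6, 1, -4, -2, -2], ![-6, -4, 1, 2, 2], ![0, 0, 0, 0, 0], ![0, 0, 0, 0, 0]],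
    ![![60, 0, 0, 0, 0], ![0, 68, 0, 0, 0], ![0, -2, 68, 0, 0], ![0, 9, -9, 76, 0], ![0, 9, -9, -18, 74]]⟩,
   ⟨![150, 150, 0, 0],
    ![![-6, 1, -4, -2, -2], ![6, 4, -1, -2, -2], ![0, 0, 0, 0, 0], ![0, 0, 0, 0, 0]],
    ![![60, 0, 0, 0, 0], ![0, 68, 0, 0, 0], ![0, -9, 67, 0, 0], ![0, 9, -8, 76, 0], ![0, 9, -8, -17, 74]]⟩,
   ⟨![488, 512, 0, 0],
    ![![-6, -4, 1, 1, 2], ![-6, 0, 2, 4, 3], ![0, 0, 0, 0, 0], ![0, 0, 0, 0, 0]],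
    ![![109, 0, 0, 0, 0], ![0, 127, 0, 0, 0], ![-5, 16, 122, 0, 0], ![17, -22, -21, 133, 0], ![11, 18, -19, -31, 134]]⟩,
   ⟨![42, 58, 0, 0],
    ![![0, 2, 5, 4, 5], ![-6, 0, 4, 2, 2], ![0, 0, 0, 0, 0], ![0, 0, 0, 0, 0]],
    ![![34, 0, 0, 0, 0], ![0, 40, 0, 0, 0], ![2, -2, 39, 0, 0], ![0, -12, -5, 43, 0], ![0, 18, -8, -9, 40]]⟩,
   ⟨![578, 422, 0, 0],
    ![![-6, 0, 4, 2, 2], ![0, 2, -5, -4, -5], ![0, 0, 0, 0, 0], ![0, 0, 0, 0, 0]],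
    ![![110, 0, 0, 0, 0], ![1, 126, 0, 0, 0], ![5, 6, 123, 0, 0], ![1, 36, -15, 135, 0], ![-1, -54, -25, -28, 127]]⟩,
   ⟨![488, 512, 0, 0],
    ![![-6, 4, 1, 1, 2], ![6, 0, -2, -4, -3], ![0, 0, 0, 0, 0], ![0, 0, 0, 0, 0]],
    ![![109, 0, 0, 0, 0], ![1, 127, 0, 0, 0], ![-5, -16, 122, 0, 0], ![17, 22, -21, 133, 0], ![11, -18, -19, -31, 134]]⟩,
   ⟨![150, 150, 0, 0],
    ![![-6, 4, 1, 2, 2], ![-6, 1, 4, 2, 2], ![0, 0, 0, 0, 0], ![0, 0, 0, 0, 0]],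
    ![![60, 0, 0, 0, 0], ![0, 68, 0, 0, 0], ![0, 9, 67, 0, 0], ![0, -9, -8, 76, 0], ![0, -9, -8, -17, 74]]⟩,
   ⟨![150, 150, 0, 0],
    ![![-6, 1, 4, 2, 2], ![-6, -4, -1, -2, -2], ![0, 0, 0, 0, 0], ![0, 0, 0, 0, 0]],
    ![![60, 0, 0, 0, 0], ![0, 68, 0, 0, 0], ![0, 2, 68, 0, 0], ![0, -9, -9, 76, 0], ![0, -9, -9, -18, 74]]⟩]

/-- The certificates for the second cone, indexed by sign pattern. -/
def listTwo : List Certificate :=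
  [⟨![709, 791, 709, 791],
    ![![-6, 3, 0, -1, -5], ![-5, -1, 0, 6, 3], ![-3, 6, 0, 5, 1], ![-5, -1, -6, 3, 0]],
    ![![214, 0, 0, 0, 0], ![9, 214, 0, 0, 0], ![28, 27, 213, 0, 0], ![31, 25, 24, 216, 0], ![27, 30, 24, 12, 215]]⟩,
   ⟨![954, 732, 545, 769],
    ![![-6, 3, 1, -1, -5], ![-6, 1, 3, -5, -1], ![-5, -1, 0, -6, 3], ![0, 5, 1, 6, -3]],
    ![![207, 0, 0, 0, 0], ![5, 219, 0, 0, 0], ![27, -22, 218, 0, 0], ![35, 22, 13, 211, 0], ![42, 21, 0, 5, 215]]⟩,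
   ⟨![99, 59, 97, 45],
    ![![0, 3, -1, 5, -5], ![-3, 6, 1, 0, 5], ![-6, -1, 1, -3, 5], ![0, 3, -5, 1, 6]],
    ![![65, 0, 0, 0, 0], ![2, 68, 0, 0, 0], ![7, 5, 67, 0, 0], ![7, 1, 3, 69, 0], ![10, 9, 7, 8, 69]]⟩,
   ⟨![412, 365, 223, 0],
    ![![-5, 3, 1, 5, -1], ![-6, -1, -5, -1, 3], ![-3, 0, 1, 5, -6], ![0, 0, 0, 0, 0]],
    ![![119, 0, 0, 0, 0], ![-2, 123, 0, 0, 0], ![16, -8, 123, 0, 0], ![10, -13, 2, 126, 0], ![7, -2, 16, 14, 126]]⟩,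
   ⟨![1061, 753, 1185, 0],
    ![![-6, -3, 1, 5, -1], ![3, 0, -1, -5, -6], ![0, 5, -1, -5, 3], ![0, 0, 0, 0, 0]],
    ![![208, 0, 0, 0, 0], ![6, 217, 0, 0, 0], ![37, 19, 211, 0, 0], ![31, 22, 3, 212, 0], ![12, 1, 26, 29, 222]]⟩,
   ⟨![124, 107, 69, 0],
    ![![-5, 3, 1, -1, 5], ![0, -5, -1, 3, -5], ![-3, 0, 1, 6, 5], ![0, 0, 0, 0, 0]],
    ![![65, 0, 0, 0, 0], ![-1, 67, 0, 0, 0], ![8, -4, 67, 0, 0], ![3, -1, 8, 69, 0], ![7, -8, 1, 9, 70]]⟩,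
   ⟨![2414, 4055, 3531, 0],
    ![![0, 5, -1, 3, -6], ![-5, 3, -1, 5, 1], ![-6, 3, -1, 1, 5], ![0, 0, 0, 0, 0]],
    ![![370, 0, 0, 0, 0], ![-8, 385, 0, 0, 0], ![24, -7, 399, 0, 0], ![37, -4, 31, 397, 0], ![51, -66, 46, 22, 403]]⟩,
   ⟨![874, 774, 725, 626],
    ![![-5, 1, 0, 6, 3], ![3, -1, 6, -5, -1], ![-5, 1, 3, 0, 6], ![-5, 3, 5, 0, 1]],
    ![![211, 0, 0, 0, 0], ![-5, 214, 0, 0, 0], ![10, -30, 214, 0, 0], ![25, -23, 25, 213, 0], ![29, -17, 13, 32, 219]]⟩,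
   ⟨![84, 108, 108, 0],
    ![![-5, -1, 6, 0, 3], ![-5, -1, 3, 5, 0], ![-5, -1, 1, 3, 6], ![0, 0, 0, 0, 0]],
    ![![67, 0, 0, 0, 0], ![3, 67, 0, 0, 0], ![9, 6, 69, 0, 0], ![6, 8, -1, 69, 0], ![11, 11, 2, 2, 66]]⟩,
   ⟨![1512, 764, 723, 0],
    ![![5, -1, -3, -5, 1], ![5, 1, -6, 0, -3], ![3, -6, -5, -1, 0], ![0, 0, 0, 0, 0]],
    ![![212, 0, 0, 0, 0], ![1, 211, 0, 0, 0], ![28, -20, 213, 0, 0], ![30, 24, 1, 214, 0], ![7, 32, 7, 29, 218]]⟩,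
   ⟨![519, 231, 249, 0],
    ![![1, -5, -1, -3, 5], ![-6, 1, 0, 5, -3], ![3, 0, -5, -1, -6], ![0, 0, 0, 0, 0]],
    ![![123, 0, 0, 0, 0], ![0, 123, 0, 0, 0], ![16, 11, 122, 0, 0], ![17, -15, 0, 125, 0], ![6, 18, 13, 0, 124]]⟩,
   ⟨![455, 252, 293, 0],
    ![![-5, 1, 5, 3, -1], ![-3, 0, 5, 1, 6], ![-6, 1, 1, 5, -3], ![0, 0, 0, 0, 0]],
    ![![122, 0, 0, 0, 0], ![-2, 125, 0, 0, 0], ![14, -2, 125, 0, 0], ![19, -13, 0, 122, 0], ![6, 15, 12, 0, 123]]⟩,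
   ⟨![455, 252, 293, 0],
    ![![-5, -1, 5, 3, -1], ![-3, 0, 5, 1, 6], ![-6, -1, 1, 5, -3], ![0, 0, 0, 0, 0]],
    ![![122, 0, 0, 0, 0], ![2, 125, 0, 0, 0], ![14, 2, 125, 0, 0], ![19, 13, 0, 122, 0], ![6, -15, 12, 0, 123]]⟩,
   ⟨![231, 519, 249, 0],
    ![![-6, -1, 0, 5, -3], ![-5, -1, 5, 3, -1], ![-3, 0, 5, 1, 6], ![0, 0, 0, 0, 0]],
    ![![123, 0, 0, 0, 0], ![0, 123, 0, 0, 0], ![16, -11, 122, 0, 0], ![17, 15, 0, 125, 0], ![6, -18, 13, 0, 124]]⟩,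
   ⟨![199, 153, 449, 200],
    ![![-5, 0, 1, 3, 6], ![-6, 5, -1, -1, 3], ![-5, -1, 3, 5, -1], ![-6, -3, 5, 0, -1]],
    ![![120, 0, 0, 0, 0], ![4, 121, 0, 0, 0], ![8, 12, 128, 0, 0], ![11, -4, -8, 126, 0], ![12, -14, -1, 12, 124]]⟩,
   ⟨![84, 108, 108, 0],
    ![![-5, 1, 6, 0, 3], ![-5, 1, 3, 5, 0], ![-5, 1, 1, 3, 6], ![0, 0, 0, 0, 0]],
    ![![67, 0, 0, 0, 0], ![-3, 67, 0, 0, 0], ![9, -6, 69, 0, 0], ![6, -8, -1, 69, 0], ![11, -11, 2, 2, 66]]⟩,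
   ⟨![1099, 802, 1099, 0],
    ![![-1, -5, 3, -6, 1], ![1, 5, 0, -3, -6], ![-1, -5, 5, 0, 3], ![0, 0, 0, 0, 0]],
    ![![212, 0, 0, 0, 0], ![10, 212, 0, 0, 0], ![26, 21, 219, 0, 0], ![34, 32, 5, 207, 0], ![22, 25, -5, 5, 219]]⟩,
   ⟨![506, 241, 252, 0],
    ![![-5, 1, 3, -1, 5], ![6, -3, -5, 1, 0], ![-5, 0, 1, -6, 3], ![0, 0, 0, 0, 0]],
    ![![121, 0, 0, 0, 0], ![1, 122, 0, 0, 0], ![11, -17, 124, 0, 0], ![13, 16, 0, 124, 0], ![18, 8, 0, 16, 126]]⟩,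
   ⟨![467, 288, 245, 0],
    ![![-1, -5, 1, -5, 3], ![-6, 3, -1, 1, -5], ![3, 0, -1, 6, -5], ![0, 0, 0, 0, 0]],
    ![![121, 0, 0, 0, 0], ![4, 124, 0, 0, 0], ![15, 11, 125, 0, 0], ![2, -15, 3, 124, 0], ![19, -2, 0, 13, 123]]⟩,
   ⟨![840, 1470, 690, 0],
    ![![-6, 3, 0, 1, -5], ![1, 5, -1, 5, -3], ![0, 3, -6, 1, -5], ![0, 0, 0, 0, 0]],
    ![![209, 0, 0, 0, 0], ![7, 218, 0, 0, 0], ![14, -13, 214, 0, 0], ![16, -38, 14, 212, 0], ![30, 2, -29, 0, 217]]⟩,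
   ⟨![1477, 695, 828, 0],
    ![![1, -5, -1, 5, -3], ![-6, -3, 0, 5, -1], ![0, -3, 6, 5, -1], ![0, 0, 0, 0, 0]],
    ![![209, 0, 0, 0, 0], ![4, 218, 0, 0, 0], ![14, 13, 214, 0, 0], ![17, 38, 13, 213, 0], ![29, -2, -28, 0, 217]]⟩,
   ⟨![468, 244, 288, 0],
    ![![1, -5, -1, 5, -3], ![-3, 0, 1, -6, 5], ![-6, -3, -1, 1, -5], ![0, 0, 0, 0, 0]],
    ![![122, 0, 0, 0, 0], ![-1, 124, 0, 0, 0], ![15, -11, 125, 0, 0], ![2, 15, 3, 124, 0], ![19, 2, 0, 13, 123]]⟩,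
   ⟨![719, 1655, 626, 0],
    ![![-1, 0, 3, 6, 5], ![-5, -1, 3, -1, 5], ![0, 5, -1, 3, -6], ![0, 0, 0, 0, 0]],
    ![![206, 0, 0, 0, 0], ![8, 208, 0, 0, 0], ![22, 1, 221, 0, 0], ![4, -27, 8, 213, 0], ![31, -26, -10, 29, 221]]⟩,
   ⟨![102, 122, 76, 0],
    ![![1, -5, -1, 6, -3], ![1, -5, -5, 0, -3], ![-6, -3, -1, 0, -5], ![0, 0, 0, 0, 0]],
    ![![67, 0, 0, 0, 0], ![-2, 68, 0, 0, 0], ![3, -8, 70, 0, 0], ![9, -11, 3, 64, 0], ![11, 0, -1, 3, 69]]⟩,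
   ⟨![86, 85, 129, 0],
    ![![-1, -5, 1, -6, 3], ![-5, -1, 1, 3, -6], ![-1, -5, 3, 1, 5], ![0, 0, 0, 0, 0]],
    ![![67, 0, 0, 0, 0], ![1, 67, 0, 0, 0], ![5, 4, 70, 0, 0], ![6, 6, 0, 67, 0], ![6, 6, 0, 3, 67]]⟩,
   ⟨![554, 1049, 1013, 383],
    ![![-5, 6, 1, 3, 0], ![-1, 6, 3, 1, 5], ![-1, 6, 3, 5, 1], ![-6, -3, -5, 1, 0]],
    ![![215, 0, 0, 0, 0], ![4, 205, 0, 0, 0], ![10, -7, 218, 0, 0], ![10, 33, -3, 212, 0], ![17, 40, -32, 24, 219]]⟩,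
   ⟨![180, 378, 261, 182],
    ![![0, -3, 6, -5, 1], ![1, 5, -3, -1, -5], ![-6, 1, -5, 1, -3], ![-3, 0, 1, 5, -6]],
    ![![122, 0, 0, 0, 0], ![2, 124, 0, 0, 0], ![13, 10, 123, 0, 0], ![9, -8, -10, 125, 0], ![15, 13, -1, 12, 124]]⟩,
   ⟨![709, 1125, 576, 591],
    ![![-6, -1, -5, -3, 1], ![-5, 1, 3, 1, 5], ![-6, -3, 0, -5, 1], ![-3, 0, 1, -6, 5]],
    ![![212, 0, 0, 0, 0], ![-1, 215, 0, 0, 0], ![17, -19, 211, 0, 0], ![22, -17, -3, 212, 0], ![23, 19, -24, 24, 221]]⟩,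
   ⟨![283, 434, 284, 0],
    ![![-6, 1, -1, -3, 5], ![-5, 1, 5, -1, 3], ![-1, -5, 3, 1, 6], ![0, 0, 0, 0, 0]],
    ![![121, 0, 0, 0, 0], ![1, 123, 0, 0, 0], ![13, 10, 125, 0, 0], ![15, 13, -3, 125, 0], ![14, -15, -4, 0, 123]]⟩,
   ⟨![997, 891, 1112, 0],
    ![![-5, 1, 3, 0, 5], ![-6, 3, 5, -1, 1], ![-5, 1, 1, -6, 3], ![0, 0, 0, 0, 0]],
    ![![211, 0, 0, 0, 0], ![0, 216, 0, 0, 0], ![25, -27, 215, 0, 0], ![24, 29, 0, 206, 0], ![22, 3, 0, 27, 223]]⟩,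
   ⟨![1114, 1125, 761, 0],
    ![![-1, 5, 1, -6, 3], ![3, -1, -5, -5, -1], ![-6, -3, 0, -5, -1], ![0, 0, 0, 0, 0]],
    ![![206, 0, 0, 0, 0], ![-2, 211, 0, 0, 0], ![15, 7, 221, 0, 0], ![15, -34, -18, 212, 0], ![-1, -29, -32, 7, 218]]⟩,
   ⟨![285, 470, 244, 0],
    ![![-5, 1, 1, 3, -6], ![-5, 1, 3, 5, 1], ![-6, -1, -5, 0, -3], ![0, 0, 0, 0, 0]],
    ![![121, 0, 0, 0, 0], ![-3, 123, 0, 0, 0], ![13, -9, 127, 0, 0], ![13, -9, 0, 124, 0], ![14, -14, 0, 5, 122]]⟩,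
   ⟨![802, 1099, 1099, 0],
    ![![-5, -1, 3, 0, 6], ![-5, -1, 6, 3, 1], ![-1, -5, 6, 1, 3], ![0, 0, 0, 0, 0]],
    ![![212, 0, 0, 0, 0], ![10, 212, 0, 0, 0], ![34, 32, 207, 0, 0], ![22, 25, 5, 219, 0], ![26, 21, 5, -5, 219]]⟩,
   ⟨![467, 245, 288, 0],
    ![![-1, -5, -5, 1, 3], ![-3, 0, -6, 1, 5], ![-6, 3, 1, -1, -5], ![0, 0, 0, 0, 0]],
    ![![121, 0, 0, 0, 0], ![4, 124, 0, 0, 0], ![2, -15, 124, 0, 0], ![15, 11, 3, 125, 0], ![19, -2, 13, 0, 123]]⟩,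
   ⟨![1524, 695, 781, 0],
    ![![-5, 1, -1, 3, 5], ![-5, -1, 6, 0, 3], ![-6, 3, -1, 5, 0], ![0, 0, 0, 0, 0]],
    ![![213, 0, 0, 0, 0], ![-1, 217, 0, 0, 0], ![18, 30, 210, 0, 0], ![27, -30, 0, 213, 0], ![30, 7, 24, -4, 215]]⟩,
   ⟨![4898, 2301, 2801, 0],
    ![![-5, -1, -1, 5, 3], ![0, 3, 1, -6, -5], ![-6, -3, -1, 0, 5], ![0, 0, 0, 0, 0]],
    ![![381, 0, 0, 0, 0], ![13, 397, 0, 0, 0], ![30, -70, 389, 0, 0], ![25, -24, 25, 391, 0], ![54, 3, -3, -52, 397]]⟩,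
   ⟨![232, 492, 276, 0],
    ![![-6, 3, -5, 0, 1], ![-5, 1, -1, 5, 3], ![-6, 3, -1, 0, 5], ![0, 0, 0, 0, 0]],
    ![![121, 0, 0, 0, 0], ![2, 125, 0, 0, 0], ![10, 22, 123, 0, 0], ![8, 7, 8, 123, 0], ![17, -1, -1, -16, 125]]⟩,
   ⟨![1715, 4151, 1995, 2139],
    ![![3, 0, -6, -5, -1], ![-5, -1, -1, 3, 5], ![-6, 3, 1, -5, 0], ![-1, 3, 1, -6, 5]],
    ![![384, 0, 0, 0, 0], ![-6, 385, 0, 0, 0], ![16, -36, 393, 0, 0], ![24, 6, 15, 392, 0], ![43, -60, 29, -52, 403]]⟩,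
   ⟨![288, 244, 468, 0],
    ![![-6, -3, 1, -1, -5], ![3, 6, 0, -5, -1], ![-5, 1, -1, 5, 3], ![0, 0, 0, 0, 0]],
    ![![122, 0, 0, 0, 0], ![-1, 124, 0, 0, 0], ![2, 15, 124, 0, 0], ![15, -11, 3, 125, 0], ![19, 2, 13, 0, 123]]⟩,
   ⟨![76, 122, 102, 0],
    ![![6, 3, 0, 1, 5], ![1, -5, 0, -5, -3], ![-5, 1, 0, 5, 3], ![0, 0, 0, 0, 0]],
    ![![67, 0, 0, 0, 0], ![-2, 68, 0, 0, 0], ![9, -11, 64, 0, 0], ![3, -8, 3, 70, 0], ![11, 0, 3, -1, 69]]⟩,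
   ⟨![817, 1647, 536, 0],
    ![![-5, -1, 1, 3, -6], ![-1, -5, 1, 3, 5], ![0, -5, -6, 1, 3], ![0, 0, 0, 0, 0]],
    ![![209, 0, 0, 0, 0], ![5, 212, 0, 0, 0], ![22, 24, 214, 0, 0], ![20, -2, 0, 221, 0], ![20, 32, 0, -13, 214]]⟩,
   ⟨![1108, 1177, 715, 0],
    ![![1, 5, 5, -1, -3], ![5, 1, -5, -3, -1], ![0, 3, 5, 6, -1], ![0, 0, 0, 0, 0]],
    ![![213, 0, 0, 0, 0], ![1, 217, 0, 0, 0], ![14, -20, 208, 0, 0], ![18, 3, -27, 215, 0], ![18, 30, 0, 0, 215]]⟩,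
   ⟨![469, 856, 782, 893],
    ![![-3, 0, -6, 1, 5], ![-5, -1, 0, -6, 3], ![-6, 3, -1, 0, -5], ![1, -6, -1, -3, -5]],
    ![![217, 0, 0, 0, 0], ![4, 215, 0, 0, 0], ![16, 26, 215, 0, 0], ![31, -31, -22, 211, 0], ![27, 35, 24, 0, 212]]⟩,
   ⟨![694, 703, 974, 629],
    ![![-5, 1, 3, 5, 0], ![5, 1, 1, 6, -3], ![-5, 1, 3, 1, -6], ![0, -3, -1, -6, 5]],
    ![![204, 0, 0, 0, 0], ![-2, 214, 0, 0, 0], ![16, -14, 217, 0, 0], ![32, -24, -3, 221, 0], ![26, 24, 14, -35, 214]]⟩,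
   ⟨![270, 262, 468, 0],
    ![![5, 1, -1, -3, -6], ![-5, 1, 6, 0, 3], ![-1, -5, 3, 1, -5], ![0, 0, 0, 0, 0]],
    ![![120, 0, 0, 0, 0], ![1, 124, 0, 0, 0], ![15, 11, 128, 0, 0], ![13, 11, 0, 124, 0], ![14, -14, 1, -7, 121]]⟩,
   ⟨![189, 236, 250, 325],
    ![![-3, 0, 5, 1, -6], ![-1, 5, -6, 0, 3], ![-6, -3, 0, 1, -5], ![1, 6, -1, -3, -5]],
    ![![125, 0, 0, 0, 0], ![-1, 124, 0, 0, 0], ![7, -16, 125, 0, 0], ![15, 17, -12, 123, 0], ![17, -21, 12, 0, 121]]⟩,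
   ⟨![299, 363, 339, 0],
    ![![-6, -3, 1, -5, -1], ![-1, 5, 0, 5, 3], ![1, -5, -6, -3, -1], ![0, 0, 0, 0, 0]],
    ![![122, 0, 0, 0, 0], ![0, 125, 0, 0, 0], ![13, 17, 118, 0, 0], ![16, -16, 0, 124, 0], ![12, 2, 14, 0, 128]]⟩,
   ⟨![520, 205, 274, 0],
    ![![-5, 1, 5, 3, 1], ![-5, 1, 0, 5, 3], ![-5, 1, 1, 3, -6], ![0, 0, 0, 0, 0]],
    ![![122, 0, 0, 0, 0], ![-3, 122, 0, 0, 0], ![12, -15, 122, 0, 0], ![9, 1, 0, 129, 0], ![9, -16, 0, -7, 123]]⟩,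
   ⟨![502, 498, 0, 0],
    ![![-5, -1, 1, 5, 3], ![-5, -1, 5, 1, 3], ![0, 0, 0, 0, 0], ![0, 0, 0, 0, 0]],
    ![![122, 0, 0, 0, 0], ![1, 122, 0, 0, 0], ![8, 8, 122, 0, 0], ![8, 8, 0, 122, 0], ![0, 0, 0, 0, 130]]⟩,
   ⟨![1386, 785, 829, 0],
    ![![-5, -1, 5, 1, 3], ![-6, 3, 1, -5, 0], ![-6, 3, 1, -1, -5], ![0, 0, 0, 0, 0]],
    ![![209, 0, 0, 0, 0], ![7, 216, 0, 0, 0], ![15, 1, 215, 0, 0], ![12, 37, 13, 216, 0], ![22, 4, -35, 0, 213]]⟩,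
   ⟨![1151, 661, 1188, 0],
    ![![5, 1, -1, -5, -3], ![3, 6, 0, -1, -5], ![-5, -1, 3, -1, 5], ![0, 0, 0, 0, 0]],
    ![![213, 0, 0, 0, 0], ![1, 213, 0, 0, 0], ![3, 20, 217, 0, 0], ![19, -15, 25, 208, 0], ![29, 17, 0, 0, 217]]⟩,
   ⟨![75, 85, 52, 88],
    ![![0, -3, 6, -1, 5], ![-5, 1, 0, 3, 5], ![3, 0, -6, -5, -1], ![-1, -6, 1, 5, 3]],
    ![![69, 0, 0, 0, 0], ![-1, 67, 0, 0, 0], ![4, -9, 67, 0, 0], ![8, -10, 6, 67, 0], ![6, 10, -7, 0, 68]]⟩,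
   ⟨![354, 167, 261, 217],
    ![![-5, 0, 5, 1, 3], ![0, -3, 6, 5, -1], ![-3, -1, 1, 5, 5], ![-6, -3, 0, 5, -1]],
    ![![122, 0, 0, 0, 0], ![6, 120, 0, 0, 0], ![8, 11, 126, 0, 0], ![6, 19, 9, 123, 0], ![10, -4, -15, -12, 126]]⟩,
   ⟨![464, 260, 276, 0],
    ![![-5, 1, 1, 5, 3], ![0, -3, -1, 5, 6], ![-6, 3, 1, -1, 5], ![0, 0, 0, 0, 0]],
    ![![120, 0, 0, 0, 0], ![-1, 125, 0, 0, 0], ![6, -22, 125, 0, 0], ![9, -1, 8, 124, 0], ![13, -3, -1, -20, 123]]⟩,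
   ⟨![95, 139, 66, 0],
    ![![-5, 1, 0, 5, 3], ![-1, 5, 1, 5, 3], ![-6, -3, 1, -1, -5], ![0, 0, 0, 0, 0]],
    ![![68, 0, 0, 0, 0], ![0, 67, 0, 0, 0], ![4, 9, 65, 0, 0], ![2, -8, 2, 69, 0], ![10, 0, -2, 0, 69]]⟩,
   ⟨![1584, 709, 708, 0],
    ![![-1, 5, 5, 1, 3], ![-6, 1, 3, 0, 5], ![-6, -3, -5, 0, -1], ![0, 0, 0, 0, 0]],
    ![![212, 0, 0, 0, 0], ![-6, 217, 0, 0, 0], ![21, -41, 213, 0, 0], ![18, -20, 0, 210, 0], ![24, 2, 0, -26, 216]]⟩,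
   ⟨![382, 378, 239, 0],
    ![![-5, -1, 1, 5, 3], ![-5, -1, 3, 1, 5], ![0, -3, 1, 5, -6], ![0, 0, 0, 0, 0]],
    ![![123, 0, 0, 0, 0], ![1, 124, 0, 0, 0], ![9, 14, 123, 0, 0], ![4, 8, 0, 124, 0], ![10, -1, 0, -11, 124]]⟩,
   ⟨![1443, 778, 778, 0],
    ![![1, 5, -1, -5, -3], ![-6, 3, 0, -1, -5], ![0, -3, -6, 1, 5], ![0, 0, 0, 0, 0]],
    ![![210, 0, 0, 0, 0], ![7, 216, 0, 0, 0], ![12, -11, 213, 0, 0], ![11, 38, -14, 215, 0], ![26, 2, -31, 0, 217]]⟩,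
   ⟨![2595, 2595, 4810, 0],
    ![![0, -3, 5, -6, 1], ![0, -3, 1, 6, 5], ![-5, -1, 1, 5, 3], ![0, 0, 0, 0, 0]],
    ![![384, 0, 0, 0, 0], ![13, 395, 0, 0, 0], ![21, 69, 394, 0, 0], ![23, -20, -25, 389, 0], ![48, 4, 4, -57, 396]]⟩,
   ⟨![1354, 745, 901, 0],
    ![![-5, 1, 3, 1, 5], ![-6, -3, -5, -1, 0], ![-1, 6, 5, 1, 3], ![0, 0, 0, 0, 0]],
    ![![215, 0, 0, 0, 0], ![-3, 211, 0, 0, 0], ![21, -33, 212, 0, 0], ![4, -25, 0, 218, 0], ![26, 10, 0, -22, 214]]⟩,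
   ⟨![901, 745, 1354, 0],
    ![![-1, -6, 5, 1, 3], ![-6, 3, -5, -1, 0], ![-5, -1, 3, 1, 5], ![0, 0, 0, 0, 0]],
    ![![215, 0, 0, 0, 0], ![3, 211, 0, 0, 0], ![21, 33, 212, 0, 0], ![4, 25, 0, 218, 0], ![26, -10, 0, -22, 214]]⟩,
   ⟨![469, 272, 260, 0],
    ![![1, -5, -5, -1, -3], ![-3, 0, 5, 5, 1], ![0, 3, 1, -6, 5], ![0, 0, 0, 0, 0]],
    ![![123, 0, 0, 0, 0], ![-1, 123, 0, 0, 0], ![11, -16, 125, 0, 0], ![14, 3, -3, 124, 0], ![-2, -19, 0, -15, 123]]⟩,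
   ⟨![272, 260, 469, 0],
    ![![3, 6, -1, -1, -5], ![-6, -3, 0, -5, -1], ![-5, 1, 5, 1, 3], ![0, 0, 0, 0, 0]],
    ![![122, 0, 0, 0, 0], ![-1, 123, 0, 0, 0], ![14, 3, 124, 0, 0], ![11, -16, -3, 125, 0], ![-2, -19, -15, 0, 123]]⟩,
   ⟨![472, 260, 269, 0],
    ![![-5, 1, 5, 1, 3], ![0, 3, 5, 1, -6], ![0, -3, 6, -5, -1], ![0, 0, 0, 0, 0]],
    ![![121, 0, 0, 0, 0], ![-1, 125, 0, 0, 0], ![9, 2, 125, 0, 0], ![6, -21, -10, 124, 0], ![13, -4, -18, 0, 124]]⟩]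

lemma valid_listOne : ∀ n < 64, ((listOne).getD n default).Valid raysOne (signs n) := by
  decide +kernel

lemma valid_listTwo : ∀ n < 64, ((listTwo).getD n default).Valid raysTwo (signs n) := by
  decide +kernel

end Certificate

namespace Certificate

lemma diagBound_le (ρ a : Fin 5 → ℤ) (k : Fin 5) :
    (diagBound ρ a : ℝ) ≤ diagValue (fun i => (ρ i : ℝ)) (fun i => (a i : ℝ)) k := by
  have h : diagBound ρ a ≤ ∑ i, ρ i * (|a i| * (6 - |a i|) + 6 * |(|a i| - |a k|)|) := by
    rw [Fin.sum_univ_five]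
    unfold diagBound
    fin_cases k
    · exact min_le_left _ _
    · exact (min_le_right _ _).trans (min_le_left _ _)
    · exact (min_le_right _ _).trans ((min_le_right _ _).trans (min_le_left _ _))
    · exact (min_le_right _ _).trans ((min_le_right _ _).trans
        ((min_le_right _ _).trans (min_le_left _ _)))
    · exact (min_le_right _ _).trans ((min_le_right _ _).trans
        ((min_le_right _ _).trans (min_le_right _ _)))
  have h' : ((diagBound ρ a : ℤ) : ℝ) ≤
    ((∑ i, ρ i * (|a i| * (6 - |a i|) + 6 * |(|a i| - |a k|)|) : ℤ) : ℝ) := by exact_mod_cast h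
  refine h'.trans (le_of_eq ?_)
  simp [diagValue]

lemma gram_eq (C : Certificate) (i j : Fin 5) :
    C.gram i j = ∑ k, C.factor i k * C.factor j k := by
  simp only [Fin.sum_univ_five, gram]

lemma total_eq (C : Certificate) (f : (Fin 5 → ℤ) → ℤ) :
    C.total f = ∑ t, C.weight t * f (C.point t) := by
  simp only [Fin.sum_univ_four, total]

variable {m : ℕ} {ρ : Fin m → Fin 5 → ℤ} {s : Fin 5 → Fin 5 → ℤ} {C : Certificate}

lemma Valid.sum_norm_sq_le (h : C.Valid ρ s) {Λ : Set (Euc 5)} {R : ℝ}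
    (hC : ∀ x, ∃ v ∈ Λ, ‖x - v‖ ≤ R) {u : Fin 5 → Euc 5} (hu : IsD Λ u) (hd : vdet u ≠ 0)
    (hr : ∀ i, 0 ≤ excess u i) (hs : IsSignPattern u s) {c : Fin m → ℝ} (hc : ∀ κ, 0 ≤ c κ)
    (hcu : ∀ i, excess u i = ∑ κ, c κ * ρ κ i) :
    ∑ k, ‖∑ i, (C.factor i k : ℝ) • u i‖ ^ 2 ≤ (∑ t, C.weight t : ℤ) * (144 * R ^ 2) := by
  obtain ⟨hw, hdiag, hoff, -⟩ := h
  have h1 : ∀ t, (C.weight t : ℝ) * (∑ κ, c κ * diagBound (ρ κ) (C.point t) +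
      1 / 2 * ∑ i, ∑ j, absGram u i j * offDiagValue (C.point t i + s i j * C.point t j)) ≤
      C.weight t * (144 * R ^ 2) := fun t => by
    obtain ⟨k, hk⟩ := hu.exists_diagValue_le hC hd hr hs fun i => (C.point t i : ℝ)
    refine mul_le_mul_of_nonneg_left (le_trans (add_le_add ?_ (le_of_eq ?_)) hk)
      (by exact_mod_cast hw t)
    · refine (Finset.sum_le_sum fun κ _ =>
        mul_le_mul_of_nonneg_left (diagBound_le (ρ κ) (C.point t) k) (hc κ)).trans (le_of_eq ?_)
      simp only [diagValue, hcu, Finset.mul_sum, Finset.sum_mul]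
      rw [Finset.sum_comm]
      exact Finset.sum_congr rfl fun i _ => Finset.sum_congr rfl fun κ _ => by ring
    · simp [offDiagValue]
  have h2 : ∀ κ, ∑ i, (ρ κ i : ℝ) * C.gram i i ≤
      ∑ t, (C.weight t : ℝ) * diagBound (ρ κ) (C.point t) := fun κ => by
    have := hdiag κ
    rw [total_eq] at this
    rw [Fin.sum_univ_five]
    exact_mod_cast this
  have h3 : ∀ i j, absGram u i j * (C.gram i i + C.gram j j + 2 * (s i j * C.gram i j)) ≤
      absGram u i j *
        ∑ t, (C.weight t : ℝ) * offDiagValue (C.point t i + s i j * C.point t j) := fun i j => by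
    rcases eq_or_ne i j with rfl | hij
    · simp [absGram]
    · refine mul_le_mul_of_nonneg_left ?_ (absGram_nonneg u i j)
      have := hoff i j hij
      rw [total_eq] at this
      exact_mod_cast this
  have h4 : ∑ k, ‖∑ i, (C.factor i k : ℝ) • u i‖ ^ 2 = ∑ κ, c κ * ∑ i, (ρ κ i : ℝ) * C.gram i i +
      1 / 2 * ∑ i, ∑ j, absGram u i j * (C.gram i i + C.gram j j + 2 * (s i j * C.gram i j)) := by
    simp only [norm_sq_eq_absGram hs, Finset.sum_add_distrib, ← Finset.mul_sum]
    congr 1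
    · simp only [hcu, Finset.mul_sum, Finset.sum_mul, gram_eq, Int.cast_sum]
      rw [Finset.sum_comm_cycle]
      refine Finset.sum_congr rfl fun κ _ => ?_
      rw [Finset.sum_comm]
      exact Finset.sum_congr rfl fun i _ => Finset.sum_congr rfl fun j _ => by push_cast; ring
    · congr 1
      rw [Finset.sum_comm]
      refine Finset.sum_congr rfl fun i _ => ?_
      rw [Finset.sum_comm]
      refine Finset.sum_congr rfl fun j _ => ?_
      rcases eq_or_ne i j with rfl | hij
      · simp [absGram]
      have h5 : (s i j : ℝ) ^ 2 = 1 := by rcases (hs i j hij).1 with h | h <;> simp [h]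
      simp only [gram_eq, Int.cast_sum, Finset.mul_sum, ← Finset.sum_add_distrib]
      refine Finset.sum_congr rfl fun k _ => ?_
      push_cast
      linear_combination absGram u i j * (C.factor j k : ℝ) ^ 2 * h5
  rw [h4]
  refine (add_le_add (Finset.sum_le_sum fun κ _ => mul_le_mul_of_nonneg_left (h2 κ) (hc κ))
    (mul_le_mul_of_nonneg_left (Finset.sum_le_sum fun i _ => Finset.sum_le_sum fun j _ => h3 i j)
      (by norm_num))).trans ?_
  rw [Int.cast_sum, Finset.sum_mul]
  refine le_trans (le_of_eq ?_) (Finset.sum_le_sum fun t _ => h1 t)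
  simp only [mul_add, Finset.sum_add_distrib, Finset.mul_sum]
  congr 1
  · rw [Finset.sum_comm]
    exact Finset.sum_congr rfl fun t _ => Finset.sum_congr rfl fun κ _ => by ring
  · rw [Finset.sum_comm_cycle]
    exact Finset.sum_congr rfl fun t _ => Finset.sum_congr rfl fun i _ =>
      Finset.sum_congr rfl fun j _ => by ring

lemma Valid.det_sq_le (h : C.Valid ρ s) {T : Euc 5 →ₗ[ℝ] Euc 5} (hT : LinearMap.det T ≠ 0) {R : ℝ}
    (hC : ∀ x, ∃ v ∈ T '' intPoints 5, ‖x - v‖ ≤ R) (hR : R ^ 2 ≤ 1 + (1 / 99) ^ 2)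
    {u : Fin 5 → Euc 5} (hu : IsD (T '' intPoints 5) u)
    (hr : ∀ i, 0 ≤ excess u i) (hs : IsSignPattern u s) {c : Fin m → ℝ} (hc : ∀ κ, 0 ≤ c κ)
    (hcu : ∀ i, excess u i = ∑ κ, c κ * ρ κ i) :
    LinearMap.det T ^ 2 ≤ 1296 * (12 / 35) ^ 5 := by
  have hdet := hu.abs_vdet hT
  have hd : vdet u ≠ 0 := fun h0 => by
    rw [h0, abs_zero] at hdet
    have := abs_pos.2 hT
    linarith
  have h1 := h.sum_norm_sq_le hC hu hd hr hs hc hcu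
  obtain ⟨hw, -, -, htri, hpos, hnum⟩ := h
  set P : ℤ := ∏ i, C.factor i i with hP
  set W : ℤ := ∑ t, C.weight t with hW
  have h2 := vdet_sq_le fun k => ∑ i, (C.factor i k : ℝ) • u i
  have h3 : vdet (fun k => ∑ i, (C.factor i k : ℝ) • u i) = P * vdet u := by
    have h5 := vdet_comb (Matrix.of fun k i => (C.factor i k : ℝ)) u
    simp only [Matrix.of_apply] at h5
    rw [h5, Matrix.det_of_isUpperTriangular]
    · simp [hP]
    · intro i j hij
      simpa using htri j i hij
  have hW0 : (0 : ℝ) ≤ W := by exact_mod_cast Finset.sum_nonneg fun t _ => hw t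
  have h4 : (P : ℝ) ^ 2 * (4 * LinearMap.det T ^ 2) ≤ (W * (144 * R ^ 2) / 5) ^ 5 := by
    have h5 : vdet u ^ 2 = 4 * LinearMap.det T ^ 2 := by
      rw [← sq_abs, hdet, mul_pow, sq_abs]
      norm_num
    rw [← h5, ← mul_pow, ← h3]
    refine h2.trans (pow_le_pow_left₀ ?_ ?_ 5)
    · positivity
    · linarith
  have hR5 : (R ^ 2) ^ 5 ≤ 1001 / 1000 :=
    (pow_le_pow_left₀ (sq_nonneg R) hR 5).trans (by norm_num)
  have hP0 : (0 : ℝ) < P := by exact_mod_cast hpos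
  have hnum' : 1001 * ((144 * (W : ℝ)) ^ 5 * 35 ^ 5) ≤
    1000 * (5 ^ 5 * 4 * 1296 * 12 ^ 5 * (P : ℝ) ^ 2) := by exact_mod_cast hnum
  have h6 : (W * (144 * R ^ 2) / 5) ^ 5 ≤ (144 * (W : ℝ)) ^ 5 / 5 ^ 5 * (1001 / 1000) := by
    rw [show (W * (144 * R ^ 2) / 5) ^ 5 = (144 * (W : ℝ)) ^ 5 / 5 ^ 5 * (R ^ 2) ^ 5 by ring]
    exact mul_le_mul_of_nonneg_left hR5 (by positivity)
  have h7 : (P : ℝ) ^ 2 * LinearMap.det T ^ 2 ≤ P ^ 2 * (1296 * (12 / 35) ^ 5) := by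
    linarith
  exact le_of_mul_le_mul_left h7 (by positivity)

end Certificate

lemma absGram_self (u : Fin 5 → Euc 5) (i : Fin 5) : absGram u i i = 0 := if_pos rfl

lemma absGram_of_ne (u : Fin 5 → Euc 5) {i j : Fin 5} (h : i ≠ j) :
    absGram u i j = |⟪u i, u j⟫| := if_neg h

lemma excess_perm (u : Fin 5 → Euc 5) (σ : Equiv.Perm (Fin 5)) (i : Fin 5) :
    excess (u ∘ σ) i = excess u (σ i) := by
  have h := Equiv.sum_comp σ fun j => absGram u (σ i) j
  simp only [excess, ← h]
  simp only [absGram, Function.comp_apply, σ.injective.eq_iff]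

lemma excess_flip (u : Fin 5 → Euc 5) {ε : Fin 5 → ℝ} (hε : ∀ i, ε i = 1 ∨ ε i = -1) (i : Fin 5) :
    excess (fun i => ε i • u i) i = excess u i := by
  have h1 : ∀ i, |ε i| = 1 := fun i => by rcases hε i with h | h <;> simp [h]
  simp [excess, absGram, norm_smul, inner_smul_left, inner_smul_right, abs_mul, h1]

lemma IsMinD.excess_zero_nonneg {Λ : Set (Euc 5)} {u : Fin 5 → Euc 5} (h : IsMinD Λ u) :
    0 ≤ excess u 0 := by
  have := h.sum_abs_inner_le
  simp (disch := decide) only [excess, Fin.sum_univ_five, absGram_self, absGram_of_ne]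
  linarith

lemma IsMinD.excess_nonneg {Λ : Set (Euc 5)} {u : Fin 5 → Euc 5} (h : IsMinD Λ u) (i : Fin 5) :
    0 ≤ excess u i := by
  have := (h.perm (Equiv.swap 0 i)).excess_zero_nonneg
  rwa [excess_perm, Equiv.swap_apply_left] at this

lemma IsMinD.excess_zero_le {Λ : Set (Euc 5)} {u : Fin 5 → Euc 5} (h : IsMinD Λ u) :
    excess u 0 ≤ excess u 1 + excess u 2 + excess u 3 + excess u 4 := by
  have := h.norm_sq_le
  simp only [excess, Fin.sum_univ_five]
  rw [absGram_comm u 1 0, absGram_comm u 2 0, absGram_comm u 3 0, absGram_comm u 4 0,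
    absGram_comm u 2 1, absGram_comm u 3 1, absGram_comm u 4 1, absGram_comm u 3 2,
    absGram_comm u 4 2, absGram_comm u 4 3]
  simp (disch := decide) only [absGram_self, absGram_of_ne]
  linarith

namespace Certificate

lemma exists_signs {u : Fin 5 → Euc 5} (h : ∀ j, j ≠ 0 → ⟪u 0, u j⟫ ≤ 0) :
    ∃ n < 64, IsSignPattern u (signs n) := by
  have key : ∀ b : Fin 6 → Bool, ∃ n < 64, ∀ k : Fin 6, n.testBit k = b k := fun b =>
    ⟨Nat.ofBits b, Nat.ofBits_lt_two_pow b, fun k => Nat.testBit_ofBits_lt b k k.2⟩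
  classical
  obtain ⟨n, hn, hb⟩ := key ![decide (0 ≤ ⟪u 1, u 2⟫), decide (0 ≤ ⟪u 1, u 3⟫),
    decide (0 ≤ ⟪u 1, u 4⟫), decide (0 ≤ ⟪u 2, u 3⟫), decide (0 ≤ ⟪u 2, u 4⟫),
    decide (0 ≤ ⟪u 3, u 4⟫)]
  refine ⟨n, hn, ?_⟩
  have hneg : ∀ j, j ≠ 0 → ⟪u 0, u j⟫ = ((-1 : ℤ) : ℝ) * |⟪u 0, u j⟫| := fun j hj => by
    rw [abs_of_nonpos (h j hj)]
    simp
  have hbit : ∀ k (x : ℝ), n.testBit k = decide (0 ≤ x) →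
      ((if n.testBit k then 1 else -1 : ℤ) = 1 ∨ (if n.testBit k then 1 else -1 : ℤ) = -1) ∧
        x = ((if n.testBit k then 1 else -1 : ℤ) : ℝ) * |x| := fun k x hk => by
    rw [hk]
    rcases le_or_gt 0 x with hx | hx
    · simp [hx, abs_of_nonneg hx]
    · simp [hx.not_ge, abs_of_neg hx]
  have hsymm : ∀ i j, i < j → (signs n i j = 1 ∨ signs n i j = -1) ∧
      ⟪u i, u j⟫ = signs n i j * |⟪u i, u j⟫| := fun i j hij => by
    fin_cases i <;> fin_cases j <;> first
      | exact absurd hij (by decide)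
      | exact ⟨Or.inr rfl, hneg _ (by decide)⟩
      | exact hbit 0 _ (hb 0)
      | exact hbit 1 _ (hb 1)
      | exact hbit 2 _ (hb 2)
      | exact hbit 3 _ (hb 3)
      | exact hbit 4 _ (hb 4)
      | exact hbit 5 _ (hb 5)
  have hs : ∀ i j, signs n i j = signs n j i := fun i j => by
    fin_cases i <;> fin_cases j <;> rfl
  intro i j hij
  rcases lt_or_gt_of_ne hij with h | h
  · exact hsymm i j h
  · rw [hs, real_inner_comm]
    exact hsymm j i h

lemma exists_coeff {r : Fin 5 → ℝ} (h01 : r 1 ≤ r 0) (h12 : r 2 ≤ r 1) (h23 : r 3 ≤ r 2)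
    (h34 : r 4 ≤ r 3) (h4 : 0 ≤ r 4) (h : r 0 ≤ r 1 + r 2 + r 3 + r 4) :
    (∃ c : Fin 8 → ℝ, (∀ κ, 0 ≤ c κ) ∧ ∀ i, r i = ∑ κ, c κ * raysOne κ i) ∨
      ∃ c : Fin 5 → ℝ, (∀ κ, 0 ≤ c κ) ∧ ∀ i, r i = ∑ κ, c κ * raysTwo κ i := by
  have one : ∀ c : Fin 8 → ℝ, (∀ κ, 0 ≤ c κ) →
      r 0 = c 0 + c 1 + c 2 + 2 * c 3 + 2 * c 4 + 2 * c 5 + 3 * c 6 + 4 * c 7 →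
      r 1 = c 0 + c 1 + c 2 + c 3 + c 4 + 2 * c 5 + c 6 + c 7 →
      r 2 = c 1 + c 2 + c 3 + c 4 + 2 * c 5 + c 6 + c 7 →
      r 3 = c 2 + c 4 + c 5 + c 6 + c 7 → r 4 = c 4 + c 5 + c 7 →
      ∃ c : Fin 8 → ℝ, (∀ κ, 0 ≤ c κ) ∧ ∀ i, r i = ∑ κ, c κ * raysOne κ i := by
    refine fun c hc e0 e1 e2 e3 e4 => ⟨c, hc, fun i => ?_⟩
    fin_cases i <;> simp [Fin.sum_univ_eight, raysOne, e0, e1, e2, e3, e4] <;> try ring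
  rcases le_total (r 0 + r 2) (r 1 + r 3 + r 4) with h1 | h1
  · refine Or.inr ⟨![r 1 - r 2, r 3 - r 4, -r 0 + r 1 - r 2 + r 3 + r 4, r 0 - r 1, r 2 - r 3],
      fun κ => ?_, fun i => ?_⟩
    · fin_cases κ <;> simp <;> linarith
    · fin_cases i <;> simp [Fin.sum_univ_five, raysTwo] <;> ring
  refine Or.inl ?_
  rcases le_total (-r 0 + r 1 + r 2 + r 3 - r 4) 0 with h2 | h2
  · refine one ![r 1 - r 2, 0, 0, r 2 - r 3, (-r 0 + r 1 + r 2 + r 3 + r 4) / 2, 0, r 3 - r 4,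
      (r 0 - r 1 - r 2 - r 3 + r 4) / 2] (fun κ => ?_) ?_ ?_ ?_ ?_ ?_
    · fin_cases κ <;> simp <;> linarith
    all_goals (simp; try ring)
  rcases le_total 0 (r 0 - r 1 - r 2 + r 3 - r 4) with h3 | h3
  · refine one ![r 1 - r 2, 0, (-r 0 + r 1 + r 2 + r 3 - r 4) / 2, r 2 - r 3, r 4, 0,
      (r 0 - r 1 - r 2 + r 3 - r 4) / 2, 0] (fun κ => ?_) ?_ ?_ ?_ ?_ ?_
    · fin_cases κ <;> simp <;> linarith
    all_goals (simp; try ring)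
  rcases le_total 0 (-r 0 + r 1 + r 2 - r 3 - r 4) with h5 | h5
  · refine one ![r 1 - r 2, -r 0 + r 1 + r 2 - r 3 - r 4, r 3 - r 4, r 0 - r 1, 0, r 4, 0, 0]
      (fun κ => ?_) ?_ ?_ ?_ ?_ ?_
    · fin_cases κ <;> simp <;> linarith
    all_goals (simp; try ring)
  · refine one ![r 1 - r 2, 0, r 3 - r 4, (r 0 - r 1 + r 2 - r 3 - r 4) / 2,
      (r 0 - r 1 - r 2 + r 3 + r 4) / 2, (-r 0 + r 1 + r 2 - r 3 + r 4) / 2, 0, 0]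
      (fun κ => ?_) ?_ ?_ ?_ ?_ ?_
    · fin_cases κ <;> simp <;> linarith
    all_goals (simp; try ring)

end Certificate

open Certificate in
lemma IsMinD.det_sq_le {T : Euc 5 →ₗ[ℝ] Euc 5} (hT : LinearMap.det T ≠ 0) {R : ℝ}
    (hC : ∀ x, ∃ v ∈ T '' intPoints 5, ‖x - v‖ ≤ R) (hR : R ^ 2 ≤ 1 + (1 / 99) ^ 2)
    {u : Fin 5 → Euc 5} (hu : IsMinD (T '' intPoints 5) u) :
    LinearMap.det T ^ 2 ≤ 1296 * (12 / 35) ^ 5 := by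
  wlog hsort : Antitone (excess u) generalizing u
  · refine this (hu.perm (Tuple.sort fun i => -excess u i)) fun i j hij => ?_
    rw [excess_perm, excess_perm]
    exact neg_le_neg_iff.1 (Tuple.monotone_sort (fun i => -excess u i) hij)
  wlog hneg : ∀ j, j ≠ 0 → ⟪u 0, u j⟫ ≤ 0 generalizing u
  · have hε : ∀ i, (fun j => if j = 0 ∨ ⟪u 0, u j⟫ ≤ 0 then (1 : ℝ) else -1) i = 1 ∨
        (fun j => if j = 0 ∨ ⟪u 0, u j⟫ ≤ 0 then (1 : ℝ) else -1) i = -1 := fun i => by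
      dsimp only
      split_ifs <;> simp
    refine this (hu.flip hε) (fun i j hij => ?_) fun j hj => ?_
    · rw [excess_flip u hε, excess_flip u hε]
      exact hsort hij
    · by_cases h : ⟪u 0, u j⟫ ≤ 0
      · simp [h]
      · simp [h, hj, (not_le.1 h).le]
  obtain ⟨n, hn, hs⟩ := exists_signs hneg
  rcases exists_coeff (hsort (by decide : (0 : Fin 5) ≤ 1)) (hsort (by decide : (1 : Fin 5) ≤ 2))
    (hsort (by decide : (2 : Fin 5) ≤ 3)) (hsort (by decide : (3 : Fin 5) ≤ 4))
    (hu.excess_nonneg 4) hu.excess_zero_le with ⟨c, hc, hcu⟩ | ⟨c, hc, hcu⟩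
  · exact (valid_listOne n hn).det_sq_le hT hC hR hu.1 hu.excess_nonneg hs hc hcu
  · exact (valid_listTwo n hn).det_sq_le hT hC hR hu.1 hu.excess_nonneg hs hc hcu

lemma exists_round_of_monotone {g : Fin 6 → ℝ} (hg : Monotone g) (h : g 5 ≤ g 0 + 1) :
    ∃ w : Fin 6 → ℤ, ∑ i, ∑ j, ((g i - w i) - (g j - w j)) ^ 2 ≤ 35 / 6 := by
  set w : Fin 6 → Fin 6 → ℤ := fun k i => if 6 ≤ (k : ℕ) + i then 1 else 0 with hw
  set Q : Fin 6 → ℝ := fun k => ∑ i, ∑ j, ((g i - w k i) - (g j - w k j)) ^ 2 with hQ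
  obtain ⟨k, hk⟩ := Finite.exists_min Q
  refine ⟨w k, ?_⟩
  set α : Fin 6 → ℝ :=
    ![1 - (g 5 - g 0), g 5 - g 4, g 4 - g 3, g 3 - g 2, g 2 - g 1, g 1 - g 0] with hα
  have hα0 : ∀ j, 0 ≤ α j := by
    have h1 := hg (by decide : (0 : Fin 6) ≤ 1)
    have h2 := hg (by decide : (1 : Fin 6) ≤ 2)
    have h3 := hg (by decide : (2 : Fin 6) ≤ 3)
    have h4 := hg (by decide : (3 : Fin 6) ≤ 4)
    have h5 := hg (by decide : (4 : Fin 6) ≤ 5)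
    intro j
    fin_cases j <;> simp [hα] <;> linarith
  have hsum : ∑ j, α j = 1 := by
    simp [hα, Fin.sum_univ_six]
    ring
  have hid : ∑ j, α j * Q j + ∑ i : Fin 6, ∑ j : Fin 6, (g j - g i - ((j : ℝ) - i) / 6) ^ 2 =
      35 / 6 := by
    simp only [hα, hQ, hw, Fin.sum_univ_six]
    simp
    ring
  have hsq : 0 ≤ ∑ i : Fin 6, ∑ j : Fin 6, (g j - g i - ((j : ℝ) - i) / 6) ^ 2 :=
    Finset.sum_nonneg fun _ _ => Finset.sum_nonneg fun _ _ => sq_nonneg _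
  have hle : Q k ≤ ∑ j, α j * Q j := by
    rw [← one_mul (Q k), ← hsum, Finset.sum_mul]
    exact Finset.sum_le_sum fun j _ => mul_le_mul_of_nonneg_left (hk j) (hα0 j)
  change Q k ≤ _
  linarith

lemma exists_round (y : Fin 6 → ℝ) :
    ∃ m : Fin 6 → ℤ, ∑ i, ∑ j, ((y i - m i) - (y j - m j)) ^ 2 ≤ 35 / 6 := by
  set f : Fin 6 → ℝ := fun i => Int.fract (y i) with hf
  obtain ⟨σ, hσ⟩ : ∃ σ : Equiv.Perm (Fin 6), Monotone (f ∘ σ) := ⟨_, Tuple.monotone_sort f⟩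
  obtain ⟨w, hw⟩ := exists_round_of_monotone hσ (by
    have h1 := Int.fract_lt_one (y (σ 5))
    have h2 := Int.fract_nonneg (y (σ 0))
    simp only [Function.comp_apply, hf]
    linarith)
  refine ⟨fun i => ⌊y i⌋ + w (σ.symm i), le_trans (le_of_eq ?_) hw⟩
  rw [← Equiv.sum_comp σ]
  refine Finset.sum_congr rfl fun i _ => ?_
  rw [← Equiv.sum_comp σ]
  refine Finset.sum_congr rfl fun j _ => ?_
  simp only [Equiv.symm_apply_apply, Function.comp_apply, hf, Int.fract]
  push_cast
  ring

/-- The matrix of a basis of the scaled lattice `A₅*` whose covering radius is `1`. -/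
def dualAFive : Matrix (Fin 5) (Fin 5) ℝ :=
  (√(12 / 35) * √6) • ((1 : Matrix (Fin 5) (Fin 5) ℝ) +
    Matrix.replicateCol Unit (fun _ : Fin 5 => (1 - √6) / (5 * √6)) *
      Matrix.replicateRow Unit (1 : Fin 5 → ℝ))

lemma det_dualAFive_sq : dualAFive.det ^ 2 = 1296 * (12 / 35) ^ 5 := by
  have h6 : √6 ^ 2 = 6 := Real.sq_sqrt (by norm_num)
  have hl : √(12 / 35) ^ 2 = 12 / 35 := Real.sq_sqrt (by norm_num)
  have h0 : √6 ≠ 0 := by positivity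
  rw [dualAFive, Matrix.det_smul, Matrix.det_one_add_replicateCol_mul_replicateRow]
  have h1 : √6 * (1 + (1 : Fin 5 → ℝ) ⬝ᵥ fun _ => (1 - √6) / (5 * √6)) = 1 := by
    simp [dotProduct]
    field_simp
    ring
  have h2 : (√(12 / 35) * √6) ^ 5 * (1 + (1 : Fin 5 → ℝ) ⬝ᵥ fun _ => (1 - √6) / (5 * √6)) =
      √(12 / 35) ^ 5 * √6 ^ 4 := by
    linear_combination √(12 / 35) ^ 5 * √6 ^ 4 * h1
  rw [Fintype.card_fin, h2]
  calc (√(12 / 35) ^ 5 * √6 ^ 4) ^ 2 = (√(12 / 35) ^ 2) ^ 5 * (√6 ^ 2) ^ 4 := by ring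
    _ = _ := by rw [h6, hl]; norm_num

lemma norm_dualAFive_sq (x : Euc 5) :
    ‖Matrix.toEuclideanLin dualAFive x‖ ^ 2 = 12 / 35 * (6 * ∑ i, x i ^ 2 - (∑ i, x i) ^ 2) := by
  have h6 : √6 ^ 2 = 6 := Real.sq_sqrt (by norm_num)
  have hl : √(12 / 35) ^ 2 = 12 / 35 := Real.sq_sqrt (by norm_num)
  have h0 : √6 ≠ 0 := by positivity
  have h1 : ∀ i, Matrix.toEuclideanLin dualAFive x i =
      √(12 / 35) * (√6 * x i + (1 - √6) / 5 * ∑ j, x j) := fun i => by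
    simp [Matrix.toLpLin_apply, dualAFive,
      Matrix.mulVec, dotProduct, Matrix.mul_apply, ← Finset.mul_sum]
    field_simp
  rw [EuclideanSpace.norm_sq_eq]
  simp only [h1, Real.norm_eq_abs, sq_abs, mul_pow, hl]
  rw [← Finset.mul_sum]
  congr 1
  have h2 : ∀ i, (√6 * x i + (1 - √6) / 5 * ∑ j, x j) ^ 2 = 6 * x i ^ 2 +
      2 * √6 * ((1 - √6) / 5) * (∑ j, x j) * x i + ((1 - √6) / 5) ^ 2 * (∑ j, x j) ^ 2 :=
    fun i => by linear_combination x i ^ 2 * h6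
  simp only [h2, Finset.sum_add_distrib, ← Finset.mul_sum, Finset.sum_const, Finset.card_univ,
    Fintype.card_fin, nsmul_eq_mul]
  push_cast
  linear_combination -(1 / 5) * (∑ j, x j) ^ 2 * h6

lemma det_toEuclideanLin_dualAFive :
    LinearMap.det (Matrix.toEuclideanLin dualAFive) = dualAFive.det := by
  rw [Matrix.toEuclideanLin, Matrix.toLpLin_eq_toLin, LinearMap.det_toLin]

lemma isCoveringLattice_iff {T : Euc 5 →ₗ[ℝ] Euc 5} {K : Set (Euc 5)} :
    IsCoveringLattice T K ↔ ∀ x, ∃ v ∈ T '' intPoints 5, x - v ∈ K := by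
  simp only [IsCoveringLattice, eq_univ_iff_forall, mem_iUnion, mem_vadd_set_iff_neg_vadd_mem,
    vadd_eq_add, neg_add_eq_sub, exists_prop]

lemma isCoveringLattice_dualAFive :
    IsCoveringLattice (Matrix.toEuclideanLin dualAFive) (unitBall 5) := by
  rw [isCoveringLattice_iff]
  intro x
  have hdet : LinearMap.det (Matrix.toEuclideanLin dualAFive) ≠ 0 := fun h => by
    have := det_dualAFive_sq
    rw [← det_toEuclideanLin_dualAFive, h] at this
    norm_num at this
  obtain ⟨y, rfl⟩ := (LinearMap.equivOfDetNeZero _ hdet).surjective x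
  obtain ⟨m, hm⟩ := exists_round (Fin.cons 0 y)
  refine ⟨_, mem_image_of_mem _ (fun i => ⟨m i.succ - m 0, rfl⟩ :
    WithLp.toLp 2 (fun i : Fin 5 => ((m i.succ - m 0 : ℤ) : ℝ)) ∈ intPoints 5), ?_⟩
  rw [unitBall, mem_closedBall_zero_iff, ← sq_le_one_iff₀ (norm_nonneg _)]
  change ‖Matrix.toEuclideanLin dualAFive y - _‖ ^ 2 ≤ 1
  rw [← map_sub, norm_dualAFive_sq]
  simp only [Fin.sum_univ_succ (n := 5), Fin.cons_zero, Fin.cons_succ] at hm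
  simp only [Fin.sum_univ_five, Fin.succ_zero_eq_one, PiLp.sub_apply,
    show Fin.succ (1 : Fin 5) = 2 from rfl, show Fin.succ (2 : Fin 5) = 3 from rfl,
    show Fin.succ (3 : Fin 5) = 4 from rfl, show Fin.succ (4 : Fin 5) = 5 from rfl] at hm ⊢
  push_cast
  linarith

/-- The ball with two small antipodal bulges of height `R - 1` in the directions `±p`. -/
def bulge (p : Euc 5) (R : ℝ) : Set (Euc 5) :=
  {x | ‖x‖ ≤ R ∧ ∀ u, ‖u‖ ≤ 1 → R * |⟪u, p⟫| ≤ 1 → ⟪x, u⟫ ≤ 1}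

lemma unitBall_subset_bulge (p : Euc 5) {R : ℝ} (hR : 1 ≤ R) : unitBall 5 ⊆ bulge p R := by
  intro x hx
  rw [unitBall, mem_closedBall_zero_iff] at hx
  exact ⟨hx.trans hR, fun u hu _ => (real_inner_le_norm x u).trans
    (mul_le_one₀ hx (norm_nonneg u) hu)⟩

lemma isSymmConvexBody_bulge (p : Euc 5) {R : ℝ} (hR : 1 ≤ R) : IsSymmConvexBody (bulge p R) := by
  refine ⟨Metric.isCompact_of_isClosed_isBounded ?_ ?_, ?_, ⟨0, ?_⟩, ?_⟩
  · simp only [bulge, ofPred_and, ofPred_forall]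
    exact (isClosed_le continuous_norm continuous_const).inter <| isClosed_iInter fun u =>
      isClosed_iInter fun _ => isClosed_iInter fun _ => isClosed_le (by fun_prop) continuous_const
  · exact isBounded_iff_forall_norm_le.2 ⟨R, fun x hx => hx.1⟩
  · rintro x ⟨hx, hx'⟩ y ⟨hy, hy'⟩ a b ha hb hab
    refine ⟨?_, fun u hu hup => ?_⟩
    · refine (norm_add_le _ _).trans ?_
      rw [norm_smul, norm_smul, Real.norm_of_nonneg ha, Real.norm_of_nonneg hb]
      nlinarith
    · rw [inner_add_left, real_inner_smul_left, real_inner_smul_left]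
      nlinarith [hx' u hu hup, hy' u hu hup]
  · exact interior_mono (unitBall_subset_bulge p hR)
      (mem_interior_iff_mem_nhds.2 (Metric.closedBall_mem_nhds _ one_pos))
  · have key : ∀ x ∈ bulge p R, -x ∈ bulge p R := fun x hx => by
      refine ⟨by rw [norm_neg]; exact hx.1, fun u hu hup => ?_⟩
      rw [inner_neg_left, ← inner_neg_right]
      exact hx.2 (-u) (by rwa [norm_neg]) (by rwa [inner_neg_left, abs_neg])
    ext x
    exact ⟨fun hx => key x hx, fun hx => neg_neg x ▸ key (-x) hx⟩

lemma unitBall_ssubset_bulge {p : Euc 5} (hp : ‖p‖ = 1) {R : ℝ} (hR : 1 < R) :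
    unitBall 5 ⊂ bulge p R := by
  refine ⟨unitBall_subset_bulge p hR.le, fun h => ?_⟩
  have hn : ‖R • p‖ = R := by rw [norm_smul, hp, mul_one, Real.norm_of_nonneg (by linarith)]
  have hm : R • p ∈ bulge p R := by
    refine ⟨hn.le, fun u _ hup => ?_⟩
    rw [real_inner_smul_left, real_inner_comm]
    exact (mul_le_mul_of_nonneg_left (le_abs_self _) (by linarith)).trans hup
  have := h hm
  rw [unitBall, mem_closedBall_zero_iff, hn] at this
  linarith

lemma norm_sub_le_or_of_mem_bulge {p : Euc 5} (hp : ‖p‖ = 1) {R : ℝ} (hR : 1 ≤ R) {x : Euc 5}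
    (hx : x ∈ bulge p R) (h1 : 1 < ‖x‖) :
    ‖x - p‖ ^ 2 ≤ R ^ 2 - 1 ∨ ‖x + p‖ ^ 2 ≤ R ^ 2 - 1 := by
  have hR0 : 0 < R := by linarith
  have hx0 : 0 < ‖x‖ := by linarith
  have h2 : ‖x‖ ≤ R * |⟪x, p⟫| := by
    by_contra! h
    have := hx.2 (‖x‖⁻¹ • x) (by rw [norm_smul, norm_inv, norm_norm, inv_mul_cancel₀ hx0.ne']) (by
      rw [real_inner_smul_left, abs_mul, abs_inv, abs_norm]
      field_simp
      exact h.le)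
    rw [real_inner_smul_right, real_inner_self_eq_norm_sq, sq, inv_mul_cancel_left₀ hx0.ne'] at this
    linarith
  have h3 : ‖x‖ ^ 2 - 2 * |⟪x, p⟫| + 1 ≤ R ^ 2 - 1 := by
    have h4 : 0 ≤ (R - ‖x‖) * (R * (R + ‖x‖) - 2) :=
      mul_nonneg (sub_nonneg.2 hx.1) (by nlinarith)
    refine le_of_mul_le_mul_left ?_ hR0
    nlinarith
  rcases le_total 0 ⟪x, p⟫ with h | h
  · left
    rw [abs_of_nonneg h] at h3
    rw [norm_sub_sq_real, hp]
    linarith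
  · right
    rw [abs_of_nonpos h] at h3
    rw [norm_add_sq_real, hp]
    linarith

lemma det_sq_le_of_bulge {p : Euc 5} (hp : ‖p‖ = 1) {R : ℝ} (hR : 1 ≤ R)
    (hR' : R ^ 2 ≤ 1 + (1 / 99) ^ 2) {T : Euc 5 →ₗ[ℝ] Euc 5} (hT : LinearMap.det T ≠ 0)
    (hC : IsCoveringLattice T (bulge p R)) : LinearMap.det T ^ 2 ≤ 1296 * (12 / 35) ^ 5 := by
  rw [isCoveringLattice_iff] at hC
  have hC' : ∀ x, ∃ v ∈ T '' intPoints 5, ‖x - v‖ ≤ R := fun x => by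
    obtain ⟨v, hv, hx⟩ := hC x
    exact ⟨v, hv, hx.1⟩
  obtain ⟨m, hm, ⟨b, hb, rfl⟩ | ⟨u, hu, rfl⟩ | ⟨w, hw, rfl⟩⟩ := exists_min_frame hT
  · refine hb.det_sq_le hT (p := p) hC (fun x hx => hx.1) hR' (fun x hx h1 => ?_) hm
    refine (norm_sub_le_or_of_mem_bulge hp hR hx h1).imp ?_ ?_ <;>
      exact fun h => abs_le_of_sq_le_sq' (by linarith) (by norm_num) |>.2
  · exact IsMinD.det_sq_le hT hC' hR' ⟨hu, hm⟩
  · refine (hw.det_sq_le hT hC' hm).trans ?_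
    rw [mul_pow]
    have := pow_le_pow_left₀ (sq_nonneg R) hR' 5
    norm_num at this ⊢
    linarith

/-- The ball `B⁵` is extensible: some origin-symmetric convex body properly containing
`B⁵` has the same critical covering determinant as `B⁵`. -/
theorem ball5_extensible :
    ∃ K : Set (Euc 5), IsSymmConvexBody K ∧ unitBall 5 ⊂ K ∧
      critCoveringDet K = critCoveringDet (unitBall 5) := by
  set p : Euc 5 := EuclideanSpace.single 0 1 with hp
  have hp1 : ‖p‖ = 1 := by simp [hp]
  set R : ℝ := 20001 / 20000 with hR
  have hR1 : 1 < R := by norm_num [hR]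
  have hR2 : R ^ 2 ≤ 1 + (1 / 99) ^ 2 := by norm_num [hR]
  have hval : ∀ K, unitBall 5 ⊆ K → K ⊆ bulge p R →
      critCoveringDet K = |LinearMap.det (Matrix.toEuclideanLin dualAFive)| := fun K h1 h2 => by
    refine IsGreatest.csSup_eq ⟨⟨_, fun h => ?_, ?_, rfl⟩, ?_⟩
    · have := det_dualAFive_sq
      rw [← det_toEuclideanLin_dualAFive, h] at this
      norm_num at this
    · rw [isCoveringLattice_iff]
      intro x
      obtain ⟨v, hv, hx⟩ := isCoveringLattice_iff.1 isCoveringLattice_dualAFive x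
      exact ⟨v, hv, h1 hx⟩
    · rintro _ ⟨T, hT, hC, rfl⟩
      rw [← sq_le_sq, det_toEuclideanLin_dualAFive, det_dualAFive_sq]
      refine det_sq_le_of_bulge hp1 hR1.le hR2 hT (isCoveringLattice_iff.2 fun x => ?_)
      obtain ⟨v, hv, hx⟩ := isCoveringLattice_iff.1 hC x
      exact ⟨v, hv, h2 hx⟩
  refine ⟨bulge p R, isSymmConvexBody_bulge p hR1.le, unitBall_ssubset_bulge hp1 hR1, ?_⟩
  rw [hval _ (unitBall_subset_bulge p hR1.le) subset_rfl,
    hval _ subset_rfl (unitBall_subset_bulge p hR1.le)]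
end
end

section
/- Let S be an n-dimensional simplex with vertices x₁,…,x_{n+1} on the unit sphere of ℝⁿ whose circumcenter is the origin, with barycentric coordinates α₁,…,α_{n+1} of the circumcenter (so Σⱼ αⱼ xⱼ = 0 and Σⱼ αⱼ = 1), and let Q_S be the associated symmetric map Q_S(v) = Σⱼ αⱼ⟨xⱼ,v⟩xⱼ. Then for every nonsingular linear map T : ℝⁿ → ℝⁿ, setting M = TᵀT − Id, the circumradius of the simplex TS satisfies cr(TS)² = 1 + trace(M∘Q_S) + ‖c‖², where c is the circumcenter of TS. In particular cr(TS)² ≥ 1 + trace(M∘Q_S). -/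
open Set Pointwise MeasureTheory
open scoped RealInnerProductSpace

noncomputable section

/-- The symmetric map `Q_S` associated to a simplex `S` with vertices `x j` on the unit
sphere and barycentric coordinates `α j` of the circumcenter:
`Q_S(v) = Σⱼ αⱼ ⟨xⱼ, v⟩ xⱼ`. -/
def QS {n : ℕ} (x : Fin (n + 1) → Euc n) (α : Fin (n + 1) → ℝ) : Euc n →ₗ[ℝ] Euc n :=
  ∑ j, α j • ((innerSL ℝ (x j)).toLinearMap.smulRight (x j))

theorem trace_comp_QS {n : ℕ} (A : Euc n →ₗ[ℝ] Euc n) (x : Fin (n + 1) → Euc n)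
    (α : Fin (n + 1) → ℝ) :
    LinearMap.trace ℝ (Euc n) (A ∘ₗ QS x α) = ∑ j, α j * ⟪x j, A (x j)⟫ := by
  have h : A ∘ₗ QS x α =
      ∑ j, α j • ((innerSL ℝ (x j)).toLinearMap.smulRight (A (x j))) := by
    ext1 v
    simp [QS, LinearMap.sum_apply]
  simp [h, map_sum, LinearMap.trace_smulRight]

/-- For a simplex with vertices `x j` on the unit sphere, circumcenter at the origin with
barycentric coordinates `α j`, and a nonsingular linear map `T` with `M = TᵀT − Id`:
if `c` and `R` are the circumcenter and circumradius of `T·S` (i.e. `dist (T xⱼ) c = R`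
for all `j`), then `cr(TS)² = R² = 1 + ⟨M, Q_S⟩ + ‖c‖²`; in particular
`cr(TS)² ≥ 1 + ⟨M, Q_S⟩`. -/
theorem circumradius_of_image {n : ℕ} (x : Fin (n + 1) → Euc n) (hx : ∀ j, ‖x j‖ = 1)
    (haff : AffineIndependent ℝ x)
    (α : Fin (n + 1) → ℝ) (hα1 : ∑ j, α j = 1) (hα0 : ∑ j, α j • x j = 0)
    (T : Euc n →ₗ[ℝ] Euc n) (hT : LinearMap.det T ≠ 0)
    (c : Euc n) (R : ℝ) (hcirc : ∀ j, dist (T (x j)) c = R) :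
    R ^ 2 = 1 + LinearMap.trace ℝ (Euc n)
        ((LinearMap.adjoint T ∘ₗ T - LinearMap.id) ∘ₗ QS x α) + ‖c‖ ^ 2 ∧
    1 + LinearMap.trace ℝ (Euc n)
        ((LinearMap.adjoint T ∘ₗ T - LinearMap.id) ∘ₗ QS x α) ≤ R ^ 2 := by
  have hR : ∀ j, R ^ 2 = ‖T (x j)‖ ^ 2 - 2 * ⟪T (x j), c⟫ + ‖c‖ ^ 2 := fun j => by
    rw [← hcirc j, dist_eq_norm, norm_sub_sq_real]
  have hT0 : ∑ j, α j * ⟪T (x j), c⟫ = 0 := by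
    have h := congrArg (fun v => ⟪T v, c⟫) hα0
    simpa [sum_inner, real_inner_smul_left] using h
  have htrace : LinearMap.trace ℝ (Euc n)
      ((LinearMap.adjoint T ∘ₗ T - LinearMap.id) ∘ₗ QS x α) =
      ∑ j, α j * ‖T (x j)‖ ^ 2 - 1 := by
    simp [trace_comp_QS, inner_sub_right, LinearMap.adjoint_inner_right, hx, mul_sub, hα1]
  have hsum : R ^ 2 = ∑ j, α j * ‖T (x j)‖ ^ 2 + ‖c‖ ^ 2 := by
    calc R ^ 2 = ∑ j, α j * R ^ 2 := by rw [← Finset.sum_mul, hα1, one_mul]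
      _ = ∑ j, (α j * ‖T (x j)‖ ^ 2 - 2 * (α j * ⟪T (x j), c⟫) + α j * ‖c‖ ^ 2) :=
        Finset.sum_congr rfl fun j _ => by rw [hR j]; ring
      _ = _ := by
        rw [Finset.sum_add_distrib, Finset.sum_sub_distrib, ← Finset.mul_sum, hT0,
          ← Finset.sum_mul, hα1]
        ring
  rw [htrace]
  constructor
  · linarith
  · linarith [sq_nonneg ‖c‖]
end
end
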